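/- Let G be a finite group with identity 1, ρ a finite-dimensional unitary representation of G with character χ = Tr ρ, and Δ_G := min_{g≠1} Re(χ(1) − χ(g)). Let β ≥ (1/Δ_G)(114 + 4 log|G|), let L ≥ 0, and let B₁, B₂ ⊆ Λ be rectangles at ℓ∞ distance at least L from each other (i.e., every vertex of B₁ is at ℓ∞ distance at least L from every vertex of B₂). Let k₁, k₂ ≥ 1, let f₁ : G^{k₁} → ℂ and f₂ : G^{k₂} → ℂ be conjugacy invariant, and for i = 1, 2 let γ₁^{(i)}, …, γ_{k_i}^{(i)} be closed loops contained in B_i. Let Σ be a random edge configuration with law μ_{Λ,β}. Then |Cov(f₁(Σ_{γ₁^{(1)}}, …, Σ_{γ_{k₁}^{(1)}}), f₂(Σ_{γ₁^{(2)}}, …, Σ_{γ_{k₂}^{(2)}}))| ≤ 4 (4·10²⁴ |G|²)^{|B₁|+|B₂|} ‖f₁‖_∞ ‖f₂‖_∞ e^{−(β/2) Δ_G (L−1)}. -/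

import Mathlib

open Classical SimpleGraph
open scoped BigOperators

noncomputable section

namespace LGT

/-- A site of `ℤ⁴`. -/
abbrev Site : Type := Fin 4 → ℤ

/-- The `i`-th coordinate unit vector. -/
def unit (i : Fin 4) : Site := fun j => if j = i then 1 else 0

lemma unit_apply_self (i : Fin 4) : unit i i = 1 := by simp [unit]

lemma unit_apply_nonneg (i j : Fin 4) : 0 ≤ unit i j := by
  by_cases h : j = i <;> simp [unit, h]

lemma unit_ne_zero (i : Fin 4) : unit i ≠ 0 := by
  intro h
  have h1 := congrFun h i
  rw [unit_apply_self] at h1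
  exact one_ne_zero h1

/-- The lattice `Λ = ([a₁,b₁] × ⋯ × [a₄,b₄]) ∩ ℤ⁴`, with all side lengths equal. -/
structure Box where
  a : Fin 4 → ℤ
  b : Fin 4 → ℤ
  side_eq : ∀ i j : Fin 4, b i - a i = b j - a j

/-- Membership of a site in the lattice `Λ`. -/
def Box.mem (Λ : Box) (x : Site) : Prop := ∀ i, Λ.a i ≤ x i ∧ x i ≤ Λ.b i

/-- The set of vertices `Λ₀` of the lattice. -/
abbrev VSite (Λ : Box) : Type := {x : Site // Λ.mem x}

lemma not_both {x y : Site} {i j : Fin 4} (h1 : y = x + unit i) (h2 : x = y + unit j) :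
    False := by
  subst h1
  rw [add_assoc] at h2
  have h3 : unit i + unit j = 0 := left_eq_add.mp h2
  have h4 := congrFun h3 i
  rw [Pi.add_apply, Pi.zero_apply, unit_apply_self] at h4
  have h5 : (0:ℤ) ≤ unit j i := unit_apply_nonneg j i
  omega

/-- The 1-skeleton `S₁(Λ)` of the lattice, as a graph on the vertices of `Λ`:
two vertices are adjacent iff they differ by a coordinate unit vector. -/
def latticeGraph (Λ : Box) : SimpleGraph (VSite Λ) where
  Adj u v := ∃ i : Fin 4, (v : Site) = (u : Site) + unit i ∨ (u : Site) = (v : Site) + unit i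
  symm := by
    constructor
    rintro u v ⟨i, h | h⟩
    · exact ⟨i, Or.inr h⟩
    · exact ⟨i, Or.inl h⟩
  loopless := by
    constructor
    rintro u ⟨i, h | h⟩ <;> exact unit_ne_zero i (left_eq_add.mp h)

/-- The set `Λ₁` of positively oriented nearest-neighbour edges of `Λ`:
an edge is a pair (base site, direction) whose endpoints both lie in `Λ`. -/
abbrev PEdge (Λ : Box) : Type :=
  {e : Site × Fin 4 // Λ.mem e.1 ∧ Λ.mem (e.1 + unit e.2)}

/-- The initial vertex of a positively oriented edge. -/
def PEdge.v0 {Λ : Box} (e : PEdge Λ) : VSite Λ := ⟨e.1.1, e.2.1⟩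

/-- The final vertex of a positively oriented edge. -/
def PEdge.v1 {Λ : Box} (e : PEdge Λ) : VSite Λ := ⟨e.1.1 + unit e.1.2, e.2.2⟩

/-- Edge configurations `σ ∈ G^{Λ₁}`. -/
abbrev EdgeConf (Λ : Box) (G : Type*) : Type _ := PEdge Λ → G

variable {G : Type*} [Group G]

/-- The value of an edge configuration on an oriented edge `(u, v)`:
`σ_e` on positively oriented edges, `σ_e⁻¹` on negatively oriented ones. -/
def oval {Λ : Box} (σ : EdgeConf Λ G) (u v : VSite Λ) : G :=
  if h : ∃ i : Fin 4, (v : Site) = (u : Site) + unit i then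
    σ ⟨((u : Site), h.choose), u.2, by rw [← h.choose_spec]; exact v.2⟩
  else if h' : ∃ i : Fin 4, (u : Site) = (v : Site) + unit i then
    (σ ⟨((v : Site), h'.choose), v.2, by rw [← h'.choose_spec]; exact u.2⟩)⁻¹
  else 1

/-- The holonomy `σ_γ = σ_{e₁} ⋯ σ_{eₙ}` of an edge configuration along a walk. -/
def hol {Λ : Box} (σ : EdgeConf Λ G) {u v : VSite Λ}
    (w : (latticeGraph Λ).Walk u v) : G :=
  (w.darts.map fun d => oval σ d.toProd.1 d.toProd.2).prod

@[simp] lemma hol_nil {Λ : Box} (σ : EdgeConf Λ G) {u : VSite Λ} :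
    hol σ (SimpleGraph.Walk.nil : (latticeGraph Λ).Walk u u) = 1 := by simp [hol]

lemma hol_cons {Λ : Box} (σ : EdgeConf Λ G) {u m v : VSite Λ}
    (h : (latticeGraph Λ).Adj u m) (q : (latticeGraph Λ).Walk m v) :
    hol σ (SimpleGraph.Walk.cons h q) = oval σ u m * hol σ q := by
  simp [hol]

lemma hol_append {Λ : Box} (σ : EdgeConf Λ G) {u v w : VSite Λ}
    (p : (latticeGraph Λ).Walk u v) (q : (latticeGraph Λ).Walk v w) :
    hol σ (p.append q) = hol σ p * hol σ q := by
  simp [hol, SimpleGraph.Walk.darts_append]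

lemma oval_mul_oval {Λ : Box} (σ : EdgeConf Λ G) {u v : VSite Λ}
    (h : (latticeGraph Λ).Adj u v) : oval σ u v * oval σ v u = 1 := by
  obtain ⟨i, hi | hi⟩ := h
  · have h1 : ∃ k : Fin 4, (v : Site) = (u : Site) + unit k := ⟨i, hi⟩
    have h2 : ¬ ∃ k : Fin 4, (u : Site) = (v : Site) + unit k := by
      rintro ⟨k, hk⟩; exact not_both hi hk
    simp only [oval]
    rw [dif_pos h1, dif_neg h2, dif_pos h1]
    exact mul_inv_cancel _
  · have h1 : ∃ k : Fin 4, (u : Site) = (v : Site) + unit k := ⟨i, hi⟩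
    have h2 : ¬ ∃ k : Fin 4, (v : Site) = (u : Site) + unit k := by
      rintro ⟨k, hk⟩; exact not_both hk hi
    simp only [oval]
    rw [dif_neg h2, dif_pos h1, dif_pos h1]
    exact inv_mul_cancel _

/-- One step of combinatorial homotopy of walks in the 1-skeleton:
inserting or removing a backtracking `e e⁻¹`. -/
inductive HStep {Λ : Box} :
    {u v : VSite Λ} → (latticeGraph Λ).Walk u v → (latticeGraph Λ).Walk u v → Prop
  | mk {u x y v : VSite Λ} (p : (latticeGraph Λ).Walk u x) (h : (latticeGraph Λ).Adj x y)
      (q : (latticeGraph Λ).Walk x v) :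
      HStep (p.append (SimpleGraph.Walk.cons h (SimpleGraph.Walk.cons h.symm q)))
        (p.append q)

/-- Two walks in the 1-skeleton are homotopic if they differ by finitely many
insertions/removals of backtrackings.  The equivalence classes of closed walks based
at `x₀` are exactly the elements of the fundamental group `π₁(S₁(Λ), x₀)`. -/
def Homotopic {Λ : Box} {u v : VSite Λ}
    (w₁ w₂ : (latticeGraph Λ).Walk u v) : Prop :=
  Relation.EqvGen (@HStep Λ u v) w₁ w₂

lemma hol_of_hstep {Λ : Box} (σ : EdgeConf Λ G) {u v : VSite Λ}
    {w₁ w₂ : (latticeGraph Λ).Walk u v} (h : HStep w₁ w₂) : hol σ w₁ = hol σ w₂ := by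
  cases h with
  | mk p had q =>
    simp only [hol_append, hol_cons, ← mul_assoc]
    rw [mul_assoc (hol σ p), oval_mul_oval σ had, mul_one]

lemma hol_homotopic {Λ : Box} (σ : EdgeConf Λ G) {u v : VSite Λ}
    {w₁ w₂ : (latticeGraph Λ).Walk u v} (h : Homotopic w₁ w₂) : hol σ w₁ = hol σ w₂ := by
  induction h with
  | rel _ _ hs => exact hol_of_hstep σ hs
  | refl _ => rfl
  | symm _ _ _ ih => exact ih.symm
  | trans _ _ _ _ _ ih₁ ih₂ => exact ih₁.trans ih₂

/-- The set `Ω = Hom(π₁(S₁(Λ), x₀), G)` of homomorphisms from the fundamental group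
of the 1-skeleton based at `x₀` to `G`, modelled as functions on closed walks at `x₀`
that are homotopy invariant and multiplicative under concatenation. -/
structure Hom (Λ : Box) (x₀ : VSite Λ) (G : Type*) [Group G] where
  toFun : (latticeGraph Λ).Walk x₀ x₀ → G
  invariant : ∀ w₁ w₂ : (latticeGraph Λ).Walk x₀ x₀, Homotopic w₁ w₂ → toFun w₁ = toFun w₂
  map_mul : ∀ w₁ w₂ : (latticeGraph Λ).Walk x₀ x₀, toFun (w₁.append w₂) = toFun w₁ * toFun w₂

/-- The map `ψ_{x₀} : G^{Λ₁} → Ω` sending an edge configuration to the induced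
homomorphism of the fundamental group, given by holonomy along loops. -/
def psi (Λ : Box) (x₀ : VSite Λ) (σ : EdgeConf Λ G) : Hom Λ x₀ G where
  toFun := hol σ
  invariant := fun _ _ h => hol_homotopic σ h
  map_mul := fun w₁ w₂ => hol_append σ w₁ w₂


/-- The set `Λ₂` of plaquettes of `Λ`: unit squares, given by a base site and two
distinct directions, all four of whose corners (hence all four boundary edges) lie in `Λ`. -/
abbrev Plaq (Λ : Box) : Type :=
  {q : Site × Fin 4 × Fin 4 //
    q.2.1 < q.2.2 ∧ Λ.mem q.1 ∧ Λ.mem (q.1 + unit q.2.1) ∧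
    Λ.mem (q.1 + unit q.2.1 + unit q.2.2) ∧ Λ.mem (q.1 + unit q.2.2)}

namespace Plaq

variable {Λ : Box}

/-- First corner `x₁` of a plaquette. -/
def c0 (p : Plaq Λ) : VSite Λ := ⟨p.1.1, p.2.2.1⟩
/-- Second corner `x₂` of a plaquette. -/
def c1 (p : Plaq Λ) : VSite Λ := ⟨p.1.1 + unit p.1.2.1, p.2.2.2.1⟩
/-- Third corner `x₃` of a plaquette. -/
def c2 (p : Plaq Λ) : VSite Λ := ⟨p.1.1 + unit p.1.2.1 + unit p.1.2.2, p.2.2.2.2.1⟩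
/-- Fourth corner `x₄` of a plaquette. -/
def c3 (p : Plaq Λ) : VSite Λ := ⟨p.1.1 + unit p.1.2.2, p.2.2.2.2.2⟩

/-- A site is a corner (vertex) of the plaquette. -/
def isCorner (p : Plaq Λ) (x : Site) : Prop :=
  x = (p.c0 : Site) ∨ x = (p.c1 : Site) ∨ x = (p.c2 : Site) ∨ x = (p.c3 : Site)

lemma adj01 (p : Plaq Λ) : (latticeGraph Λ).Adj p.c0 p.c1 := ⟨p.1.2.1, Or.inl rfl⟩
lemma adj12 (p : Plaq Λ) : (latticeGraph Λ).Adj p.c1 p.c2 := ⟨p.1.2.2, Or.inl rfl⟩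
lemma adj23 (p : Plaq Λ) : (latticeGraph Λ).Adj p.c2 p.c3 :=
  ⟨p.1.2.1, Or.inr (add_right_comm p.1.1 (unit p.1.2.1) (unit p.1.2.2))⟩
lemma adj30 (p : Plaq Λ) : (latticeGraph Λ).Adj p.c3 p.c0 := ⟨p.1.2.2, Or.inr rfl⟩

end Plaq

/-- The counter-clockwise boundary loop `γ_p : x₁ → x₂ → x₃ → x₄ → x₁` of a plaquette. -/
def plaqWalk {Λ : Box} (p : Plaq Λ) : (latticeGraph Λ).Walk p.c0 p.c0 :=
  SimpleGraph.Walk.cons p.adj01 (SimpleGraph.Walk.cons p.adj12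
    (SimpleGraph.Walk.cons p.adj23 (SimpleGraph.Walk.cons p.adj30 SimpleGraph.Walk.nil)))

variable {G : Type*} [Group G]

/-- The plaquette variable `σ_p`: the holonomy of `σ` around the boundary of `p`. -/
def holP {Λ : Box} (σ : EdgeConf Λ G) (p : Plaq Λ) : G := hol σ (plaqWalk p)

/-- The support of an edge configuration: the plaquettes `p` with `σ_p ≠ 1`. -/
def esupp {Λ : Box} (σ : EdgeConf Λ G) : Set (Plaq Λ) := {p | holP σ p ≠ 1}

/-- The character `χ = Tr ρ` of a unitary representation `ρ` of `G` of dimension `d`. -/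
def chi {G : Type*} [Group G] {d : ℕ} (ρ : G →* Matrix.unitaryGroup (Fin d) ℂ) (g : G) : ℂ :=
  Matrix.trace ((ρ g : Matrix (Fin d) (Fin d) ℂ))

/-- `Δ_G := min_{g ≠ 1} Re (χ(1) - χ(g))`. -/
def DeltaG (G : Type*) [Group G] (χ : G → ℂ) : ℝ :=
  sInf ((fun g => (χ 1 - χ g).re) '' {g : G | g ≠ 1})

/-- `φ_β(g) = exp(-β Re(χ(1) - χ(g)))`. -/
def phiB {G : Type*} [Group G] (χ : G → ℂ) (β : ℝ) (g : G) : ℝ :=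
  Real.exp (-(β * (χ 1 - χ g).re))

/-- The Wilson action `S_Λ(σ) = Σ_{p ∈ Λ₂} Re (χ(1) - χ(σ_p))`. -/
def action (Λ : Box) (χ : G → ℂ) (σ : EdgeConf Λ G) : ℝ :=
  ∑ᶠ p : Plaq Λ, (χ 1 - χ (holP σ p)).re

/-- The partition function `Z_{Λ,β}` of the lattice gauge theory. -/
def muZ (Λ : Box) (G : Type*) [Group G] (χ : G → ℂ) (β : ℝ) : ℝ :=
  ∑ᶠ σ : EdgeConf Λ G, Real.exp (-(β * action Λ χ σ))

/-- The probability `μ_{Λ,β}(σ) = Z⁻¹ e^{-β S_Λ(σ)}` of an edge configuration. -/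
def muP (Λ : Box) (χ : G → ℂ) (β : ℝ) (σ : EdgeConf Λ G) : ℝ :=
  Real.exp (-(β * action Λ χ σ)) / muZ Λ G χ β

/-- Expectation `E[f(Σ)]` for `Σ ∼ μ_{Λ,β}`. -/
def muE (Λ : Box) (χ : G → ℂ) (β : ℝ) (f : EdgeConf Λ G → ℂ) : ℂ :=
  ∑ᶠ σ : EdgeConf Λ G, (muP Λ χ β σ : ℂ) * f σ

/-- Covariance `Cov(f(Σ), g(Σ))` for `Σ ∼ μ_{Λ,β}`. -/
def muCov (Λ : Box) (χ : G → ℂ) (β : ℝ) (f g : EdgeConf Λ G → ℂ) : ℂ :=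
  muE Λ χ β (fun σ => f σ * g σ) - muE Λ χ β f * muE Λ χ β g

section HomSide

variable (Λ : Box) (x₀ : VSite Λ)

/-- Given fixed paths `ℓ(x₀,x)` and a closed loop `γ` based at `u`, the loop
`ξ_γ = ℓ(x₀,u) γ ℓ(x₀,u)⁻¹ ∈ π₁(S₁(Λ), x₀)` (as a based closed walk). -/
def xiLoop (ℓb : ∀ x : VSite Λ, (latticeGraph Λ).Walk x₀ x) {u : VSite Λ}
    (γ : (latticeGraph Λ).Walk u u) : (latticeGraph Λ).Walk x₀ x₀ :=
  (ℓb u).append (γ.append (ℓb u).reverse)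

variable {Λ x₀}

/-- `ψ(ξ_γ)` for a homomorphism `ψ ∈ Ω` and a closed loop `γ`. -/
def evalLoop (ψ : Hom Λ x₀ G) (ℓb : ∀ x : VSite Λ, (latticeGraph Λ).Walk x₀ x)
    {u : VSite Λ} (γ : (latticeGraph Λ).Walk u u) : G :=
  ψ.toFun (xiLoop Λ x₀ ℓb γ)

/-- `ψ(ξ_p)` for a plaquette `p`. -/
def evalP (ψ : Hom Λ x₀ G) (ℓb : ∀ x : VSite Λ, (latticeGraph Λ).Walk x₀ x)
    (p : Plaq Λ) : G :=
  evalLoop ψ ℓb (plaqWalk p)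

/-- The support `supp(ψ) = {p ∈ Λ₂ : ψ(ξ_p) ≠ 1}` of a homomorphism. -/
def hsupp (ψ : Hom Λ x₀ G) (ℓb : ∀ x : VSite Λ, (latticeGraph Λ).Walk x₀ x) :
    Set (Plaq Λ) :=
  {p | evalP ψ ℓb p ≠ 1}

variable (Λ x₀)

/-- The (unnormalized) weight `∏_{p ∈ Λ₂} φ_β(ψ(ξ_p))` of a homomorphism. -/
def nuW (χ : G → ℂ) (β : ℝ) (ℓb : ∀ x : VSite Λ, (latticeGraph Λ).Walk x₀ x)
    (ψ : Hom Λ x₀ G) : ℝ :=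
  ∏ᶠ p : Plaq Λ, phiB χ β (evalP ψ ℓb p)

/-- The normalizing constant `Z^ν_{Λ,β}`. -/
def nuZ (G : Type*) [Group G] (χ : G → ℂ) (β : ℝ)
    (ℓb : ∀ x : VSite Λ, (latticeGraph Λ).Walk x₀ x) : ℝ :=
  ∑ᶠ ψ : Hom Λ x₀ G, nuW Λ x₀ χ β ℓb ψ

/-- The probability `ν_{Λ,β}(ψ)` of a homomorphism. -/
def nuP (χ : G → ℂ) (β : ℝ) (ℓb : ∀ x : VSite Λ, (latticeGraph Λ).Walk x₀ x)
    (ψ : Hom Λ x₀ G) : ℝ :=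
  nuW Λ x₀ χ β ℓb ψ / nuZ Λ x₀ G χ β ℓb

/-- Expectation `E[h(Ψ)]` for `Ψ ∼ ν_{Λ,β}`. -/
def nuE (χ : G → ℂ) (β : ℝ) (ℓb : ∀ x : VSite Λ, (latticeGraph Λ).Walk x₀ x)
    (h : Hom Λ x₀ G → ℂ) : ℂ :=
  ∑ᶠ ψ : Hom Λ x₀ G, (nuP Λ x₀ χ β ℓb ψ : ℂ) * h ψ

/-- Covariance `Cov(h₁(Ψ), h₂(Ψ))` for `Ψ ∼ ν_{Λ,β}`. -/
def nuCov (χ : G → ℂ) (β : ℝ) (ℓb : ∀ x : VSite Λ, (latticeGraph Λ).Walk x₀ x)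
    (h₁ h₂ : Hom Λ x₀ G → ℂ) : ℂ :=
  nuE Λ x₀ χ β ℓb (fun ψ => h₁ ψ * h₂ ψ) - nuE Λ x₀ χ β ℓb h₁ * nuE Λ x₀ χ β ℓb h₂

/-- For `Ψ₁, Ψ₂` i.i.d. `∼ ν_{Λ,β}`, the probability `P((Ψ₁,Ψ₂) ∈ S)`. -/
def nuP2 (χ : G → ℂ) (β : ℝ) (ℓb : ∀ x : VSite Λ, (latticeGraph Λ).Walk x₀ x)
    (S : Set (Hom Λ x₀ G × Hom Λ x₀ G)) : ℝ :=
  ∑ᶠ pr ∈ S, nuP Λ x₀ χ β ℓb pr.1 * nuP Λ x₀ χ β ℓb pr.2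

end HomSide

/-- Conjugacy invariance: `f(h₁⁻¹g₁h₁, …, h_k⁻¹g_kh_k) = f(g₁, …, g_k)`. -/
def ConjInvariant {G : Type*} [Group G] {k : ℕ} (f : (Fin k → G) → ℂ) : Prop :=
  ∀ g h : Fin k → G, f (fun i => (h i)⁻¹ * g i * h i) = f g

/-- The sup norm `‖f‖_∞` of a complex-valued function. -/
def supNorm {α : Type*} (f : α → ℂ) : ℝ := ⨆ x, ‖f x‖


/-- A rectangle `B = [x₁,y₁] × ⋯ × [x₄,y₄]` contained in `Λ` (degenerate sides allowed). -/
structure Rect (Λ : Box) where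
  lo : Fin 4 → ℤ
  hi : Fin 4 → ℤ
  lo_le_hi : ∀ i, lo i ≤ hi i
  a_le_lo : ∀ i, Λ.a i ≤ lo i
  hi_le_b : ∀ i, hi i ≤ Λ.b i

namespace Rect

variable {Λ : Box}

/-- A site is a vertex of the rectangle. -/
def memV (B : Rect Λ) (x : Site) : Prop := ∀ i, B.lo i ≤ x i ∧ x i ≤ B.hi i

/-- A plaquette is contained in the rectangle (all four corners are vertices of it). -/
def plaqIn (B : Rect Λ) (p : Plaq Λ) : Prop :=
  B.memV (p.c0 : Site) ∧ B.memV (p.c1 : Site) ∧ B.memV (p.c2 : Site) ∧ B.memV (p.c3 : Site)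

/-- The set of plaquettes contained in the rectangle. -/
def plaqSet (B : Rect Λ) : Set (Plaq Λ) := {p | B.plaqIn p}

/-- `|B|`: the number of plaquettes contained in the rectangle. -/
def plaqCard (B : Rect Λ) : ℕ := Nat.card B.plaqSet

end Rect

/-- A walk is contained in a rectangle if all its vertices are vertices of the rectangle. -/
def WalkInRect {Λ : Box} (B : Rect Λ) {u v : VSite Λ}
    (w : (latticeGraph Λ).Walk u v) : Prop :=
  ∀ x ∈ w.support, B.memV (x : Site)

/-- The four boundary edges of a plaquette (as ordered pairs of vertices). -/
def plaqEdges {Λ : Box} (p : Plaq Λ) : List (VSite Λ × VSite Λ) :=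
  [(p.c0, p.c1), (p.c1, p.c2), (p.c3, p.c2), (p.c0, p.c3)]

/-- `(u,v)` is an (unoriented) edge of the 2-complex generated by the plaquette set `Q`. -/
def edgeInComplex {Λ : Box} (Q : Set (Plaq Λ)) (u v : VSite Λ) : Prop :=
  ∃ p ∈ Q, (u, v) ∈ plaqEdges p ∨ (v, u) ∈ plaqEdges p

/-- `u` is a vertex of the 2-complex generated by the plaquette set `Q`. -/
def vertexInComplex {Λ : Box} (Q : Set (Plaq Λ)) (u : VSite Λ) : Prop :=
  ∃ p ∈ Q, u = p.c0 ∨ u = p.c1 ∨ u = p.c2 ∨ u = p.c3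

/-- A walk lies in the 2-complex generated by `Q` if all its vertices and edges do. -/
def WalkInComplex {Λ : Box} (Q : Set (Plaq Λ)) {u v : VSite Λ}
    (w : (latticeGraph Λ).Walk u v) : Prop :=
  (∀ x ∈ w.support, vertexInComplex Q x) ∧
  (∀ d ∈ w.darts, edgeInComplex Q d.toProd.1 d.toProd.2)

/-- One step of combinatorial homotopy of walks within the 2-complex generated by `Q`:
inserting/removing a backtracking along an edge of the complex, or inserting/removing the
boundary loop of a plaquette of the complex. -/
inductive CHStep {Λ : Box} (Q : Set (Plaq Λ)) :
    {u v : VSite Λ} → (latticeGraph Λ).Walk u v → (latticeGraph Λ).Walk u v → Prop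
  | back {u x y v : VSite Λ} (p : (latticeGraph Λ).Walk u x) (h : (latticeGraph Λ).Adj x y)
      (he : edgeInComplex Q x y) (q : (latticeGraph Λ).Walk x v) :
      CHStep Q (p.append (SimpleGraph.Walk.cons h (SimpleGraph.Walk.cons h.symm q)))
        (p.append q)
  | plaq {u v : VSite Λ} (pl : Plaq Λ) (hpl : pl ∈ Q)
      (w₁ : (latticeGraph Λ).Walk u pl.c0) (w₂ : (latticeGraph Λ).Walk pl.c0 v) :
      CHStep Q (w₁.append ((plaqWalk pl).append w₂)) (w₁.append w₂)

/-- Homotopy of walks within the 2-complex generated by `Q`. -/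
def CHomotopic {Λ : Box} (Q : Set (Plaq Λ)) {u v : VSite Λ}
    (w₁ w₂ : (latticeGraph Λ).Walk u v) : Prop :=
  Relation.EqvGen (@CHStep Λ Q u v) w₁ w₂

/-- A 2-complex (given by a plaquette set `Q`, together with all its edges and vertices)
is simply connected: it is path connected and every closed walk in it is null-homotopic
within it. -/
def SimplyConnectedC {Λ : Box} (Q : Set (Plaq Λ)) : Prop :=
  (∀ u v : VSite Λ, vertexInComplex Q u → vertexInComplex Q v →
     ∃ w : (latticeGraph Λ).Walk u v, WalkInComplex Q w) ∧
  (∀ u : VSite Λ, ∀ w : (latticeGraph Λ).Walk u u, WalkInComplex Q w →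
     CHomotopic Q w SimpleGraph.Walk.nil)

/-- The 2-complex `S₂(B)`: all plaquettes of the rectangle `B`. -/
def S2 {Λ : Box} (B : Rect Λ) : Set (Plaq Λ) := B.plaqSet

/-- A plaquette lies on the (topological) boundary of a rectangle. -/
def Plaq.onRectBoundary {Λ : Box} (B : Rect Λ) (p : Plaq Λ) : Prop :=
  B.plaqIn p ∧ ∃ k : Fin 4, k ≠ p.1.2.1 ∧ k ≠ p.1.2.2 ∧
    (p.1.1 k = B.lo k ∨ p.1.1 k = B.hi k)

/-- A plaquette lies on the boundary of the lattice `Λ`. -/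
def Plaq.onBoxBoundary {Λ : Box} (p : Plaq Λ) : Prop :=
  ∃ k : Fin 4, k ≠ p.1.2.1 ∧ k ≠ p.1.2.2 ∧ (p.1.1 k = Λ.a k ∨ p.1.1 k = Λ.b k)

/-- The 2-complex `∂S₂(B)`: plaquettes on the boundary of `B` but not on the boundary of `Λ`. -/
def bS2 {Λ : Box} (B : Rect Λ) : Set (Plaq Λ) :=
  {p | p.onRectBoundary B ∧ ¬ p.onBoxBoundary}

/-- The 2-complex `S₂ᶜ(B)`: all plaquettes of `Λ` not contained in `B`, together with `∂S₂(B)`. -/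
def S2c {Λ : Box} (B : Rect Λ) : Set (Plaq Λ) :=
  {p | ¬ B.plaqIn p} ∪ bS2 B

/-- `P₁, P₂` are well separated by the rectangle `B`. -/
def WellSeparated {Λ : Box} (B : Rect Λ) (P₁ P₂ : Set (Plaq Λ)) : Prop :=
  P₁ ⊆ S2 B ∧ P₂ ⊆ S2c B ∧ ∀ p ∈ P₁ ∪ P₂, p ∉ bS2 B

/-- A good rectangle: `S₂(B)`, `S₂ᶜ(B)` and `∂S₂(B)` are all simply connected. -/
def GoodRect {Λ : Box} (B : Rect Λ) : Prop :=
  SimplyConnectedC (S2 B) ∧ SimplyConnectedC (S2c B) ∧ SimplyConnectedC (bS2 B)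

/-- `P₁` is well separated from `P₂` by some good rectangle. -/
def WellSepGood {Λ : Box} (P₁ P₂ : Set (Plaq Λ)) : Prop :=
  ∃ B : Rect Λ, GoodRect B ∧ WellSeparated B P₁ P₂

/-- Union of a list of sets. -/
def unionList {α : Type*} (Ks : List (Set α)) : Set α := {x | ∃ K ∈ Ks, x ∈ K}

/-- `Ks` is a knot decomposition of the plaquette set `P`: a maximal partition
`P = K₁ ∪ ⋯ ∪ K_m` such that each `K_i` is well separated from `K_{i+1} ∪ ⋯ ∪ K_m`
by a good rectangle. -/
structure IsKnotDecomp {Λ : Box} (P : Set (Plaq Λ)) (Ks : List (Set (Plaq Λ))) : Prop where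
  union_eq : unionList Ks = P
  nonempty : ∀ K ∈ Ks, K.Nonempty
  pairwise_disjoint : Ks.Pairwise Disjoint
  sep : ∀ (n : ℕ) (hn : n + 1 < Ks.length),
    WellSepGood (Ks.get ⟨n, Nat.lt_of_succ_lt hn⟩) (unionList (Ks.drop (n + 1)))
  maximal : ∀ K ∈ Ks, ¬ ∃ K₁ K₂ : Set (Plaq Λ), K₁.Nonempty ∧ K₂.Nonempty ∧
    Disjoint K₁ K₂ ∧ K₁ ∪ K₂ = K ∧ WellSepGood K₁ K₂

/-- The collection `𝒦` of knots: all sets appearing in the (fixed) knot decomposition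
`KD P` of some plaquette set `P`. -/
def Knots {Λ : Box} (KD : Set (Plaq Λ) → List (Set (Plaq Λ))) : Set (Set (Plaq Λ)) :=
  {K | ∃ P : Set (Plaq Λ), K ∈ KD P}

/-- `GF(T)`: edge configurations equal to `1` on every edge of the graph `T`. -/
def GF {Λ : Box} (G : Type*) [Group G] (T : SimpleGraph (VSite Λ)) :
    Set (EdgeConf Λ G) :=
  {σ | ∀ e : PEdge Λ, T.Adj e.v0 e.v1 → σ e = 1}

/-- The 1-skeleton of the 2-complex generated by the plaquette set `Q`, as a graph. -/
def skel {Λ : Box} (Q : Set (Plaq Λ)) : SimpleGraph (VSite Λ) :=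
  SimpleGraph.fromRel (edgeInComplex Q)

/-- `T` is a spanning tree of the 1-skeleton `S₁(Λ)`. -/
def IsSpanningTree {Λ : Box} (T : SimpleGraph (VSite Λ)) : Prop :=
  T ≤ latticeGraph Λ ∧ T.IsTree

/-- `T` contains a spanning tree of the 2-complex generated by `Q`: any two vertices of the
complex are joined by a path using only edges lying both in `T` and in the complex. -/
def ContainsSpanningTreeOf {Λ : Box} (T : SimpleGraph (VSite Λ)) (Q : Set (Plaq Λ)) : Prop :=
  ∀ u v : VSite Λ, vertexInComplex Q u → vertexInComplex Q v → (T ⊓ skel Q).Reachable u v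

section Phi

variable (Λ : Box) (x₀ : VSite Λ) {G : Type*} [Group G]

/-- `supp_{P₀}(ψ₁, ψ₂) = supp(ψ₁) ∪ supp(ψ₂) ∪ P₀`. -/
def supp2 (ℓb : ∀ x : VSite Λ, (latticeGraph Λ).Walk x₀ x) (P₀ : Set (Plaq Λ))
    (ψ₁ ψ₂ : Hom Λ x₀ G) : Set (Plaq Λ) :=
  hsupp ψ₁ ℓb ∪ hsupp ψ₂ ℓb ∪ P₀

/-- The polymer counting function
`Φ²_{P₀}(P) = Σ_{ψ₁,ψ₂ : supp_{P₀}(ψ₁,ψ₂) = P} ∏_{p∈Λ₂} φ_β(ψ₁(ξ_p)) φ_β(ψ₂(ξ_p))`. -/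
def Phi2 (χ : G → ℂ) (β : ℝ) (ℓb : ∀ x : VSite Λ, (latticeGraph Λ).Walk x₀ x)
    (P₀ P : Set (Plaq Λ)) : ℝ :=
  ∑ᶠ pr : Hom Λ x₀ G × Hom Λ x₀ G,
    if supp2 Λ x₀ ℓb P₀ pr.1 pr.2 = P then
      ∏ᶠ p : Plaq Λ, phiB χ β (evalP pr.1 ℓb p) * phiB χ β (evalP pr.2 ℓb p)
    else 0

end Phi


section Swap

variable (Λ : Box) (x₀ : VSite Λ) (G : Type*) [Group G]

/-- Tuples of homomorphisms subordinate to the members of a list of plaquette sets. -/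
def TupleSpace (ℓb : ∀ x : VSite Λ, (latticeGraph Λ).Walk x₀ x)
    (Ks : List (Set (Plaq Λ))) : Type _ :=
  {t : Fin Ks.length → Hom Λ x₀ G // ∀ i, hsupp (t i) ℓb ⊆ Ks.get i}

/-- `P := supp(ψ₁) ∪ supp(ψ₂) ∪ B₁ ∪ B₂` for a pair of homomorphisms. -/
def bigP (ℓb : ∀ x : VSite Λ, (latticeGraph Λ).Walk x₀ x) (B₁ B₂ : Rect Λ)
    (pr : Hom Λ x₀ G × Hom Λ x₀ G) : Set (Plaq Λ) :=
  hsupp pr.1 ℓb ∪ hsupp pr.2 ℓb ∪ S2 B₁ ∪ S2 B₂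

/-- `B₁` and `B₂` lie in different knots of the knot decomposition of
`supp(ψ₁) ∪ supp(ψ₂) ∪ B₁ ∪ B₂`. -/
def inDiffKnots (KD : Set (Plaq Λ) → List (Set (Plaq Λ)))
    (ℓb : ∀ x : VSite Λ, (latticeGraph Λ).Walk x₀ x) (B₁ B₂ : Rect Λ)
    (pr : Hom Λ x₀ G × Hom Λ x₀ G) : Prop :=
  ∃ j₁ j₂ : Fin (KD (bigP Λ x₀ G ℓb B₁ B₂ pr)).length, j₁ ≠ j₂ ∧
    S2 B₁ ⊆ (KD (bigP Λ x₀ G ℓb B₁ B₂ pr)).get j₁ ∧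
    S2 B₂ ⊆ (KD (bigP Λ x₀ G ℓb B₁ B₂ pr)).get j₂

/-- The event `E(B₁,B₂) ⊆ Ω²`. -/
def Eset (KD : Set (Plaq Λ) → List (Set (Plaq Λ)))
    (ℓb : ∀ x : VSite Λ, (latticeGraph Λ).Walk x₀ x) (B₁ B₂ : Rect Λ) :
    Set (Hom Λ x₀ G × Hom Λ x₀ G) :=
  {pr | inDiffKnots Λ x₀ G KD ℓb B₁ B₂ pr}

/-- The swapping map `T : E(B₁,B₂) → E(B₁,B₂)` (extended by the identity off `E(B₁,B₂)`):
identify `ψ₁, ψ₂` with tuples via `Θ(P)`, exchange the coordinates of the knot containing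
`B₂`, and come back via `Θ(P)⁻¹`. -/
def swapT (KD : Set (Plaq Λ) → List (Set (Plaq Λ)))
    (ℓb : ∀ x : VSite Λ, (latticeGraph Λ).Walk x₀ x)
    (Θ : ∀ P : Set (Plaq Λ),
      {ψ : Hom Λ x₀ G // hsupp ψ ℓb ⊆ P} ≃ TupleSpace Λ x₀ G ℓb (KD P))
    (B₁ B₂ : Rect Λ) (pr : Hom Λ x₀ G × Hom Λ x₀ G) : Hom Λ x₀ G × Hom Λ x₀ G :=
  if h : inDiffKnots Λ x₀ G KD ℓb B₁ B₂ pr then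
    let P := bigP Λ x₀ G ℓb B₁ B₂ pr
    let j₂ : Fin (KD P).length := h.choose_spec.choose
    let t₁ := Θ P ⟨pr.1, fun p hp =>
      Set.mem_union_left _ (Set.mem_union_left _ (Set.mem_union_left _ hp))⟩
    let t₂ := Θ P ⟨pr.2, fun p hp =>
      Set.mem_union_left _ (Set.mem_union_left _ (Set.mem_union_right _ hp))⟩
    (((Θ P).symm ⟨Function.update t₁.1 j₂ (t₂.1 j₂), by
        intro i
        rcases eq_or_ne i j₂ with hi | hi
        · subst hi; rw [Function.update_self]; exact t₂.2 j₂
        · rw [Function.update_of_ne hi]; exact t₁.2 i⟩).1,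
     ((Θ P).symm ⟨Function.update t₂.1 j₂ (t₁.1 j₂), by
        intro i
        rcases eq_or_ne i j₂ with hi | hi
        · subst hi; rw [Function.update_self]; exact t₁.2 j₂
        · rw [Function.update_of_ne hi]; exact t₂.2 i⟩).1)
  else pr

end Swap

section Finiteness

variable (Λ : Box)

instance : Finite (VSite Λ) :=
  Set.Finite.subset (Set.finite_Icc Λ.a Λ.b) fun _ hx => ⟨fun i => (hx i).1, fun i => (hx i).2⟩

instance : Finite (PEdge Λ) :=
  Finite.of_injective (fun e : PEdge Λ => ((e.v0, e.1.2) : VSite Λ × Fin 4)) fun e f h => by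
    simp only [Prod.mk.injEq, PEdge.v0, Subtype.mk.injEq] at h
    exact Subtype.ext (Prod.ext h.1 h.2)

instance : Finite (Plaq Λ) :=
  Finite.of_injective (fun p : Plaq Λ => ((p.c0, p.1.2) : VSite Λ × Fin 4 × Fin 4)) fun e f h => by
    simp only [Prod.mk.injEq, Plaq.c0, Subtype.mk.injEq] at h
    exact Subtype.ext (Prod.ext h.1 h.2)

instance : Fintype (VSite Λ) := Fintype.ofFinite _
instance : Fintype (PEdge Λ) := Fintype.ofFinite _
instance : Fintype (Plaq Λ) := Fintype.ofFinite _

end Finiteness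

lemma unit_apply_of_ne {i j : Fin 4} (h : j ≠ i) : unit i j = 0 := by simp [unit, h]

lemma unit_injective : Function.Injective unit := fun i j h => by
  by_contra hij
  have := congrFun h i
  rw [unit_apply_self, unit_apply_of_ne hij] at this
  exact one_ne_zero this

section Gauge

variable {Λ : Box} {H : Type*} [Group H]

lemma oval_of_pos (σ : EdgeConf Λ H) {u v : VSite Λ} {i : Fin 4}
    (h : (v : Site) = (u : Site) + unit i) :
    oval σ u v = σ ⟨((u : Site), i), u.2, by rw [← h]; exact v.2⟩ := by
  have hex : ∃ i : Fin 4, (v : Site) = (u : Site) + unit i := ⟨i, h⟩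
  have hi : hex.choose = i :=
    unit_injective (add_left_cancel (hex.choose_spec.symm.trans h))
  simp only [oval]
  rw [dif_pos hex]
  congr 3

lemma oval_of_neg (σ : EdgeConf Λ H) {u v : VSite Λ} {i : Fin 4}
    (h : (u : Site) = (v : Site) + unit i) :
    oval σ u v = (σ ⟨((v : Site), i), v.2, by rw [← h]; exact u.2⟩)⁻¹ := by
  rw [← oval_of_pos σ h]
  exact eq_inv_of_mul_eq_one_left (oval_mul_oval σ ⟨i, Or.inr h⟩)

/-- The action of a gauge transformation on edge configurations. -/
def gaugeAct (h : VSite Λ → H) (σ : EdgeConf Λ H) : EdgeConf Λ H :=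
  fun e => h e.v0 * σ e * (h e.v1)⁻¹

lemma gaugeAct_mul (h k : VSite Λ → H) (σ : EdgeConf Λ H) :
    gaugeAct (h * k) σ = gaugeAct h (gaugeAct k σ) := by
  funext e; simp [gaugeAct, mul_assoc]

lemma gaugeAct_one (σ : EdgeConf Λ H) : gaugeAct 1 σ = σ := by
  funext e; simp [gaugeAct]

/-- A gauge transformation as a permutation of the edge configurations. -/
def gaugeEquiv (h : VSite Λ → H) : EdgeConf Λ H ≃ EdgeConf Λ H where
  toFun := gaugeAct h
  invFun := gaugeAct h⁻¹
  left_inv σ := by rw [← gaugeAct_mul, inv_mul_cancel, gaugeAct_one]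
  right_inv σ := by rw [← gaugeAct_mul, mul_inv_cancel, gaugeAct_one]

lemma oval_gaugeAct (h : VSite Λ → H) (σ : EdgeConf Λ H) {u v : VSite Λ}
    (huv : (latticeGraph Λ).Adj u v) :
    oval (gaugeAct h σ) u v = h u * oval σ u v * (h v)⁻¹ := by
  obtain ⟨i, hi | hi⟩ := huv
  · have h1 : (⟨(u : Site) + unit i, by rw [← hi]; exact v.2⟩ : VSite Λ) = v :=
      Subtype.ext hi.symm
    rw [oval_of_pos _ hi, oval_of_pos _ hi]
    simp only [gaugeAct, PEdge.v0, PEdge.v1]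
    rw [h1]
  · have h1 : (⟨(v : Site) + unit i, by rw [← hi]; exact u.2⟩ : VSite Λ) = u :=
      Subtype.ext hi.symm
    rw [oval_of_neg _ hi, oval_of_neg _ hi]
    simp only [gaugeAct, PEdge.v0, PEdge.v1]
    rw [h1]
    simp [mul_assoc]

lemma hol_gaugeAct (h : VSite Λ → H) (σ : EdgeConf Λ H) {u v : VSite Λ}
    (w : (latticeGraph Λ).Walk u v) :
    hol (gaugeAct h σ) w = h u * hol σ w * (h v)⁻¹ := by
  induction w with
  | nil => simp
  | cons huv q ih => rw [hol_cons, hol_cons, ih, oval_gaugeAct h σ huv]; simp [mul_assoc]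

lemma holP_gaugeAct (h : VSite Λ → H) (σ : EdgeConf Λ H) (p : Plaq Λ) :
    holP (gaugeAct h σ) p = h p.c0 * holP σ p * (h p.c0)⁻¹ := hol_gaugeAct h σ _

/-- The edge of a plaquette in its first direction at its base. -/
def Plaq.e1 (p : Plaq Λ) : PEdge Λ := ⟨(p.1.1, p.1.2.1), p.2.2.1, p.2.2.2.1⟩
/-- The edge of a plaquette in its second direction away from its base. -/
def Plaq.e2 (p : Plaq Λ) : PEdge Λ :=
  ⟨(p.1.1 + unit p.1.2.1, p.1.2.2), p.2.2.2.1, p.2.2.2.2.1⟩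
/-- The edge of a plaquette in its first direction away from its base. -/
def Plaq.e3 (p : Plaq Λ) : PEdge Λ :=
  ⟨(p.1.1 + unit p.1.2.2, p.1.2.1), p.2.2.2.2.2, by
    have := p.2.2.2.2.1; rwa [add_right_comm] at this⟩
/-- The edge of a plaquette in its second direction at its base. -/
def Plaq.e4 (p : Plaq Λ) : PEdge Λ := ⟨(p.1.1, p.1.2.2), p.2.2.1, p.2.2.2.2.2⟩

lemma holP_eq (σ : EdgeConf Λ H) (p : Plaq Λ) :
    holP σ p = σ p.e1 * σ p.e2 * (σ p.e3)⁻¹ * (σ p.e4)⁻¹ := by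
  have h1 : oval σ p.c0 p.c1 = σ p.e1 := oval_of_pos σ (i := p.1.2.1) rfl
  have h2 : oval σ p.c1 p.c2 = σ p.e2 := oval_of_pos σ (i := p.1.2.2) rfl
  have h3 : oval σ p.c2 p.c3 = (σ p.e3)⁻¹ :=
    oval_of_neg σ (i := p.1.2.1) (add_right_comm p.1.1 (unit p.1.2.1) (unit p.1.2.2))
  have h4 : oval σ p.c3 p.c0 = (σ p.e4)⁻¹ := oval_of_neg σ (i := p.1.2.2) rfl
  simp [holP, plaqWalk, hol_cons, h1, h2, h3, h4, mul_assoc]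

/-- The four positively oriented edges of a plaquette. -/
def Plaq.HasEdge (p : Plaq Λ) (e : PEdge Λ) : Prop :=
  e = p.e1 ∨ e = p.e2 ∨ e = p.e3 ∨ e = p.e4

lemma holP_congr {σ τ : EdgeConf Λ H} {p : Plaq Λ} (h : ∀ e, p.HasEdge e → σ e = τ e) :
    holP σ p = holP τ p := by
  rw [holP_eq, holP_eq, h p.e1 (by simp [Plaq.HasEdge]), h p.e2 (by simp [Plaq.HasEdge]),
    h p.e3 (by simp [Plaq.HasEdge]), h p.e4 (by simp [Plaq.HasEdge])]

lemma holP_one (p : Plaq Λ) : holP (1 : EdgeConf Λ H) p = 1 := by simp [holP_eq]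

/-- Both endpoints of an edge lie in the rectangle. -/
def Rect.edgeIn (R : Rect Λ) (e : PEdge Λ) : Prop := R.memV e.1.1 ∧ R.memV (e.1.1 + unit e.1.2)

lemma hol_congr_of_walkInRect {B : Rect Λ} {σ τ : EdgeConf Λ H}
    (h : ∀ e, B.edgeIn e → σ e = τ e) {u v : VSite Λ} (w : (latticeGraph Λ).Walk u v)
    (hw : WalkInRect B w) : hol σ w = hol τ w := by
  induction w with
  | nil => simp
  | @cons u m v huv q ih =>
    have hu : B.memV (u : Site) := hw u (by simp)
    have hm : B.memV (m : Site) := hw m (by simp)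
    rw [hol_cons, hol_cons, ih fun x hx => hw x (by simp [hx])]
    congr 1
    obtain ⟨i, hi | hi⟩ := huv
    · rw [oval_of_pos _ hi, oval_of_pos _ hi]
      exact h _ ⟨hu, by simpa only [← hi] using hm⟩
    · rw [oval_of_neg _ hi, oval_of_neg _ hi]
      rw [h _ ⟨hm, by simpa only [← hi] using hu⟩]

lemma plaqIn_iff {R : Rect Λ} {p : Plaq Λ} :
    R.plaqIn p ↔ R.memV p.1.1 ∧ R.memV (p.1.1 + unit p.1.2.1 + unit p.1.2.2) := by
  constructor
  · exact fun h => ⟨h.1, h.2.2.1⟩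
  · rintro ⟨h0, h2⟩
    refine ⟨h0, fun k => ?_, h2, fun k => ?_⟩ <;>
    · have a := h0 k
      have b := h2 k
      have c := unit_apply_nonneg p.1.2.1 k
      have d := unit_apply_nonneg p.1.2.2 k
      simp only [Pi.add_apply, Plaq.c1, Plaq.c3] at *
      constructor <;> linarith [a.1, a.2, b.1, b.2]

lemma edgeIn_of_plaqIn {R : Rect Λ} {p : Plaq Λ} (hp : R.plaqIn p) {e : PEdge Λ}
    (he : p.HasEdge e) : R.edgeIn e := by
  obtain ⟨h0, h1, h2, h3⟩ := hp
  rcases he with rfl | rfl | rfl | rfl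
  · exact ⟨h0, h1⟩
  · exact ⟨h1, h2⟩
  · refine ⟨h3, ?_⟩
    have : p.e3.1.1 + unit p.e3.1.2 = (p.c2 : Site) := add_right_comm _ _ _
    rwa [this]
  · exact ⟨h0, h3⟩

end Gauge

section Trivialization

variable {Λ : Box} {H : Type*} [Group H]

/-- An edge configuration as a function on all of `ℤ⁴`, equal to `1` off the lattice. -/
def tot (σ : EdgeConf Λ H) (x : Site) (i : Fin 4) : H :=
  if h : Λ.mem x ∧ Λ.mem (x + unit i) then σ ⟨(x, i), h⟩ else 1

lemma tot_edge (σ : EdgeConf Λ H) (e : PEdge Λ) : tot σ e.1.1 e.1.2 = σ e := by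
  simp only [tot]
  rw [dif_pos e.2]

lemma Rect.mem_of_memV {R : Rect Λ} {x : Site} (h : R.memV x) : Λ.mem x := fun i =>
  ⟨(R.a_le_lo i).trans (h i).1, (h i).2.trans (R.hi_le_b i)⟩

lemma Rect.memV_of_le {R : Rect Λ} {x y z : Site} (hx : R.memV x) (hz : R.memV z)
    (hxy : ∀ k, x k ≤ y k) (hyz : ∀ k, y k ≤ z k) : R.memV y := fun k =>
  ⟨(hx k).1.trans (hxy k), (hyz k).trans (hz k).2⟩

lemma exists_plaq {R : Rect Λ} {x : Site} {i j : Fin 4} (hij : i < j) (hx : R.memV x)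
    (hx' : R.memV (x + unit i + unit j)) : ∃ p : Plaq Λ, p.1 = (x, i, j) ∧ R.plaqIn p := by
  have h1 : R.memV (x + unit i) := Rect.memV_of_le hx hx'
    (fun k => by simpa using unit_apply_nonneg i k) (fun k => by simpa using unit_apply_nonneg j k)
  have h2 : R.memV (x + unit j) := Rect.memV_of_le hx hx'
    (fun k => by simpa using unit_apply_nonneg j k)
    (fun k => by
      have := unit_apply_nonneg i k
      simp only [Pi.add_apply]; linarith)
  exact ⟨⟨(x, i, j), hij, Rect.mem_of_memV hx, Rect.mem_of_memV h1, Rect.mem_of_memV hx',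
    Rect.mem_of_memV h2⟩, rfl, plaqIn_iff.2 ⟨hx, hx'⟩⟩

/-- The configuration `σ` has no charge in the rectangle `R`. -/
def FlatIn (R : Rect Λ) (σ : EdgeConf Λ H) : Prop := ∀ p, R.plaqIn p → holP σ p = 1

lemma holP_eq_tot (σ : EdgeConf Λ H) (p : Plaq Λ) :
    holP σ p = tot σ p.1.1 p.1.2.1 * tot σ (p.1.1 + unit p.1.2.1) p.1.2.2 *
      (tot σ (p.1.1 + unit p.1.2.2) p.1.2.1)⁻¹ * (tot σ p.1.1 p.1.2.2)⁻¹ := by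
  rw [holP_eq, ← tot_edge σ p.e1, ← tot_edge σ p.e2, ← tot_edge σ p.e3, ← tot_edge σ p.e4]
  rfl

lemma FlatIn.comm {R : Rect Λ} {σ : EdgeConf Λ H} (hσ : FlatIn R σ) {x : Site} {i j : Fin 4}
    (hij : i ≠ j) (hx : R.memV x) (hx' : R.memV (x + unit i + unit j)) :
    tot σ x i * tot σ (x + unit i) j = tot σ x j * tot σ (x + unit j) i := by
  wlog h : i < j generalizing i j
  · exact (this hij.symm (by rwa [add_right_comm])
      (lt_of_le_of_ne (not_lt.1 h) hij.symm)).symm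
  obtain ⟨p, hp, hpR⟩ := exists_plaq h hx hx'
  have h1 := hσ p hpR
  rw [holP_eq_tot, hp] at h1
  exact (mul_inv_eq_one.1 (by rwa [mul_inv_rev, ← mul_assoc]))

/-- The gauge function `h` trivializes `σ` on the rectangle `R`. -/
def TrivBy (R : Rect Λ) (σ : EdgeConf Λ H) (h : Site → H) : Prop :=
  ∀ e : PEdge Λ, R.edgeIn e → σ e = (h e.1.1)⁻¹ * h (e.1.1 + unit e.1.2)

theorem FlatIn.exists_trivBy {R : Rect Λ} {σ : EdgeConf Λ H} (hσ : FlatIn R σ) :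
    ∃ h, TrivBy R σ h := by
  obtain ⟨n, hn⟩ : ∃ n : ℕ, ∑ i, (R.hi i - R.lo i) = n :=
    Int.eq_ofNat_of_zero_le (Finset.sum_nonneg fun i _ => sub_nonneg.2 (R.lo_le_hi i))
  induction n generalizing R with
  | zero =>
    refine ⟨1, fun e he => ?_⟩
    have h0 := (Finset.sum_eq_zero_iff_of_nonneg
      (fun i _ => sub_nonneg.2 (R.lo_le_hi i))).1 (by simpa using hn) e.1.2 (Finset.mem_univ _)
    have h1 := (he.1 e.1.2).1
    have h2 := (he.2 e.1.2).2
    rw [Pi.add_apply, unit_apply_self] at h2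
    omega
  | succ n ih =>
    obtain ⟨i, hi⟩ : ∃ i, R.lo i < R.hi i := by
      by_contra! hcon
      have : ∑ i, (R.hi i - R.lo i) ≤ 0 := Finset.sum_nonpos fun i _ => by linarith [hcon i]
      rw [hn] at this
      push_cast at this
      omega
    let R' : Rect Λ :=
      { lo := R.lo
        hi := Function.update R.hi i (R.hi i - 1)
        lo_le_hi := fun k => by
          by_cases hk : k = i
          · subst hk; simp; omega
          · simpa [hk] using R.lo_le_hi k
        a_le_lo := R.a_le_lo
        hi_le_b := fun k => by
          by_cases hk : k = i
          · subst hk; simpa using (by linarith [R.hi_le_b k])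
          · simpa [hk] using R.hi_le_b k }
    have hR' : ∀ x, R'.memV x ↔ R.memV x ∧ x i ≠ R.hi i := by
      intro x
      constructor
      · intro hx
        refine ⟨fun k => ⟨(hx k).1, ?_⟩, ?_⟩
        · have := (hx k).2
          by_cases hk : k = i
          · subst hk; simp [R'] at this; omega
          · simpa [R', hk] using this
        · have := (hx i).2
          simp [R'] at this; omega
      · rintro ⟨hx, hxi⟩ k
        refine ⟨(hx k).1, ?_⟩
        have := (hx k).2
        by_cases hk : k = i
        · subst hk; simp [R']; omega
        · simpa [R', hk] using this
    have hflat : FlatIn R' σ := fun p hp => hσ p (by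
      rw [plaqIn_iff] at hp ⊢
      exact ⟨((hR' _).1 hp.1).1, ((hR' _).1 hp.2).1⟩)
    obtain ⟨h', hh'⟩ := ih hflat (by
      have : ∑ k, (R'.hi k - R'.lo k) = ∑ k, (R.hi k - R.lo k) - 1 := by
        rw [← Finset.add_sum_erase _ _ (Finset.mem_univ i),
          ← Finset.add_sum_erase _ (fun k => R.hi k - R.lo k) (Finset.mem_univ i)]
        have h1 : ∑ k ∈ Finset.univ.erase i, (R'.hi k - R'.lo k) =
            ∑ k ∈ Finset.univ.erase i, (R.hi k - R.lo k) :=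
          Finset.sum_congr rfl fun k hk => by simp [R', Finset.ne_of_mem_erase hk]
        rw [h1]
        simp [R']
        ring
      rw [this, hn]; simp)
    refine ⟨fun x => if x i = R.hi i then h' (x - unit i) * tot σ (x - unit i) i else h' x, ?_⟩
    rintro ⟨⟨x, j⟩, hx1, hx2⟩ ⟨hex, hex'⟩
    simp only at hex hex' ⊢
    by_cases hji : j = i
    · subst hji
      have h2 := (hex' j).2
      have h3 : (x + unit j) j = x j + 1 := by simp [unit_apply_self]
      rw [if_neg (by omega)]
      by_cases h4 : (x + unit j) j = R.hi j
      · rw [if_pos h4, add_sub_cancel_right, tot, dif_pos ⟨hx1, hx2⟩]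
        simp
      · rw [if_neg h4]
        exact hh' ⟨(x, j), hx1, hx2⟩ ⟨(hR' _).2 ⟨hex, by simp only; omega⟩, (hR' _).2 ⟨hex', h4⟩⟩
    · have h3 : (x + unit j) i = x i := by
        simp [unit_apply_of_ne (Ne.symm hji)]
      by_cases h4 : x i = R.hi i
      · rw [if_pos h4, if_pos (h3.trans h4)]
        set y := x - unit i with hy
        have hxy : x = y + unit i := by rw [hy, sub_add_cancel]
        have hyj : x + unit j - unit i = y + unit j := by rw [hxy]; abel
        have hyR : R.memV y := by
          intro k
          have h5 := hex k
          by_cases hk : k = i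
          · subst hk
            simp only [hy, Pi.sub_apply, unit_apply_self]
            omega
          · simpa [hy, unit_apply_of_ne hk] using h5
        have hyi : y i ≠ R.hi i := by
          simp only [hy, Pi.sub_apply, unit_apply_self]; omega
        have hyjR : R.memV (y + unit j) := Rect.memV_of_le hyR hex'
          (fun k => by simpa using unit_apply_nonneg j k)
          (fun k => by
            have := unit_apply_nonneg i k
            simp only [hxy, Pi.add_apply]; linarith)
        have h6 : R'.memV y := (hR' _).2 ⟨hyR, hyi⟩
        have h7 : R'.memV (y + unit j) := (hR' _).2 ⟨hyjR, by
          rw [Pi.add_apply, unit_apply_of_ne (Ne.symm hji), add_zero]; exact hyi⟩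
        have h8 := hh' ⟨(y, j), Rect.mem_of_memV hyR, Rect.mem_of_memV hyjR⟩ ⟨h6, h7⟩
        rw [← tot_edge σ] at h8
        simp only at h8
        have h9 := hσ.comm (x := y) (i := i) (j := j) (Ne.symm hji) hyR (by rwa [← hxy])
        rw [← hxy] at h9
        rw [hyj, ← tot_edge σ ⟨(x, j), hx1, hx2⟩]
        simp only
        have h10 : tot σ x j = (tot σ y i)⁻¹ * (tot σ y j * tot σ (y + unit j) i) := by
          rw [← h9]; group
        rw [h10, h8]
        group
      · rw [if_neg h4, if_neg (by rwa [h3])]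
        exact hh' ⟨(x, j), hx1, hx2⟩ ⟨(hR' _).2 ⟨hex, h4⟩, (hR' _).2 ⟨hex', by rwa [h3]⟩⟩

/-- Two trivializations that agree at one vertex of a rectangle agree on the rectangle. -/
theorem TrivBy.eqOn {R : Rect Λ} {σ : EdgeConf Λ H} {h k : Site → H}
    (hh : TrivBy R σ h) (hk : TrivBy R σ k) {x₀ : Site} (hx₀ : R.memV x₀)
    (h₀ : h x₀ = k x₀) : ∀ x, R.memV x → h x = k x := by
  have step : ∀ x i, R.memV x → R.memV (x + unit i) →
      (h x = k x ↔ h (x + unit i) = k (x + unit i)) := by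
    intro x i hx hx'
    have e1 := hh ⟨(x, i), Rect.mem_of_memV hx, Rect.mem_of_memV hx'⟩ ⟨hx, hx'⟩
    have e2 := hk ⟨(x, i), Rect.mem_of_memV hx, Rect.mem_of_memV hx'⟩ ⟨hx, hx'⟩
    have e3 := e1.symm.trans e2
    simp only at e3
    constructor
    · intro e; rw [e] at e3; exact mul_left_cancel e3
    · intro e; rw [e] at e3; exact inv_injective (mul_right_cancel e3)
  intro x hx
  obtain ⟨n, hn⟩ : ∃ n : ℕ, ∑ i, (x i - x₀ i).natAbs = n := ⟨_, rfl⟩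
  induction n generalizing x with
  | zero =>
    have : x = x₀ := by
      funext i
      have := (Finset.sum_eq_zero_iff.1 hn) i (Finset.mem_univ _)
      omega
    rw [this, h₀]
  | succ n ih =>
    obtain ⟨i, hi⟩ : ∃ i, x i ≠ x₀ i := by
      by_contra! hcon
      simp [hcon] at hn
    have key : ∀ y : Site, (∀ k, k ≠ i → y k = x k) →
        (y i - x₀ i).natAbs + 1 = (x i - x₀ i).natAbs → ∑ k, (y k - x₀ k).natAbs = n := by
      intro y hy hyi
      rw [← Finset.add_sum_erase _ _ (Finset.mem_univ i)] at hn ⊢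
      have : ∑ k ∈ Finset.univ.erase i, (y k - x₀ k).natAbs =
          ∑ k ∈ Finset.univ.erase i, (x k - x₀ k).natAbs :=
        Finset.sum_congr rfl fun k hk => by rw [hy k (Finset.ne_of_mem_erase hk)]
      omega
    rcases lt_or_gt_of_ne hi with hlt | hgt
    · have hy : R.memV (x + unit i) := fun k => by
        by_cases hk : k = i
        · subst hk
          have a := hx k
          have b := hx₀ k
          simp only [Pi.add_apply, unit_apply_self]
          omega
        · simpa [unit_apply_of_ne hk] using hx k
      refine (step x i hx hy).2 (ih _ hy (key _ (fun k hk => by simp [unit_apply_of_ne hk]) ?_))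
      simp only [Pi.add_apply, unit_apply_self]
      omega
    · have hy : R.memV (x - unit i) := fun k => by
        by_cases hk : k = i
        · subst hk
          have a := hx k
          have b := hx₀ k
          simp only [Pi.sub_apply, unit_apply_self]
          omega
        · simpa [unit_apply_of_ne hk] using hx k
      have := (step (x - unit i) i hy (by rwa [sub_add_cancel])).1
        (ih _ hy (key _ (fun k hk => by simp [unit_apply_of_ne hk]) (by
          simp only [Pi.sub_apply, unit_apply_self]; omega)))
      rwa [sub_add_cancel] at this

lemma TrivBy.mul_left {R : Rect Λ} {σ : EdgeConf Λ H} {h : Site → H} (hh : TrivBy R σ h) (c : H) :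
    TrivBy R σ fun x => c * h x := fun e he => by
  rw [hh e he]; group

lemma TrivBy.mono {R R' : Rect Λ} {σ : EdgeConf Λ H} {h : Site → H} (hh : TrivBy R σ h)
    (hR : ∀ x, R'.memV x → R.memV x) : TrivBy R' σ h := fun e he =>
  hh e ⟨hR _ he.1, hR _ he.2⟩

lemma FlatIn.exists_trivBy_eq {R : Rect Λ} {σ : EdgeConf Λ H} (hσ : FlatIn R σ) (x₀ : Site)
    (c : H) : ∃ h, TrivBy R σ h ∧ h x₀ = c := by
  obtain ⟨h, hh⟩ := hσ.exists_trivBy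
  exact ⟨_, hh.mul_left (c * (h x₀)⁻¹), by group⟩

lemma hol_one {u v : VSite Λ} (w : (latticeGraph Λ).Walk u v) :
    hol (1 : EdgeConf Λ H) w = 1 := by
  induction w with
  | nil => simp
  | cons huv q ih => rw [hol_cons, ih, oval]; simp

/-- The holonomy of a trivialized configuration along a walk. -/
lemma TrivBy.hol_eq {R : Rect Λ} {σ : EdgeConf Λ H} {h : Site → H} (hh : TrivBy R σ h)
    {u v : VSite Λ} (w : (latticeGraph Λ).Walk u v) (hw : WalkInRect R w) :
    hol σ w = (h u)⁻¹ * h v := by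
  have h1 : hol σ w = hol (gaugeAct (fun x : VSite Λ => (h x)⁻¹) 1) w := by
    refine hol_congr_of_walkInRect (fun e he => ?_) w hw
    rw [hh e he]
    simp [gaugeAct, PEdge.v0, PEdge.v1]
  rw [h1, hol_gaugeAct, hol_one]
  simp

end Trivialization

section RelativeBoundary

variable {Λ : Box} {H : Type*} [Group H]

/-- The extreme value of the `k`-th coordinate on one of the two sides of a rectangle. -/
def Rect.sideVal (R : Rect Λ) (k : Fin 4) (s : Bool) : ℤ := if s then R.hi k else R.lo k

/-- The given side of the rectangle does not lie on the boundary of the lattice. -/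
def Rect.RelSide (R : Rect Λ) (k : Fin 4) (s : Bool) : Prop :=
  if s then R.hi k < Λ.b k else Λ.a k < R.lo k

/-- The site `x` lies on a relative side of `R` orthogonal to the direction `k`. -/
def Rect.OnSide (R : Rect Λ) (x : Site) (k : Fin 4) : Prop :=
  ∃ s, R.RelSide k s ∧ x k = R.sideVal k s

/-- The edges in the relative boundary of a rectangle. -/
def Rect.bdE (R : Rect Λ) (e : PEdge Λ) : Prop :=
  R.edgeIn e ∧ ∃ k, k ≠ e.1.2 ∧ R.OnSide e.1.1 k

/-- The plaquettes in the relative boundary of a rectangle. -/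
def Rect.bdP (R : Rect Λ) (p : Plaq Λ) : Prop :=
  R.plaqIn p ∧ ∃ k, k ≠ p.1.2.1 ∧ k ≠ p.1.2.2 ∧ R.OnSide p.1.1 k

lemma Rect.sideVal_mem (R : Rect Λ) (k : Fin 4) (s : Bool) :
    R.lo k ≤ R.sideVal k s ∧ R.sideVal k s ≤ R.hi k := by
  have := R.lo_le_hi k
  cases s <;> simp [Rect.sideVal, this]

lemma exists_coord_of_not_memV {R : Rect Λ} {x : Site} (h : ¬ R.memV x) :
    ∃ k, x k < R.lo k ∨ R.hi k < x k := by
  by_contra! hcon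
  exact h fun k => hcon k

lemma bdE_of_hasEdge {R : Rect Λ} {e : PEdge Λ} {p : Plaq Λ} (he : R.edgeIn e)
    (hpe : p.HasEdge e) (hp : ¬ R.plaqIn p) : R.bdE e := by
  refine ⟨he, ?_⟩
  obtain ⟨⟨x, i, j⟩, hij, h0, h1, h2, h3⟩ := p
  simp only at hij h0 h1 h2 h3
  have hne : i ≠ j := hij.ne
  rw [plaqIn_iff, not_and_or] at hp
  simp only at hp
  have huu : ∀ k, unit i k = (if k = i then 1 else 0) ∧ unit j k = (if k = j then 1 else 0) :=
    fun k => ⟨rfl, rfl⟩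
  rcases hpe with rfl | rfl | rfl | rfl <;>
    simp only [Rect.edgeIn, Plaq.e1, Plaq.e2, Plaq.e3, Plaq.e4] at he ⊢
  · have hp2 := hp.resolve_left (not_not.2 he.1)
    obtain ⟨k, hk⟩ := exists_coord_of_not_memV hp2
    have a0 := he.1 k; have a1 := he.2 k; have b2 := h2 k; have b3 := huu k
    simp only [Pi.add_apply] at *
    rcases eq_or_ne k j with rfl | hkj
    · refine ⟨k, hne.symm, true, ?_, ?_⟩ <;>
        simp [Rect.RelSide, Rect.sideVal, hne.symm] at * <;> omega
    · simp only [if_neg hkj] at b3; omega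
  · have hp2 := hp.resolve_right (not_not.2 he.2)
    obtain ⟨k, hk⟩ := exists_coord_of_not_memV hp2
    have a0 := he.1 k; have a1 := he.2 k; have b0 := h0 k; have b3 := huu k
    simp only [Pi.add_apply] at *
    rcases eq_or_ne k i with rfl | hki
    · refine ⟨k, hne, false, ?_, ?_⟩ <;>
        simp [Rect.RelSide, Rect.sideVal, hne] at * <;> omega
    · simp only [if_neg hki] at b3; omega
  · have hp2 := hp.resolve_right (not_not.2 (by have := he.2; rwa [add_right_comm] at this))
    obtain ⟨k, hk⟩ := exists_coord_of_not_memV hp2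
    have a0 := he.1 k; have a1 := he.2 k; have b0 := h0 k; have b3 := huu k
    simp only [Pi.add_apply] at *
    rcases eq_or_ne k j with rfl | hkj
    · refine ⟨k, hne.symm, false, ?_, ?_⟩ <;>
        simp [Rect.RelSide, Rect.sideVal, hne.symm] at * <;> omega
    · simp only [if_neg hkj] at b3; omega
  · have hp2 := hp.resolve_left (not_not.2 he.1)
    obtain ⟨k, hk⟩ := exists_coord_of_not_memV hp2
    have a0 := he.1 k; have a1 := he.2 k; have b2 := h2 k; have b3 := huu k
    simp only [Pi.add_apply] at *
    rcases eq_or_ne k i with rfl | hki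
    · refine ⟨k, hne, true, ?_, ?_⟩ <;>
        simp [Rect.RelSide, Rect.sideVal, hne] at * <;> omega
    · simp only [if_neg hki] at b3; omega

/-- Every configuration without charges on the relative boundary of `R` is trivial there. -/
def GoodFor (H : Type*) [Group H] (R : Rect Λ) : Prop :=
  ∀ σ : EdgeConf Λ H, (∀ p, R.bdP p → holP σ p = 1) →
    ∃ h : Site → H, ∀ e, R.bdE e → σ e = (h e.1.1)⁻¹ * h (e.1.1 + unit e.1.2)

/-- A side of a rectangle, as a rectangle. -/
def Rect.face (R : Rect Λ) (k : Fin 4) (s : Bool) : Rect Λ where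
  lo := Function.update R.lo k (R.sideVal k s)
  hi := Function.update R.hi k (R.sideVal k s)
  lo_le_hi j := by
    by_cases h : j = k
    · subst h; simp
    · simpa [h] using R.lo_le_hi j
  a_le_lo j := by
    by_cases h : j = k
    · subst h; simpa using (R.a_le_lo j).trans (R.sideVal_mem j s).1
    · simpa [h] using R.a_le_lo j
  hi_le_b j := by
    by_cases h : j = k
    · subst h; simpa using (R.sideVal_mem j s).2.trans (R.hi_le_b j)
    · simpa [h] using R.hi_le_b j

lemma Rect.memV_face {R : Rect Λ} {k : Fin 4} {s : Bool} {x : Site} :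
    (R.face k s).memV x ↔ R.memV x ∧ x k = R.sideVal k s := by
  have h0 := R.sideVal_mem k s
  constructor
  · intro h
    have hk := h k
    simp only [Rect.face, Function.update_self] at hk
    refine ⟨fun j => ?_, le_antisymm hk.2 hk.1⟩
    by_cases hj : j = k
    · subst hj; omega
    · simpa [Rect.face, hj] using h j
  · rintro ⟨h, hk⟩ j
    by_cases hj : j = k
    · subst hj; simp [Rect.face, hk]
    · simpa [Rect.face, hj] using h j

lemma flatIn_face {R : Rect Λ} {σ : EdgeConf Λ H} (hσ : ∀ p, R.bdP p → holP σ p = 1)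
    {k : Fin 4} {s : Bool} (hs : R.RelSide k s) : FlatIn (R.face k s) σ := by
  intro p hp
  obtain ⟨h1, h2⟩ := plaqIn_iff.1 hp
  rw [Rect.memV_face] at h1 h2
  have h3 := h2.2
  rw [← h1.2] at h3
  have a := unit_apply_nonneg p.1.2.1 k
  have b := unit_apply_nonneg p.1.2.2 k
  simp only [Pi.add_apply] at h3
  refine hσ p ⟨plaqIn_iff.2 ⟨h1.1, h2.1⟩, k, ?_, ?_, s, hs, h1.2⟩
  · rintro rfl; rw [unit_apply_self] at h3; omega
  · rintro rfl; rw [unit_apply_self] at h3; omega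

lemma edgeIn_face_of_bdE {R : Rect Λ} {e : PEdge Λ} (he : R.bdE e) :
    ∃ k s, R.RelSide k s ∧ (R.face k s).edgeIn e := by
  obtain ⟨he, k, hk, s, hs, hx⟩ := he
  refine ⟨k, s, hs, Rect.memV_face.2 ⟨he.1, hx⟩, Rect.memV_face.2 ⟨he.2, ?_⟩⟩
  rw [Pi.add_apply, unit_apply_of_ne hk, add_zero, hx]

lemma TrivBy.eqOn_inter {R R' : Rect Λ} {σ : EdgeConf Λ H} {h k : Site → H}
    (hh : TrivBy R σ h) (hk : TrivBy R' σ k) {x₀ : Site} (hx₀ : R.memV x₀) (hx₀' : R'.memV x₀)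
    (h₀ : h x₀ = k x₀) {x : Site} (hx : R.memV x) (hx' : R'.memV x) : h x = k x := by
  let Q : Rect Λ :=
    { lo := fun i => max (R.lo i) (R'.lo i)
      hi := fun i => min (R.hi i) (R'.hi i)
      lo_le_hi := fun i => by
        have a := hx i
        have b := hx' i
        simp only [max_le_iff, le_min_iff]
        omega
      a_le_lo := fun i => (R.a_le_lo i).trans (le_max_left _ _)
      hi_le_b := fun i => (min_le_left _ _).trans (R.hi_le_b i) }
  have hQ : ∀ y, Q.memV y ↔ R.memV y ∧ R'.memV y := fun y =>
    ⟨fun h => ⟨fun i => ⟨(le_max_left _ _).trans (h i).1, (h i).2.trans (min_le_left _ _)⟩,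
      fun i => ⟨(le_max_right _ _).trans (h i).1, (h i).2.trans (min_le_right _ _)⟩⟩,
      fun h i => ⟨max_le (h.1 i).1 (h.2 i).1, le_min (h.1 i).2 (h.2 i).2⟩⟩
  exact (hh.mono fun y hy => ((hQ y).1 hy).1).eqOn (hk.mono fun y hy => ((hQ y).1 hy).2)
    ((hQ _).2 ⟨hx₀, hx₀'⟩) h₀ x ((hQ _).2 ⟨hx, hx'⟩)

/-- Compatible trivializations on a family of rectangles glue. -/
lemma exists_trivBy_of_compatible {A : Type*} {F : A → Rect Λ} {σ : EdgeConf Λ H}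
    {h : A → Site → H} (hh : ∀ a, TrivBy (F a) σ (h a))
    (hc : ∀ a b x, (F a).memV x → (F b).memV x → h a x = h b x) :
    ∃ g : Site → H, ∀ a, TrivBy (F a) σ g := by
  refine ⟨fun x => if hx : ∃ a, (F a).memV x then h hx.choose x else 1, fun a e he => ?_⟩
  have key : ∀ x, (F a).memV x →
      (if hx : ∃ a, (F a).memV x then h hx.choose x else 1) = h a x := fun x hx => by
    have hex : ∃ a, (F a).memV x := ⟨a, hx⟩
    rw [dif_pos hex]
    exact hc _ _ _ hex.choose_spec hx
  simp only [key _ he.1, key _ he.2]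
  exact hh a e he

/-- A rectangle with a single relative side is good. -/
theorem goodFor_of_unique_side {R : Rect Λ} {k : Fin 4} {s : Bool}
    (h : ∀ k' s', R.RelSide k' s' → k' = k ∧ s' = s) (hs : R.RelSide k s) : GoodFor H R := by
  intro σ hσ
  obtain ⟨g, hg⟩ := (flatIn_face hσ hs).exists_trivBy
  refine ⟨g, fun e he => ?_⟩
  obtain ⟨k', s', h1, h2⟩ := edgeIn_face_of_bdE he
  obtain ⟨rfl, rfl⟩ := h k' s' h1
  exact hg e h2

/-- A nondegenerate rectangle which has a relative side in every direction is good. -/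
theorem goodFor_of_forall_side {R : Rect Λ} (hlt : ∀ k, R.lo k < R.hi k)
    (hs : ∀ k, ∃ s, R.RelSide k s) : GoodFor H R := by
  intro σ hσ
  choose s hs using hs
  let v : Site := fun k => R.sideVal k (s k)
  have hv : ∀ k, (R.face k (s k)).memV v := fun k =>
    Rect.memV_face.2 ⟨fun j => R.sideVal_mem j _, rfl⟩
  choose g hg hg1 using fun k => (flatIn_face hσ (hs k)).exists_trivBy_eq v 1
  have hgg : ∀ j k x, (R.face j (s j)).memV x → (R.face k (s k)).memV x → g j x = g k x :=
    fun j k x hj hk => (hg j).eqOn_inter (hg k) (hv j) (hv k) (by rw [hg1, hg1]) hj hk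
  let w : Fin 4 → Site := fun k => Function.update v k (R.sideVal k (!s k))
  choose g' hg' hg'1 using fun k : {k // R.RelSide k (!s k)} =>
    (flatIn_face hσ k.2).exists_trivBy_eq (w k) (g (k + 1) (w k))
  have hupd : ∀ (x : Site) k t, R.memV x → R.memV (Function.update x k (R.sideVal k t)) := by
    intro x k t hx j
    by_cases hj : j = k
    · subst hj; simpa using R.sideVal_mem j t
    · simpa [hj] using hx j
  have hvm : R.memV v := fun j => R.sideVal_mem j _
  have hw : ∀ k, (R.face k (!s k)).memV (w k) := fun k =>
    Rect.memV_face.2 ⟨hupd _ _ _ hvm, by simp [w]⟩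
  have hw' : ∀ k j, j ≠ k → (R.face j (s j)).memV (w k) := fun k j hj =>
    Rect.memV_face.2 ⟨hupd _ _ _ hvm, by simp [w, hj, v]⟩
  have hk1 : ∀ k : Fin 4, k + 1 ≠ k := by decide
  have hopp : ∀ (k : Fin 4) (x : Site), ¬ ((R.face k (s k)).memV x ∧ (R.face k (!s k)).memV x) := by
    rintro k x ⟨h1, h2⟩
    have a := (Rect.memV_face.1 h1).2
    have b := (Rect.memV_face.1 h2).2
    have c := hlt k
    cases h : s k <;> simp [h, Rect.sideVal] at a b <;> omega
  have hg'g : ∀ (k : {k // R.RelSide k (!s k)}) j x, (R.face k (!s k)).memV x →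
      (R.face j (s j)).memV x → g' k x = g j x := by
    intro k j x hk hj
    have hjk : j ≠ k := by
      rintro rfl; exact hopp _ x ⟨hj, hk⟩
    exact (hg' k).eqOn_inter (hg j) (hw k) (hw' k j hjk)
      (by rw [hg'1, hgg (k + 1) j _ (hw' _ _ (hk1 _)) (hw' k j hjk)]) hk hj
  have hface : ∀ (k j : {k // R.RelSide k (!s k)}) x, (R.face k (!s k)).memV x →
      (R.face j (!s j)).memV x → g' k x = g' j x := by
    intro k j x hk hj
    rcases eq_or_ne k j with rfl | hkj
    · rfl
    have hkj' : (k : Fin 4) ≠ j := fun h => hkj (Subtype.ext h)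
    obtain ⟨l, hlk, hlj⟩ : ∃ l : Fin 4, l ≠ k ∧ l ≠ j := by
      have : ∀ a b : Fin 4, ∃ l, l ≠ a ∧ l ≠ b := by decide
      exact this _ _
    let y : Site := Function.update (w k) j (R.sideVal j (!s j))
    have hyR : R.memV y := hupd _ _ _ (hupd _ _ _ hvm)
    have hyk : (R.face k (!s k)).memV y := Rect.memV_face.2 ⟨hyR, by simp [y, w, hkj']⟩
    have hyj : (R.face j (!s j)).memV y := Rect.memV_face.2 ⟨hyR, by simp [y]⟩
    have hyl : (R.face l (s l)).memV y := Rect.memV_face.2 ⟨hyR, by simp [y, w, hlk, hlj, v]⟩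
    exact (hg' k).eqOn_inter (hg' j) hyk hyj
      ((hg'g k l y hyk hyl).trans (hg'g j l y hyj hyl).symm) hk hj
  obtain ⟨h, hh⟩ := exists_trivBy_of_compatible (A := Fin 4 ⊕ {k // R.RelSide k (!s k)})
    (F := Sum.elim (fun k => R.face k (s k)) (fun k => R.face k (!s k))) (σ := σ)
    (h := Sum.elim g g') (by rintro (k | k); exacts [hg k, hg' k]) (by
      rintro (a | a) (b | b) x ha hb
      · exact hgg a b x ha hb
      · exact (hg'g b a x hb ha).symm
      · exact hg'g a b x ha hb
      · exact hface a b x ha hb)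
  refine ⟨h, fun e he => ?_⟩
  obtain ⟨k, t, h1, h2⟩ := edgeIn_face_of_bdE he
  rcases eq_or_ne t (s k) with rfl | ht
  · exact hh (Sum.inl k) e h2
  · obtain rfl : t = !s k := by
      cases h : s k <;> cases t <;> simp_all
    exact hh (Sum.inr ⟨k, h1⟩) e h2

end RelativeBoundary

section Factorization

variable {Λ : Box} {H : Type*} [Group H]

/-- The plaquettes carrying a nontrivial holonomy. -/
def charges (σ : EdgeConf Λ H) : Finset (Plaq Λ) := {p | holP σ p ≠ 1}

lemma mem_charges {σ : EdgeConf Λ H} {p : Plaq Λ} : p ∈ charges σ ↔ holP σ p ≠ 1 := by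
  simp [charges]

lemma charges_gaugeAct (h : VSite Λ → H) (σ : EdgeConf Λ H) :
    charges (gaugeAct h σ) = charges σ := by
  ext p
  simp [mem_charges, holP_gaugeAct]

/-- The product of the weights of all the plaquette holonomies. -/
def wt (w : H → ℝ) (σ : EdgeConf Λ H) : ℝ := ∏ p, w (holP σ p)

lemma wt_gaugeAct {w : H → ℝ} (hw : ∀ x g, w (g * x * g⁻¹) = w x) (h : VSite Λ → H)
    (σ : EdgeConf Λ H) : wt w (gaugeAct h σ) = wt w σ := by
  simp [wt, holP_gaugeAct, hw]

/-- The configuration is equal to `1` on the given set of edges. -/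
def FixedOn (E : PEdge Λ → Prop) (σ : EdgeConf Λ H) : Prop := ∀ e, E e → σ e = 1

/-- The configuration is equal to `1` on the relative boundary of a rectangle. -/
abbrev Rect.Fixed (R : Rect Λ) (σ : EdgeConf Λ H) : Prop := FixedOn R.bdE σ

/-- The configuration equal to `σ` in the rectangle and to `τ` outside. -/
def glue (R : Rect Λ) (σ τ : EdgeConf Λ H) : EdgeConf Λ H :=
  fun e => if R.edgeIn e then σ e else τ e

lemma glue_glue {K : Type*} (R : Rect Λ) (σ τ : EdgeConf Λ K) :
    glue R (glue R σ τ) (glue R τ σ) = σ := by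
  funext e; by_cases h : R.edgeIn e <;> simp [glue, h]

lemma holP_glue_of_plaqIn {R : Rect Λ} (σ τ : EdgeConf Λ H) {p : Plaq Λ} (hp : R.plaqIn p) :
    holP (glue R σ τ) p = holP σ p :=
  holP_congr fun _ he => if_pos (edgeIn_of_plaqIn hp he)

lemma glue_eq_right {R : Rect Λ} {σ τ : EdgeConf Λ H} (hσ : R.Fixed σ) (hτ : R.Fixed τ)
    {e : PEdge Λ} (he : R.edgeIn e → R.bdE e) : glue R σ τ e = τ e := by
  by_cases h : R.edgeIn e
  · simp [glue, h, hσ e (he h), hτ e (he h)]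
  · simp [glue, h]

lemma holP_glue_of_not_plaqIn {R : Rect Λ} {σ τ : EdgeConf Λ H} (hσ : R.Fixed σ)
    (hτ : R.Fixed τ) {p : Plaq Λ} (hp : ¬ R.plaqIn p) : holP (glue R σ τ) p = holP τ p :=
  holP_congr fun _ he => glue_eq_right hσ hτ fun h => bdE_of_hasEdge h he hp

lemma Rect.Fixed.glue {R : Rect Λ} {σ τ : EdgeConf Λ H} (hσ : R.Fixed σ) (hτ : R.Fixed τ) :
    R.Fixed (glue R σ τ) := fun e he => by
  simp only [LGT.glue]; split_ifs
  exacts [hσ e he, hτ e he]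

variable [Fintype H]

/-- Gauge fixing: a sum over configurations that are trivializable on a set of edges is
proportional to the sum over the configurations which are trivial there. -/
lemma card_mul_sum_eq (E : PEdge Λ → Prop) {K : EdgeConf Λ H → ℂ}
    (hK : ∀ h σ, K (gaugeAct h σ) = K σ)
    (hE : ∀ σ, K σ ≠ 0 → ∃ h : Site → H, ∀ e, E e → σ e = (h e.1.1)⁻¹ * h (e.1.1 + unit e.1.2)) :
    (Finset.card {h : VSite Λ → H | FixedOn E (gaugeAct h 1)} : ℂ) * ∑ σ, K σ =
      (Fintype.card (VSite Λ → H) : ℂ) * ∑ σ, if FixedOn E σ then K σ else 0 := by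
  have h1 : ∀ h : VSite Λ → H, (∑ σ, if FixedOn E (gaugeAct h σ) then K σ else 0) =
      ∑ σ, if FixedOn E σ then K σ else 0 := fun h =>
    Fintype.sum_equiv (gaugeEquiv h) _ _ fun σ => by
      change _ = if FixedOn E (gaugeAct h σ) then K (gaugeAct h σ) else 0
      rw [hK]
  have h2 : ∀ σ, (∑ h : VSite Λ → H, if FixedOn E (gaugeAct h σ) then K σ else 0) =
      (Finset.card {h : VSite Λ → H | FixedOn E (gaugeAct h 1)} : ℂ) * K σ := by
    intro σ
    by_cases h0 : K σ = 0
    · simp [h0]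
    obtain ⟨g, hg⟩ := hE σ h0
    let g' : VSite Λ → H := fun x => (g x)⁻¹
    have h3 : ∀ k e, E e → gaugeAct (k * g') 1 e = gaugeAct k σ e := by
      intro k e he
      rw [gaugeAct_mul]
      simp [gaugeAct, hg e he, g', PEdge.v0, PEdge.v1]
    have h4 : ∀ k, FixedOn E (gaugeAct k σ) ↔ FixedOn E (gaugeAct (k * g') 1) := fun k =>
      forall_congr' fun e => ⟨fun h he => (h3 k e he).trans (h he), fun h he => (h3 k e he) ▸ h he⟩
    rw [Finset.card_filter, Nat.cast_sum, Finset.sum_mul]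
    refine Fintype.sum_equiv (Equiv.mulRight g') _ _ fun k => ?_
    by_cases hk : FixedOn E (gaugeAct (k * g') 1) <;> simp [hk, h4 k]
  rw [Finset.mul_sum, ← Finset.sum_congr rfl fun σ _ => h2 σ, Finset.sum_comm,
    Finset.sum_congr rfl fun h _ => h1 h, Finset.sum_const, nsmul_eq_mul, Finset.card_univ]

lemma sum_mul_sum_eq_of_glue {R : Rect Λ} {Ka Kb Kc Kd : EdgeConf Λ H → ℂ}
    (h : ∀ σ τ, R.Fixed σ → R.Fixed τ →
      Ka σ * Kb τ = Kc (glue R σ τ) * Kd (glue R τ σ)) :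
    (∑ σ, if R.Fixed σ then Ka σ else 0) * (∑ σ, if R.Fixed σ then Kb σ else 0) =
      (∑ σ, if R.Fixed σ then Kc σ else 0) * ∑ σ, if R.Fixed σ then Kd σ else 0 := by
  simp only [← Finset.sum_filter]
  rw [Finset.sum_mul_sum, Finset.sum_mul_sum, ← Finset.sum_product', ← Finset.sum_product']
  refine Finset.sum_nbij' (fun x => (glue R x.1 x.2, glue R x.2 x.1))
    (fun x => (glue R x.1 x.2, glue R x.2 x.1)) ?_ ?_ ?_ ?_ ?_
  · rintro ⟨σ, τ⟩ hx
    simp only [Finset.mem_product, Finset.mem_filter, Finset.mem_univ, true_and] at hx ⊢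
    exact ⟨hx.1.glue hx.2, hx.2.glue hx.1⟩
  · rintro ⟨σ, τ⟩ hx
    simp only [Finset.mem_product, Finset.mem_filter, Finset.mem_univ, true_and] at hx ⊢
    exact ⟨hx.1.glue hx.2, hx.2.glue hx.1⟩
  · rintro ⟨σ, τ⟩ _
    simp only [glue_glue]
  · rintro ⟨σ, τ⟩ _
    simp only [glue_glue]
  · rintro ⟨σ, τ⟩ hx
    simp only [Finset.mem_product, Finset.mem_filter, Finset.mem_univ, true_and] at hx
    exact h σ τ hx.1 hx.2

/-- The weighted value of an observable at a configuration, if it has the given charges. -/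
def chargeTerm (w : H → ℝ) (P : Finset (Plaq Λ)) (F : EdgeConf Λ H → ℂ) (σ : EdgeConf Λ H) : ℂ :=
  if charges σ = P then (wt w σ : ℂ) * F σ else 0

/-- The weighted sum of an observable over the configurations with given charges. -/
def chargeSum (w : H → ℝ) (P : Finset (Plaq Λ)) (F : EdgeConf Λ H → ℂ) : ℂ :=
  ∑ σ, chargeTerm w P F σ

/-- The factorization of charge sums along a good rectangle. -/
theorem chargeSum_mul_chargeSum {w : H → ℝ} (hw : ∀ x g, w (g * x * g⁻¹) = w x) {R : Rect Λ}
    (hR : GoodFor H R) {P : Finset (Plaq Λ)} (hP : ∀ p ∈ P, ¬ R.bdP p)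
    {F₁ F₂ : EdgeConf Λ H → ℂ} (hg₁ : ∀ h σ, F₁ (gaugeAct h σ) = F₁ σ)
    (hg₂ : ∀ h σ, F₂ (gaugeAct h σ) = F₂ σ)
    (hF₁ : ∀ σ τ, (∀ e, R.edgeIn e → σ e = τ e) → F₁ σ = F₁ τ)
    (hF₂ : ∀ σ τ, (∀ e, (R.edgeIn e → R.bdE e) → σ e = τ e) → F₂ σ = F₂ τ) :
    chargeSum w P (fun σ => F₁ σ * F₂ σ) * chargeSum w ∅ (fun _ : EdgeConf Λ H => 1) =
      chargeSum w {p ∈ P | R.plaqIn p} F₁ * chargeSum w {p ∈ P | ¬ R.plaqIn p} F₂ := by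
  have avg : ∀ Q F, Q ⊆ P → (∀ h σ, F (gaugeAct h σ) = F σ) →
      (Finset.card {h : VSite Λ → H | FixedOn R.bdE (gaugeAct h 1)} : ℂ) * chargeSum w Q F =
      (Fintype.card (VSite Λ → H) : ℂ) *
        ∑ σ, if R.Fixed σ then chargeTerm w Q F σ else 0 := by
    intro Q F hQ hF
    refine card_mul_sum_eq R.bdE (fun h σ => ?_) fun σ hσ => hR σ fun p hp => ?_
    · simp only [chargeTerm, charges_gaugeAct, wt_gaugeAct hw, hF]
    · by_contra hne
      have h1 : charges σ = Q := by
        by_contra h; exact hσ (by simp [chargeTerm, h])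
      exact hP p (hQ (h1 ▸ mem_charges.2 hne)) hp
  have h0 : (Finset.card {h : VSite Λ → H | FixedOn R.bdE (gaugeAct h 1)} : ℂ) ≠ 0 := by
    rw [Nat.cast_ne_zero]
    refine Finset.card_ne_zero.2 ⟨1, ?_⟩
    simp [gaugeAct_one, FixedOn]
  have glued := sum_mul_sum_eq_of_glue (R := R)
    (Ka := chargeTerm w P fun σ => F₁ σ * F₂ σ) (Kb := chargeTerm w ∅ fun _ => 1)
    (Kc := chargeTerm w {p ∈ P | R.plaqIn p} F₁) (Kd := chargeTerm w {p ∈ P | ¬ R.plaqIn p} F₂)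
    (by
      intro σ τ hσ hτ
      have e1 : F₁ (glue R σ τ) = F₁ σ := hF₁ _ _ fun e he => by simp [glue, he]
      have e2 : F₂ (glue R τ σ) = F₂ σ := hF₂ _ _ fun e he => glue_eq_right hτ hσ he
      have e3 : wt w (glue R σ τ) * wt w (glue R τ σ) = wt w σ * wt w τ := by
        simp only [wt, ← Finset.prod_mul_distrib]
        refine Finset.prod_congr rfl fun p _ => ?_
        by_cases hp : R.plaqIn p
        · rw [holP_glue_of_plaqIn _ _ hp, holP_glue_of_plaqIn _ _ hp]
        · rw [holP_glue_of_not_plaqIn hσ hτ hp, holP_glue_of_not_plaqIn hτ hσ hp, mul_comm]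
      have e4 : (charges σ = P ∧ charges τ = ∅) ↔
          (charges (glue R σ τ) = {p ∈ P | R.plaqIn p} ∧
            charges (glue R τ σ) = {p ∈ P | ¬ R.plaqIn p}) := by
        simp only [Finset.ext_iff, mem_charges, ← forall_and]
        refine forall_congr' fun p => ?_
        by_cases hp : R.plaqIn p
        · simp [holP_glue_of_plaqIn _ _ hp, hp]
        · simp [holP_glue_of_not_plaqIn hσ hτ hp, holP_glue_of_not_plaqIn hτ hσ hp, hp, and_comm]
      have e5 : (wt w (glue R σ τ) : ℂ) * wt w (glue R τ σ) = wt w σ * wt w τ := by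
        exact_mod_cast e3
      simp only [chargeTerm, e1, e2, ite_zero_mul_ite_zero]
      rw [if_congr e4 (show _ = _ from ?_) rfl]
      linear_combination (-(F₁ σ * F₂ σ)) * e5)
  have a := avg P (fun σ => F₁ σ * F₂ σ) subset_rfl fun h σ => by rw [hg₁, hg₂]
  have b := avg ∅ (fun _ => 1) (Finset.empty_subset _) fun _ _ => rfl
  have c := avg _ F₁ (Finset.filter_subset R.plaqIn P) hg₁
  have d := avg _ F₂ (Finset.filter_subset (fun p => ¬ R.plaqIn p) P) hg₂
  refine mul_left_cancel₀ (mul_ne_zero h0 h0) ?_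
  rw [mul_mul_mul_comm, a, b, mul_mul_mul_comm, glued, mul_mul_mul_comm, ← c, ← d,
    mul_mul_mul_comm]

end Factorization

section Separation

variable {Λ : Box}

/-- All the edges of `B` are edges of `R`. -/
def Rect.Inside (B R : Rect Λ) : Prop := ∀ e, B.edgeIn e → R.edgeIn e

/-- The common edges of `B` and `R` lie in the relative boundary of `R`. -/
def Rect.Outside (B R : Rect Λ) : Prop := ∀ e, B.edgeIn e → R.edgeIn e → R.bdE e

/-- No good rectangle avoiding the plaquettes in `X` separates `B₁` from `B₂`, or both of them from
a part of `X`. -/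
def Inseparable (H : Type*) [Group H] (B₁ B₂ : Rect Λ) (X : Finset (Plaq Λ)) : Prop :=
  ∀ R, GoodFor H R → (∀ p ∈ X, ¬ R.bdP p) →
    ¬ (B₁.Inside R ∧ B₂.Outside R) ∧ ¬ (B₂.Inside R ∧ B₁.Outside R) ∧
    (B₁.Inside R → B₂.Inside R → ∀ p ∈ X, R.plaqIn p) ∧
    (B₁.Outside R → B₂.Outside R → ∀ p ∈ X, ¬ R.plaqIn p)

variable {H : Type*} [Group H]

/-- The observable only depends on the edges in a rectangle. -/
def LocalIn (B : Rect Λ) (F : EdgeConf Λ H → ℂ) : Prop :=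
  ∀ σ τ, (∀ e, B.edgeIn e → σ e = τ e) → F σ = F τ

/-- The observable is invariant under gauge transformations. -/
def GaugeInvariant (F : EdgeConf Λ H → ℂ) : Prop := ∀ h σ, F (gaugeAct h σ) = F σ

lemma GaugeInvariant.mul {F₁ F₂ : EdgeConf Λ H → ℂ} (h₁ : GaugeInvariant F₁)
    (h₂ : GaugeInvariant F₂) : GaugeInvariant fun σ => F₁ σ * F₂ σ := fun h σ => by
  simp only [h₁ h σ, h₂ h σ]

variable [Fintype H]

theorem chargeSum_mul_eq_zero_or {w : H → ℝ} (hw : ∀ x g, w (g * x * g⁻¹) = w x)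
    (h0 : chargeSum w ∅ (fun _ : EdgeConf Λ H => 1) ≠ 0) {B₁ B₂ : Rect Λ}
    {F₁ F₂ : EdgeConf Λ H → ℂ} (hg₁ : GaugeInvariant F₁) (hg₂ : GaugeInvariant F₂)
    (hl₁ : LocalIn B₁ F₁) (hl₂ : LocalIn B₂ F₂) (hz₁ : ∀ Q, chargeSum w Q F₁ = 0)
    (hz₂ : ∀ Q, chargeSum w Q F₂ = 0) (P : Finset (Plaq Λ)) :
    chargeSum w P (fun σ => F₁ σ * F₂ σ) = 0 ∨
      ∃ X ⊆ P, Inseparable H B₁ B₂ X ∧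
        chargeSum w P (fun _ : EdgeConf Λ H => 1) * chargeSum w ∅ (fun _ : EdgeConf Λ H => 1) =
          chargeSum w X (fun _ : EdgeConf Λ H => 1) *
            chargeSum w (P \ X) (fun _ : EdgeConf Λ H => 1) := by
  induction hn : P.card using Nat.strong_induction_on generalizing P with
  | _ n ih =>
  subst hn
  have hg1 : GaugeInvariant (fun _ : EdgeConf Λ H => (1 : ℂ)) := fun _ _ => rfl
  by_cases hbad : Inseparable H B₁ B₂ P
  · exact Or.inr ⟨P, subset_rfl, hbad, by simp⟩
  simp only [Inseparable, not_forall] at hbad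
  obtain ⟨R, hR, hP, hcase⟩ := hbad
  have split1 : ∀ Q ⊆ P, chargeSum w Q (fun _ : EdgeConf Λ H => 1) *
      chargeSum w ∅ (fun _ : EdgeConf Λ H => 1) =
      chargeSum w {p ∈ Q | R.plaqIn p} (fun _ : EdgeConf Λ H => 1) *
        chargeSum w {p ∈ Q | ¬ R.plaqIn p} (fun _ : EdgeConf Λ H => 1) := fun Q hQ => by
    have := chargeSum_mul_chargeSum hw hR (P := Q) (fun p hp => hP p (hQ hp))
      (F₁ := fun _ => 1) (F₂ := fun _ => 1) hg1 hg1 (fun _ _ _ => rfl) (fun _ _ _ => rfl)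
    simpa using this
  by_cases c1 : B₁.Inside R ∧ B₂.Outside R
  · left
    have := chargeSum_mul_chargeSum hw hR hP hg₁ hg₂
      (fun σ τ h => hl₁ σ τ fun e he => h e (c1.1 e he))
      (fun σ τ h => hl₂ σ τ fun e he => h e (c1.2 e he))
    rw [hz₁, zero_mul] at this
    exact (mul_eq_zero.1 this).resolve_right h0
  by_cases c2 : B₂.Inside R ∧ B₁.Outside R
  · left
    have := chargeSum_mul_chargeSum hw hR hP hg₂ hg₁
      (fun σ τ h => hl₂ σ τ fun e he => h e (c2.1 e he))
      (fun σ τ h => hl₁ σ τ fun e he => h e (c2.2 e he))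
    rw [hz₂, zero_mul] at this
    simpa only [mul_comm] using (mul_eq_zero.1 this).resolve_right h0
  by_cases c3 : B₁.Inside R ∧ B₂.Inside R ∧ ∃ p ∈ P, ¬ R.plaqIn p
  · obtain ⟨i1, i2, p, hp, hpR⟩ := c3
    have hD := chargeSum_mul_chargeSum hw hR hP
      (F₁ := fun σ => F₁ σ * F₂ σ) (F₂ := fun _ => 1) (hg₁.mul hg₂) hg1
      (fun σ τ h => by
        simp only [hl₁ σ τ fun e he => h e (i1 e he), hl₂ σ τ fun e he => h e (i2 e he)])
      (fun _ _ _ => rfl)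
    simp only [mul_one] at hD
    have hss : P.filter R.plaqIn ⊂ P := Finset.filter_ssubset.2 ⟨p, hp, hpR⟩
    rcases ih _ (Finset.card_lt_card hss) _ rfl with h | ⟨X, hX, hXb, hXe⟩
    · left
      rw [h, zero_mul] at hD
      exact (mul_eq_zero.1 hD).resolve_right h0
    · refine Or.inr ⟨X, hX.trans hss.1, hXb, mul_right_cancel₀ h0 ?_⟩
      have e1 := split1 P subset_rfl
      have e2 := split1 (P \ X) Finset.sdiff_subset
      have e3 : (P \ X).filter R.plaqIn = P.filter R.plaqIn \ X := by
        ext q; simp only [Finset.mem_filter, Finset.mem_sdiff]; tauto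
      have e4 : (P \ X).filter (fun q => ¬ R.plaqIn q) = P.filter fun q => ¬ R.plaqIn q := by
        ext q
        have := fun h : q ∈ X => (Finset.mem_filter.1 (hX h)).2
        simp only [Finset.mem_filter, Finset.mem_sdiff]; tauto
      rw [e3, e4] at e2
      rw [e1, mul_assoc (chargeSum w X _), e2, mul_right_comm, hXe, mul_assoc]
  by_cases c4 : B₁.Outside R ∧ B₂.Outside R ∧ ∃ p ∈ P, R.plaqIn p
  · obtain ⟨i1, i2, p, hp, hpR⟩ := c4
    have hD := chargeSum_mul_chargeSum hw hR hP
      (F₁ := fun _ => 1) (F₂ := fun σ => F₁ σ * F₂ σ) hg1 (hg₁.mul hg₂)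
      (fun _ _ _ => rfl)
      (fun σ τ h => by
        simp only [hl₁ σ τ fun e he => h e (i1 e he), hl₂ σ τ fun e he => h e (i2 e he)])
    simp only [one_mul] at hD
    have hss : P.filter (fun q => ¬ R.plaqIn q) ⊂ P :=
      Finset.filter_ssubset.2 ⟨p, hp, not_not.2 hpR⟩
    rcases ih _ (Finset.card_lt_card hss) _ rfl with h | ⟨X, hX, hXb, hXe⟩
    · left
      rw [h, mul_zero] at hD
      exact (mul_eq_zero.1 hD).resolve_right h0
    · refine Or.inr ⟨X, hX.trans hss.1, hXb, mul_right_cancel₀ h0 ?_⟩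
      have e1 := split1 P subset_rfl
      have e2 := split1 (P \ X) Finset.sdiff_subset
      have e3 : (P \ X).filter (fun q => ¬ R.plaqIn q) = P.filter (fun q => ¬ R.plaqIn q) \ X := by
        ext q; simp only [Finset.mem_filter, Finset.mem_sdiff]; tauto
      have e4 : (P \ X).filter R.plaqIn = P.filter R.plaqIn := by
        ext q
        have := fun h : q ∈ X => (Finset.mem_filter.1 (hX h)).2
        simp only [Finset.mem_filter, Finset.mem_sdiff]; tauto
      rw [e3, e4] at e2
      rw [e1, mul_assoc (chargeSum w X _), e2, mul_assoc, hXe, mul_left_comm]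
  exact absurd ⟨c1, c2, fun a b p hp => by_contra fun h => c3 ⟨a, b, p, hp, h⟩,
    fun a b p hp h => c4 ⟨a, b, p, hp, h⟩⟩ hcase

end Separation

section Counting

variable {Λ : Box} {H : Type*} [Group H]

/-- The edges of the comb: all the coordinates before the direction of the edge are minimal. -/
def PEdge.InComb (e : PEdge Λ) : Prop := ∀ k < e.1.2, e.1.1 k = Λ.a k

/-- The points of the segment in direction `k` of the comb path leading to `x`. -/
def combPoint (Λ : Box) (x : Site) (k : Fin 4) (t : ℕ) : Site :=
  fun j => if j < k then Λ.a j else if j = k then Λ.a k + t else x j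

/-- The holonomy of the segment in direction `k` of the comb path leading to `x`. -/
def combSegment (σ : EdgeConf Λ H) (x : Site) (k : Fin 4) : H :=
  ((List.range (x k - Λ.a k).toNat).map fun t => tot σ (combPoint Λ x k t) k).prod

lemma combSegment_eq_one (σ : EdgeConf Λ H) {x : Site} {k : Fin 4} (h : x k = Λ.a k) :
    combSegment σ x k = 1 := by simp [combSegment, h]

lemma combSegment_add_unit (σ : EdgeConf Λ H) (x : Site) {i k : Fin 4} (h : i < k) :
    combSegment σ (x + unit i) k = combSegment σ x k := by
  have h1 : (x + unit i) k = x k := by simp [unit_apply_of_ne h.ne']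
  have h2 : ∀ t, combPoint Λ (x + unit i) k t = combPoint Λ x k t := fun t => by
    funext j
    rcases lt_trichotomy j k with hj | rfl | hj
    · simp [combPoint, hj]
    · simp [combPoint]
    · have : j ≠ i := (h.trans hj).ne'
      simp [combPoint, hj.not_gt, hj.ne', unit_apply_of_ne this]
  simp [combSegment, h1, h2]

lemma combSegment_add_unit_self (σ : EdgeConf Λ H) {e : PEdge Λ} (he : e.InComb) :
    combSegment σ (e.1.1 + unit e.1.2) e.1.2 = combSegment σ e.1.1 e.1.2 * σ e := by
  obtain ⟨⟨x, i⟩, hx, hx'⟩ := e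
  have hxi : Λ.a i ≤ x i := (hx i).1
  simp only [PEdge.InComb] at he hx hx' ⊢
  have h2 : ∀ t, combPoint Λ (x + unit i) i t = combPoint Λ x i t := fun t => by
    funext j
    by_cases hj : j = i
    · subst hj; simp [combPoint]
    · simp [combPoint, hj, unit_apply_of_ne hj]
  have h3 : combPoint Λ x i (x i - Λ.a i).toNat = x := by
    funext j
    rcases lt_trichotomy j i with hj | rfl | hj
    · simp [combPoint, hj, he j hj]
    · simp [combPoint, hxi]
    · simp [combPoint, hj.not_gt, hj.ne']
  have h1 : ((x + unit i) i - Λ.a i).toNat = (x i - Λ.a i).toNat + 1 := by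
    simp only [Pi.add_apply, unit_apply_self]
    omega
  simp only [combSegment, h1, h2, List.range_succ, List.map_append, List.prod_append,
    List.map_cons, List.map_nil, List.prod_singleton]
  rw [h3, tot, dif_pos ⟨hx, hx'⟩]

/-- A configuration without charges that agrees with a given one on the comb. -/
lemma exists_flat_eq_on_comb (σ : EdgeConf Λ H) :
    ∃ τ : EdgeConf Λ H, charges τ = ∅ ∧ ∀ e : PEdge Λ, e.InComb → τ e = σ e := by
  let h : Site → H := fun x =>
    combSegment σ x 3 * combSegment σ x 2 * combSegment σ x 1 * combSegment σ x 0
  have key : ∀ e : PEdge Λ, e.InComb → h (e.1.1 + unit e.1.2) = h e.1.1 * σ e := by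
    intro e he
    have h1 := combSegment_add_unit_self σ he
    have h2 : ∀ k, e.1.2 < k → combSegment σ (e.1.1 + unit e.1.2) k = combSegment σ e.1.1 k :=
      fun k hk => combSegment_add_unit σ _ hk
    have h3 : ∀ k < e.1.2, combSegment σ e.1.1 k = 1 := fun k hk =>
      combSegment_eq_one σ (he k hk)
    have h4 : ∀ k < e.1.2, combSegment σ (e.1.1 + unit e.1.2) k = 1 := fun k hk =>
      combSegment_eq_one σ (by simp [unit_apply_of_ne hk.ne, he k hk])
    obtain ⟨⟨x, i⟩, hx⟩ := e
    simp only [h] at h1 h2 h3 h4 ⊢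
    fin_cases i <;> simp only [Fin.zero_eta, Fin.mk_one, Fin.reduceFinMk] at *
    · rw [h1, h2 3 (by decide), h2 2 (by decide), h2 1 (by decide)]
      simp only [mul_assoc]
    · rw [h1, h2 3 (by decide), h2 2 (by decide), h3 0 (by decide), h4 0 (by decide)]
      simp only [mul_assoc, mul_one]
    · rw [h1, h2 3 (by decide), h3 0 (by decide), h4 0 (by decide), h3 1 (by decide),
        h4 1 (by decide)]
      simp only [mul_assoc, mul_one]
    · rw [h1, h3 0 (by decide), h4 0 (by decide), h3 1 (by decide), h4 1 (by decide),
        h3 2 (by decide), h4 2 (by decide)]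
      simp only [mul_one]
  refine ⟨gaugeAct (fun x : VSite Λ => (h x)⁻¹) 1, ?_, fun e he => ?_⟩
  · rw [charges_gaugeAct]
    ext p
    simp [mem_charges, holP_one]
  · simp [gaugeAct, PEdge.v0, PEdge.v1, key e he]

/-- A configuration is determined by its plaquette holonomies and its values on the comb. -/
lemma eq_of_holP_eq_of_comb {σ τ : EdgeConf Λ H} (h : ∀ p, holP σ p = holP τ p)
    (hc : ∀ e : PEdge Λ, e.InComb → σ e = τ e) : σ = τ := by
  funext e
  obtain ⟨n, hn⟩ : ∃ n : ℕ, 4 * ∑ k, (e.1.1 k - Λ.a k) + e.1.2.1 = n :=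
    Int.eq_ofNat_of_zero_le (by
      have : 0 ≤ ∑ k, (e.1.1 k - Λ.a k) := Finset.sum_nonneg fun k _ => by
        linarith [(e.2.1 k).1]
      positivity)
  induction n using Nat.strong_induction_on generalizing e with
  | _ n ih =>
  have ih' : ∀ f : PEdge Λ, 4 * ∑ k, (f.1.1 k - Λ.a k) + (f.1.2.1 : ℤ) < n → σ f = τ f := by
    intro f hf
    have h0 : 0 ≤ ∑ k, (f.1.1 k - Λ.a k) := Finset.sum_nonneg fun k _ => by
      linarith [(f.2.1 k).1]
    exact ih (4 * ∑ k, (f.1.1 k - Λ.a k) + (f.1.2.1 : ℤ)).toNat (by omega) f (by omega)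
  clear ih
  by_cases he : e.InComb
  · exact hc e he
  obtain ⟨⟨x, j⟩, hx, hx'⟩ := e
  simp only [PEdge.InComb, not_forall] at he hn hx hx'
  obtain ⟨i, hij, hi⟩ := he
  have hsum : ∀ l, ∑ k, unit l k = 1 := fun l => by simp [unit]
  obtain ⟨y, rfl⟩ : ∃ y, x = y + unit i := ⟨x - unit i, by simp⟩
  have hyi := (hx i).1
  simp only [Pi.add_apply, unit_apply_self] at hyi hi
  have hy : Λ.mem y := fun k => by
    have := hx k
    by_cases hk : k = i
    · subst hk; simp only [Pi.add_apply, unit_apply_self] at this; omega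
    · simpa [unit_apply_of_ne hk] using this
  have hyj : Λ.mem (y + unit j) := fun k => by
    have a := hx' k
    have b := hy k
    have c := unit_apply_nonneg i k
    have d := unit_apply_nonneg j k
    simp only [Pi.add_apply] at *
    constructor <;> linarith [a.1, a.2, b.1, b.2]
  have hp := h ⟨(y, i, j), hij, hy, hx, hx', hyj⟩
  rw [holP_eq, holP_eq] at hp
  have hij' : (i : ℕ) < j := hij
  have hj4 := j.2
  simp only [Pi.add_apply, Finset.sum_sub_distrib, Finset.sum_add_distrib, hsum] at hn
  rw [ih' (Plaq.e1 _) (by simp only [Plaq.e1, Finset.sum_sub_distrib]; omega),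
    ih' (Plaq.e3 _) (by
      simp only [Plaq.e3, Pi.add_apply, Finset.sum_sub_distrib, Finset.sum_add_distrib, hsum]
      omega),
    ih' (Plaq.e4 _) (by simp only [Plaq.e4, Finset.sum_sub_distrib]; omega)] at hp
  exact mul_left_cancel (mul_right_cancel (mul_right_cancel hp))

lemma wt_nonneg {w : H → ℝ} (hw0 : ∀ g, 0 ≤ w g) (σ : EdgeConf Λ H) : 0 ≤ wt w σ :=
  Finset.prod_nonneg fun _ _ => hw0 _

variable [Fintype H]

lemma card_charges_eq_le (X : Finset (Plaq Λ)) :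
    Finset.card {σ : EdgeConf Λ H | charges σ = X} ≤
      Fintype.card H ^ X.card * Finset.card {σ : EdgeConf Λ H | charges σ = ∅} := by
  choose c hc₁ hc₂ using exists_flat_eq_on_comb (Λ := Λ) (H := H)
  have h1 : Fintype.card H ^ X.card = (Finset.univ : Finset (X → H)).card := by simp
  rw [h1, ← Finset.card_product]
  refine Finset.card_le_card_of_injOn (fun σ => (fun p : X => holP σ p, c σ)) ?_ ?_
  · intro σ _
    simp [hc₁]
  · intro σ hσ τ hτ hστ
    simp only [Finset.coe_filter, Finset.mem_univ, true_and, Set.mem_ofPred_eq] at hσ hτ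
    simp only [Prod.mk.injEq] at hστ
    refine eq_of_holP_eq_of_comb (fun p => ?_) fun e he => ?_
    · by_cases hp : p ∈ X
      · exact congrFun hστ.1 ⟨p, hp⟩
      · have a : holP σ p = 1 := by rw [← hσ, mem_charges, not_not] at hp; exact hp
        have b : holP τ p = 1 := by rw [← hτ, mem_charges, not_not] at hp; exact hp
        rw [a, b]
    · rw [← hc₂ σ e he, ← hc₂ τ e he, hστ.2]

/-- The total weight of the configurations with given charges. -/
def chargeWeight (w : H → ℝ) (P : Finset (Plaq Λ)) : ℝ :=
  ∑ σ : EdgeConf Λ H, if charges σ = P then wt w σ else 0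

lemma chargeSum_one (w : H → ℝ) (P : Finset (Plaq Λ)) :
    chargeSum w P (fun _ : EdgeConf Λ H => 1) = chargeWeight w P := by
  simp only [chargeSum, chargeTerm, chargeWeight, mul_one]
  rw [Complex.ofReal_sum]
  exact Finset.sum_congr rfl fun σ _ => by split_ifs <;> simp

lemma chargeWeight_nonneg {w : H → ℝ} (hw0 : ∀ g, 0 ≤ w g) (P : Finset (Plaq Λ)) :
    0 ≤ chargeWeight w P :=
  Finset.sum_nonneg fun σ _ => by split_ifs; exacts [wt_nonneg hw0 σ, le_rfl]

lemma chargeWeight_empty {w : H → ℝ} (hw1 : w 1 = 1) :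
    chargeWeight (Λ := Λ) w ∅ = Finset.card {σ : EdgeConf Λ H | charges σ = ∅} := by
  rw [chargeWeight, ← Finset.sum_filter, Finset.card_eq_sum_ones, Nat.cast_sum]
  refine Finset.sum_congr rfl fun σ hσ => ?_
  simp only [Finset.mem_filter, Finset.mem_univ, true_and] at hσ
  have : ∀ p, holP σ p = 1 := fun p => by
    by_contra h
    have := mem_charges.2 h
    simp [hσ] at this
  simp [wt, this, hw1]

lemma chargeWeight_empty_pos {w : H → ℝ} (hw1 : w 1 = 1) : 0 < chargeWeight (Λ := Λ) w ∅ := by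
  rw [chargeWeight_empty hw1, Nat.cast_pos, Finset.card_pos]
  exact ⟨1, by simp [charges, holP_one]⟩

theorem chargeWeight_le {w : H → ℝ} (hw0 : ∀ g, 0 ≤ w g) (hw1 : w 1 = 1) {q : ℝ} (hq0 : 0 ≤ q)
    (hq : ∀ g, g ≠ 1 → w g ≤ q) (X : Finset (Plaq Λ)) :
    chargeWeight w X ≤ (Fintype.card H * q) ^ X.card * chargeWeight (Λ := Λ) w ∅ := by
  have h1 : ∀ σ : EdgeConf Λ H, charges σ = X → wt w σ ≤ q ^ X.card := by
    intro σ hσ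
    rw [wt, ← Finset.prod_subset (Finset.subset_univ X), ← Finset.prod_const]
    · exact Finset.prod_le_prod (fun _ _ => hw0 _) fun p hp =>
        hq _ (mem_charges.1 (hσ ▸ hp))
    · intro p _ hp
      rw [← hσ, mem_charges, not_not] at hp
      rw [hp, hw1]
  calc chargeWeight w X ≤ Finset.card {σ : EdgeConf Λ H | charges σ = X} * q ^ X.card := by
        rw [chargeWeight, ← Finset.sum_filter, ← nsmul_eq_mul]
        exact Finset.sum_le_card_nsmul _ _ _ fun σ hσ => h1 σ (by simpa using hσ)
    _ ≤ (Fintype.card H ^ X.card * Finset.card {σ : EdgeConf Λ H | charges σ = ∅} : ℕ) *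
          q ^ X.card := by
        gcongr
        exact card_charges_eq_le X
    _ = _ := by
        rw [chargeWeight_empty hw1, mul_pow]
        push_cast
        ring

end Counting

section Gap

variable {Λ : Box} {H : Type*} [Group H] {B₁ B₂ : Rect Λ} {X : Finset (Plaq Λ)}

lemma Inseparable.symm (h : Inseparable H B₁ B₂ X) : Inseparable H B₂ B₁ X := fun R hR hX => by
  obtain ⟨h1, h2, h3, h4⟩ := h R hR hX
  exact ⟨h2, h1, fun a b => h3 b a, fun a b => h4 b a⟩

/-- The part of the lattice below a given height in direction `i`. -/
def halfRect (Λ : Box) (i : Fin 4) (c : ℤ) (hΛ : ∀ k, Λ.a k ≤ Λ.b k) (hc : Λ.a i ≤ c)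
    (hc' : c ≤ Λ.b i) : Rect Λ where
  lo := Λ.a
  hi := Function.update Λ.b i c
  lo_le_hi k := by by_cases h : k = i <;> simp_all
  a_le_lo _ := le_rfl
  hi_le_b k := by by_cases h : k = i <;> simp_all

lemma Inseparable.le_card_of_gap (h : Inseparable H B₁ B₂ X) {L : ℕ} {i : Fin 4}
    (hi : B₁.hi i + L ≤ B₂.lo i) : L ≤ X.card + 1 := by
  have key : ∀ c : ℤ, B₁.hi i < c → c < B₂.lo i → ∃ p ∈ X, p.1.1 i = c := by
    intro c hc₁ hc₂
    have hΛ : ∀ k, Λ.a k ≤ Λ.b k := fun k =>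
      (B₁.a_le_lo k).trans ((B₁.lo_le_hi k).trans (B₁.hi_le_b k))
    have h1 := B₁.a_le_lo i
    have h2 := B₁.lo_le_hi i
    have h3 := B₂.hi_le_b i
    have h4 := B₂.lo_le_hi i
    set R := halfRect Λ i c hΛ (by omega) (by omega) with hR
    have hs : ∀ k s, R.RelSide k s → k = i ∧ s = true := by
      intro k s hks
      cases s
      · simp [Rect.RelSide, hR, halfRect] at hks
      · simp only [Rect.RelSide, hR, halfRect, if_true, Function.update_apply] at hks
        by_contra! hcon
        rw [if_neg fun hk => hcon hk rfl] at hks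
        exact hks.false
    have hgood : GoodFor H R := goodFor_of_unique_side hs (by
      simp only [Rect.RelSide, hR, halfRect, if_true, Function.update_self]
      omega)
    by_contra! hX
    refine (h R hgood fun p hp hb => ?_).1 ⟨fun e he => ?_, fun e he heR => ?_⟩
    · obtain ⟨-, k, -, -, s, hks, hk⟩ := hb
      obtain ⟨rfl, rfl⟩ := hs k s hks
      exact hX p hp (by simpa [Rect.sideVal, hR, halfRect] using hk)
    · have aux : ∀ x, B₁.memV x → R.memV x := fun x hx k => by
        have := hx k
        have := B₁.a_le_lo k
        have := B₁.hi_le_b k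
        by_cases hk : k = i
        · subst hk; simp only [hR, halfRect, Function.update_self]; omega
        · simp only [hR, halfRect, Function.update_of_ne hk]; omega
      exact ⟨aux _ he.1, aux _ he.2⟩
    · have a := (heR.1 i).2
      have b := (he.1 i).1
      simp only [hR, halfRect, Function.update_self] at a
      omega
  have hsub : (Finset.range (L - 1)).image (fun t : ℕ => B₁.hi i + 1 + t) ⊆
      X.image fun p => p.1.1 i := by
    intro c hc
    simp only [Finset.mem_image, Finset.mem_range] at hc ⊢
    obtain ⟨t, ht, rfl⟩ := hc
    exact key _ (by omega) (by omega)
  have hcard := (Finset.card_le_card hsub).trans Finset.card_image_le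
  rw [Finset.card_image_of_injective _ fun s t hst => by simpa using hst,
    Finset.card_range] at hcard
  omega

theorem Inseparable.le_card (h : Inseparable H B₁ B₂ X) {L : ℕ}
    (hdist : ∀ x y : Site, B₁.memV x → B₂.memV y → ∃ i, (L : ℤ) ≤ |x i - y i|) :
    L ≤ X.card + 1 := by
  rcases Nat.eq_zero_or_pos L with rfl | hL
  · simp
  let x : Site := fun k =>
    if B₁.hi k < B₂.lo k then B₁.hi k else if B₂.hi k < B₁.lo k then B₁.lo k
    else max (B₁.lo k) (B₂.lo k)
  let y : Site := fun k =>
    if B₁.hi k < B₂.lo k then B₂.lo k else if B₂.hi k < B₁.lo k then B₂.hi k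
    else max (B₁.lo k) (B₂.lo k)
  obtain ⟨i, hi⟩ := hdist x y
    (fun k => by
      have := B₁.lo_le_hi k
      have := B₂.lo_le_hi k
      simp only [x]
      split_ifs <;> omega)
    (fun k => by
      have := B₁.lo_le_hi k
      have := B₂.lo_le_hi k
      simp only [y]
      split_ifs <;> omega)
  simp only [x, y] at hi
  split_ifs at hi with h1 h2
  · exact h.le_card_of_gap (i := i) (by rw [abs_of_nonpos (by omega)] at hi; omega)
  · exact h.symm.le_card_of_gap (i := i) (by rw [abs_of_nonneg (by omega)] at hi; omega)
  · simp only [sub_self, abs_zero] at hi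
    omega

end Gap

section SpanningWalk

variable {α : Type*}

/-- The product of the weights of the steps of the walk `l` started at a given point. -/
def walkCost (u : α → α → ℝ) : α → List α → ℝ
  | _, [] => 1
  | a, b :: l => u a b * walkCost u b l

lemma exists_walk_insert (u : α → α → ℝ) (y z : α) : ∀ (l : List α) (a : α), y ∈ a :: l →
    ∃ l' : List α, l'.length = l.length + 2 ∧ (∀ x, x ∈ a :: l' ↔ x = z ∨ x ∈ a :: l) ∧
      walkCost u a l' = walkCost u a l * (u y z * u z y)
  | l, a, hy => by
    by_cases hya : y = a
    · subst hya
      refine ⟨z :: y :: l, by simp, fun x => ?_, by simp only [walkCost]; ring⟩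
      simp only [List.mem_cons]
      tauto
    · cases l with
      | nil => simp [hya] at hy
      | cons b l =>
        obtain ⟨l', h1, h2, h3⟩ := exists_walk_insert u y z l b
          ((List.mem_cons.1 hy).resolve_left hya)
        refine ⟨b :: l', by simp [h1], fun x => ?_, by simp only [walkCost, h3]; ring⟩
        rw [List.mem_cons, h2, List.mem_cons (a := x) (b := a)]
        tauto

lemma sum_walkCost_le [Fintype α] {u : α → α → ℝ} (hu : ∀ a b, 0 ≤ u a b) {A : ℝ}
    (hA : ∀ a, ∑ b, u a b ≤ A) (n : ℕ) (a : α) :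
    ∑ f : Fin n → α, walkCost u a (List.ofFn f) ≤ A ^ n := by
  induction n generalizing a with
  | zero => simp [walkCost]
  | succ n ih =>
    have hA0 : 0 ≤ A := (Finset.sum_nonneg fun b _ => hu a b).trans (hA a)
    rw [← (Fin.consEquiv fun _ => α).sum_comp, Fintype.sum_prod_type]
    calc _ = ∑ b, u a b * ∑ f : Fin n → α, walkCost u b (List.ofFn f) := by
          simp [Finset.mul_sum, walkCost, Fin.consEquiv]
      _ ≤ ∑ b, u a b * A ^ n := Finset.sum_le_sum fun b _ =>
          mul_le_mul_of_nonneg_left (ih b) (hu a b)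
      _ ≤ A ^ (n + 1) := by
          rw [← Finset.sum_mul, pow_succ']
          exact mul_le_mul_of_nonneg_right (hA a) (pow_nonneg hA0 n)

/-- A walk exploring a finite set greedily, together with the list of the distances travelled. -/
lemma exists_greedy_walk {d : α → α → ℕ} (hd : ∀ x y, d x y = d y x) (u : ℕ → ℝ)
    {S : Finset α} {p : α} (hp : p ∈ S)
    (hS : ∀ Y ⊆ S, Y.Nonempty → Y ≠ S → ∀ j, (∀ y ∈ Y, ∀ z ∈ S \ Y, j < d y z) →
      j ≤ 2 * Y.card) (n : ℕ) (hn : n < S.card) :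
    ∃ (V : Finset α) (l : List α) (R : List ℕ), V ⊆ S ∧ V.card = n + 1 ∧ l.length = 2 * n ∧
      (∀ x, x ∈ p :: l ↔ x ∈ V) ∧ R.length = n ∧
      walkCost (fun x y => u (d x y)) p l = (R.map fun r => u r ^ 2).prod ∧
      ∀ j, ∃ V' ⊂ V, (∀ y ∈ V', ∀ z ∈ S \ V', j < d y z) ∧
        j * R.countP (j < ·) ≤ 2 * V'.card := by
  induction n with
  | zero =>
    exact ⟨{p}, [], [], by simpa, by simp, by simp, by simp, by simp, by simp [walkCost],
      fun j => ⟨∅, by simp, by simp, by simp⟩⟩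
  | succ n ih =>
    obtain ⟨V, l, R, hVS, hVc, hl, hmem, hR, hcost, hsep⟩ := ih (by omega)
    have hpV : p ∈ V := (hmem p).1 (by simp)
    have hne : (V ×ˢ (S \ V)).Nonempty := by
      refine Finset.Nonempty.product ⟨p, hpV⟩ ?_
      rw [← Finset.card_pos, Finset.card_sdiff_of_subset hVS]
      omega
    obtain ⟨⟨y, z⟩, hyz, hmin⟩ := Finset.exists_min_image _ (fun q : α × α => d q.1 q.2) hne
    simp only [Finset.mem_product, Finset.mem_sdiff] at hyz
    obtain ⟨hy, hzS, hzV⟩ := hyz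
    have hmin' : ∀ y' ∈ V, ∀ z' ∈ S \ V, d y z ≤ d y' z' := fun y' hy' z' hz' =>
      hmin (y', z') (Finset.mem_product.2 ⟨hy', hz'⟩)
    obtain ⟨l', h1, h2, h3⟩ := exists_walk_insert (fun x y => u (d x y)) y z l p ((hmem y).2 hy)
    refine ⟨insert z V, l', d y z :: R, Finset.insert_subset hzS hVS, ?_, by omega,
      fun x => by rw [h2, hmem, Finset.mem_insert], by simp [hR], ?_, fun j => ?_⟩
    · rw [Finset.card_insert_of_notMem hzV, hVc]
    · rw [h3, hcost, List.map_cons, List.prod_cons, hd z y]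
      ring
    · obtain ⟨V', hV', hs, hc⟩ := hsep j
      by_cases hj : j < d y z
      · refine ⟨V, Finset.ssubset_insert hzV, fun y' hy' z' hz' =>
          hj.trans_le (hmin' y' hy' z' hz'), ?_⟩
        have := hS (V \ V') (Finset.sdiff_subset.trans hVS)
          (Finset.sdiff_nonempty.2 hV'.2) (fun h => by
            rw [← h] at hzS
            exact hzV (Finset.mem_sdiff.1 hzS).1) j (fun a ha b hb => by
            rw [Finset.mem_sdiff] at ha hb
            by_cases hbV : b ∈ V
            · have hb' : b ∈ V' := by
                by_contra hb'
                exact hb.2 (Finset.mem_sdiff.2 ⟨hbV, hb'⟩)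
              rw [hd]
              exact hs b hb' a (Finset.mem_sdiff.2 ⟨hVS ha.1, ha.2⟩)
            · exact hj.trans_le (hmin' a ha.1 b (Finset.mem_sdiff.2 ⟨hb.1, hbV⟩)))
        rw [Finset.card_sdiff_of_subset hV'.1] at this
        have hle := Finset.card_le_card hV'.1
        rw [List.countP_cons_of_pos (by simpa using hj), mul_add, mul_one]
        omega
      · refine ⟨V', hV'.trans (Finset.ssubset_insert hzV), hs, ?_⟩
        rwa [List.countP_cons_of_neg (by simpa using hj)]

lemma list_sum_map_sum_range (c : ℕ → ℝ) {M : ℕ} : ∀ R : List ℕ, (∀ r ∈ R, r ≤ M) →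
    (R.map fun r => ∑ i ∈ Finset.range r, c i).sum =
      ∑ i ∈ Finset.range M, c i * R.countP (i < ·)
  | [], _ => by simp
  | r :: R, h => by
    rw [List.map_cons, List.sum_cons, list_sum_map_sum_range c R fun s hs => h s (by simp [hs])]
    have hr : r ≤ M := h r (by simp)
    have : Finset.range r = (Finset.range M).filter (· < r) := by
      ext i
      simp only [Finset.mem_range, Finset.mem_filter]
      omega
    rw [this, Finset.sum_filter, ← Finset.sum_add_distrib]
    refine Finset.sum_congr rfl fun i _ => ?_
    by_cases hi : i < r <;> simp [hi]
    ring

lemma sum_range_inv_le (M : ℕ) :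
    ∑ i ∈ Finset.range M, ((i + 1 : ℝ)⁻¹ * (i + 2 : ℝ)⁻¹) ≤ 1 := by
  suffices h : ∑ i ∈ Finset.range M, ((i + 1 : ℝ)⁻¹ * (i + 2 : ℝ)⁻¹) = 1 - (M + 1 : ℝ)⁻¹ by
    rw [h]
    have : (0 : ℝ) ≤ (M + 1 : ℝ)⁻¹ := by positivity
    linarith
  induction M with
  | zero => simp
  | succ M ih =>
    rw [Finset.sum_range_succ, ih]
    push_cast
    field_simp
    ring

lemma sum_log_le {R : List ℕ} {m : ℕ} (hm : R.length ≤ m)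
    (hR : ∀ j, j * R.countP (j < ·) ≤ 2 * m) :
    (R.map fun r : ℕ => Real.log (r + 1)).sum ≤ 3 * m := by
  obtain ⟨M, hM⟩ : ∃ M, ∀ r ∈ R, r ≤ M + 1 :=
    ⟨R.sum, fun r hr => (List.single_le_sum (by simp) r hr).trans (Nat.le_succ _)⟩
  calc (R.map fun r : ℕ => Real.log (r + 1)).sum
      ≤ (R.map fun r => ∑ i ∈ Finset.range r, ((i : ℝ) + 1)⁻¹).sum := by
        refine List.sum_le_sum fun r _ => ?_
        have := log_add_one_le_harmonic r
        simpa [harmonic] using this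
    _ = ∑ i ∈ Finset.range (M + 1), ((i : ℝ) + 1)⁻¹ * R.countP (i < ·) :=
        list_sum_map_sum_range _ R hM
    _ = ∑ i ∈ Finset.range M, ((i : ℝ) + 2)⁻¹ * R.countP (i + 1 < ·) + R.countP (0 < ·) := by
        rw [Finset.sum_range_succ']
        simp [add_assoc, one_add_one_eq_two]
    _ ≤ ∑ i ∈ Finset.range M, 2 * m * (((i : ℝ) + 1)⁻¹ * ((i : ℝ) + 2)⁻¹) + m := by
        refine add_le_add (Finset.sum_le_sum fun i _ => ?_)
          (Nat.cast_le.2 (List.countP_le_length.trans hm))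
        have h : ((i : ℝ) + 1) * R.countP (i + 1 < ·) ≤ 2 * m := by exact_mod_cast hR (i + 1)
        have h' : (R.countP (i + 1 < ·) : ℝ) ≤ 2 * m * ((i : ℝ) + 1)⁻¹ := by
          rw [← div_eq_mul_inv, le_div_iff₀ (by positivity), mul_comm]
          exact h
        calc _ ≤ ((i : ℝ) + 2)⁻¹ * (2 * m * ((i : ℝ) + 1)⁻¹) := by gcongr
          _ = _ := by ring
    _ ≤ 3 * m := by
        rw [← Finset.mul_sum]
        nlinarith [sum_range_inv_le M, (Nat.cast_nonneg m : (0 : ℝ) ≤ m)]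

theorem exists_cheap_walk {d : α → α → ℕ} (hd : ∀ x y, d x y = d y x)
    {S : Finset α} {p : α} (hp : p ∈ S)
    (hS : ∀ Y ⊆ S, Y.Nonempty → Y ≠ S → ∀ j, (∀ y ∈ Y, ∀ z ∈ S \ Y, j < d y z) →
      j ≤ 2 * Y.card) :
    ∃ l : List α, l.length = 2 * (S.card - 1) ∧ (∀ x, x ∈ p :: l ↔ x ∈ S) ∧
      Real.exp (-36) ^ S.card ≤ walkCost (fun x y => ((d x y + 1 : ℝ)⁻¹) ^ 6) p l := by
  have hpos : 0 < S.card := Finset.card_pos.2 ⟨p, hp⟩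
  obtain ⟨V, l, R, hVS, hV, hl, hmem, hR, hcost, hsep⟩ :=
    exists_greedy_walk hd (fun r => ((r + 1 : ℝ)⁻¹) ^ 6) hp hS (S.card - 1) (by omega)
  obtain rfl : V = S := Finset.eq_of_subset_of_card_le hVS (by omega)
  refine ⟨l, hl, hmem, ?_⟩
  have h := sum_log_le (R := R) (m := V.card) (by omega) fun j => by
    obtain ⟨V', hV', -, hc⟩ := hsep j
    have := Finset.card_le_card hV'.1
    omega
  have key : ∀ R : List ℕ, (R.map fun r : ℕ => (((r + 1 : ℝ)⁻¹) ^ 6) ^ 2).prod =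
      Real.exp (-12 * (R.map fun r : ℕ => Real.log (r + 1)).sum) := by
    intro R
    induction R with
    | nil => simp
    | cons r R ih =>
      rw [List.map_cons, List.prod_cons, ih, List.map_cons, List.sum_cons, mul_add, Real.exp_add,
        ← pow_mul]
      congr 1
      have hr : (0 : ℝ) < r + 1 := by positivity
      rw [show -12 * Real.log ((r : ℝ) + 1) = ((6 * 2 : ℕ) : ℝ) * -Real.log (r + 1) by
        push_cast; ring, Real.exp_nat_mul, Real.exp_neg, Real.exp_log hr]
  rw [hcost, key, ← Real.exp_nat_mul]
  exact Real.exp_le_exp.2 (by linarith)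

/-- The number of sets of a given size explored by cheap walks is at most exponential. -/
theorem card_le_of_cheap_walks [Fintype α] {u : α → α → ℝ} (hu : ∀ a b, 0 ≤ u a b) {A ε : ℝ}
    (hA : ∀ a, ∑ b, u a b ≤ A) (p : α) (n : ℕ) (T : Finset (Finset α))
    (hT : ∀ S ∈ T, ∃ l : List α, l.length = n ∧ (∀ x, x ∈ p :: l ↔ x ∈ S) ∧
      ε ≤ walkCost u p l) : T.card * ε ≤ A ^ n := by
  have hnn : ∀ (l : List α) (a : α), 0 ≤ walkCost u a l := by
    intro l
    induction l with
    | nil => simp [walkCost]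
    | cons b l ih => exact fun a => mul_nonneg (hu a b) (ih b)
  have hT' : ∀ S : T, ∃ f : Fin n → α, (∀ x, x ∈ p :: List.ofFn f ↔ x ∈ S.1) ∧
      ε ≤ walkCost u p (List.ofFn f) := by
    rintro ⟨S, hS⟩
    obtain ⟨l, rfl, h⟩ := hT S hS
    exact ⟨l.get, by simpa using h⟩
  choose f hf₁ hf₂ using hT'
  have hinj : Function.Injective f := fun S S' h => by
    ext x
    rw [← hf₁, ← hf₁, h]
  calc T.card * ε = ∑ _S : T, ε := by simp
    _ ≤ ∑ S : T, walkCost u p (List.ofFn (f S)) := Finset.sum_le_sum fun S _ => hf₂ S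
    _ = ∑ g ∈ Finset.univ.image f, walkCost u p (List.ofFn g) := by
        rw [Finset.sum_image fun _ _ _ _ h => hinj h]
    _ ≤ ∑ g : Fin n → α, walkCost u p (List.ofFn g) :=
        Finset.sum_le_sum_of_subset_of_nonneg (Finset.subset_univ _) fun g _ _ => hnn _ _
    _ ≤ A ^ n := sum_walkCost_le hu hA n p

end SpanningWalk

section Entropy

variable {Λ : Box} {H : Type*} [Group H] {B B₁ B₂ : Rect Λ} {X : Finset (Plaq Λ)}

/-- The `ℓ∞` distance between the base points of two plaquettes. -/
def plaqDist (p q : Plaq Λ) : ℕ := Finset.univ.sup fun k => (p.1.1 k - q.1.1 k).natAbs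

lemma plaqDist_le_iff {p q : Plaq Λ} {n : ℕ} :
    plaqDist p q ≤ n ↔ ∀ k, (p.1.1 k - q.1.1 k).natAbs ≤ n := by
  simp [plaqDist, Finset.sup_le_iff]

lemma plaqDist_comm (p q : Plaq Λ) : plaqDist p q = plaqDist q p := by
  simp only [plaqDist, ← Int.natAbs_neg (p.1.1 _ - _), neg_sub]

/-- The finite set of the plaquettes contained in a rectangle. -/
def Rect.plaqs (B : Rect Λ) : Finset (Plaq Λ) := {p | B.plaqIn p}

lemma Rect.mem_plaqs {p : Plaq Λ} : p ∈ B.plaqs ↔ B.plaqIn p := by simp [Rect.plaqs]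

lemma Rect.card_plaqs (B : Rect Λ) : B.plaqs.card = B.plaqCard := by
  rw [Rect.plaqCard, Rect.plaqs, Rect.plaqSet, Nat.card_eq_fintype_card, Fintype.card_subtype]
  rfl

lemma unit_apply_eq (i k : Fin 4) : unit i k = if k = i then 1 else 0 := rfl

lemma exists_plaq_of_edgeIn (hB : B.plaqs.Nonempty) {e : PEdge Λ} (he : B.edgeIn e) :
    ∃ p, B.plaqIn p ∧ p.HasEdge e := by
  obtain ⟨q, hq⟩ := hB
  rw [Rect.mem_plaqs, plaqIn_iff] at hq
  obtain ⟨j, hj, hlt⟩ : ∃ j, j ≠ e.1.2 ∧ B.lo j + 1 ≤ B.hi j := by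
    have hne : q.1.2.1 ≠ q.1.2.2 := q.2.1.ne
    by_cases h : q.1.2.1 = e.1.2
    · refine ⟨q.1.2.2, h ▸ hne.symm, ?_⟩
      have a := hq.1 q.1.2.2
      have b := hq.2 q.1.2.2
      have c := unit_apply_nonneg q.1.2.1 q.1.2.2
      simp only [Pi.add_apply, unit_apply_self] at b
      omega
    · refine ⟨q.1.2.1, h, ?_⟩
      have a := hq.1 q.1.2.1
      have b := hq.2 q.1.2.1
      have c := unit_apply_nonneg q.1.2.2 q.1.2.1
      simp only [Pi.add_apply, unit_apply_self] at b
      omega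
  obtain ⟨⟨x, i⟩, hx⟩ := e
  obtain ⟨he0, he1⟩ := he
  simp only at hj he0 he1 hx
  by_cases hxj : x j + 1 ≤ B.hi j
  · have h1 : B.memV (x + unit i + unit j) := fun k => by
      have a := he0 k
      have b := he1 k
      simp only [Pi.add_apply, unit_apply_eq] at b ⊢
      by_cases hk : k = j
      · subst hk; simp [hj]; omega
      · simpa [hk] using b
    rcases lt_or_gt_of_ne hj with hij | hij
    · obtain ⟨p, hp, hpB⟩ := exists_plaq hij he0 (by rwa [add_right_comm])
      obtain ⟨p, hp'⟩ := p
      subst hp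
      exact ⟨_, hpB, by simp [Plaq.HasEdge, Plaq.e4]⟩
    · obtain ⟨p, hp, hpB⟩ := exists_plaq hij he0 h1
      obtain ⟨p, hp'⟩ := p
      subst hp
      exact ⟨_, hpB, by simp [Plaq.HasEdge, Plaq.e1]⟩
  · obtain ⟨y, rfl⟩ : ∃ y, x = y + unit j := ⟨x - unit j, by simp⟩
    have h0 : B.memV y := fun k => by
      have a := he0 k
      simp only [Pi.add_apply, unit_apply_eq] at a hxj
      by_cases hk : k = j
      · subst hk; simp at a hxj; omega
      · simpa [hk] using a
    rcases lt_or_gt_of_ne hj with hij | hij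
    · obtain ⟨p, hp, hpB⟩ := exists_plaq hij h0 he1
      obtain ⟨p, hp'⟩ := p
      subst hp
      exact ⟨_, hpB, by simp [Plaq.HasEdge, Plaq.e2]⟩
    · obtain ⟨p, hp, hpB⟩ := exists_plaq hij h0 (by rwa [add_right_comm])
      obtain ⟨p, hp'⟩ := p
      subst hp
      exact ⟨_, hpB, by simp [Plaq.HasEdge, Plaq.e3]⟩

/-- The plaquettes of a rectangle are connected through steps of length at most one. -/
lemma exists_adjacent_plaqs {T : Finset (Plaq Λ)} (n : ℕ) {p q : Plaq Λ} (hp : B.plaqIn p)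
    (hq : B.plaqIn q) (hpq : plaqDist p q ≤ n) (hpT : p ∈ T) (hqT : q ∉ T) :
    ∃ y z, B.plaqIn y ∧ B.plaqIn z ∧ y ∈ T ∧ z ∉ T ∧ plaqDist y z ≤ 1 := by
  induction n generalizing p with
  | zero => exact ⟨p, q, hp, hq, hpT, hqT, hpq.trans zero_le_one⟩
  | succ n ih =>
    rw [plaqDist_le_iff] at hpq
    let x : Site := fun k => if p.1.1 k < q.1.1 k then p.1.1 k + 1
      else if q.1.1 k < p.1.1 k then p.1.1 k - 1 else p.1.1 k
    have hp' := plaqIn_iff.1 hp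
    have hq' := plaqIn_iff.1 hq
    obtain ⟨r, hr, hrB⟩ := exists_plaq (R := B) (x := x) (i := q.1.2.1) (j := q.1.2.2) q.2.1
      (fun k => by
        have a := hp'.1 k
        have b := hq'.1 k
        simp only [x]
        split_ifs <;> omega)
      (fun k => by
        have a := hp'.1 k
        have b := hq'.1 k
        have c := hq'.2 k
        have e := unit_apply_nonneg q.1.2.1 k
        have f := unit_apply_nonneg q.1.2.2 k
        simp only [x, Pi.add_apply] at c ⊢
        have hne : q.1.2.1 ≠ q.1.2.2 := q.2.1.ne
        have g : unit q.1.2.1 k + unit q.1.2.2 k ≤ 1 := by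
          simp only [unit_apply_eq]
          split_ifs with h1 h2
          · exact absurd (h1.symm.trans h2) hne
          all_goals simp
        split_ifs <;> omega)
    have hrx : r.1.1 = x := by rw [hr]
    by_cases hrT : r ∈ T
    · refine ih hrB (plaqDist_le_iff.2 fun k => ?_) hrT
      have := hpq k
      rw [hrx]
      simp only [x]
      split_ifs <;> omega
    · refine ⟨p, r, hp, hrB, hpT, hrT, plaqDist_le_iff.2 fun k => ?_⟩
      rw [hrx]
      simp only [x]
      split_ifs <;> omega

lemma Inseparable.exists_near (h : Inseparable H B₁ B₂ X) (h₁ : B₁.plaqs.Nonempty)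
    (h₂ : B₂.plaqs.Nonempty) {T : Finset (Plaq Λ)} (hTS : T ⊆ X ∪ B₁.plaqs ∪ B₂.plaqs)
    (hT : T.Nonempty) (hne : T ≠ X ∪ B₁.plaqs ∪ B₂.plaqs) {lo hi : Site}
    (hbox : ∀ p ∈ T, ∀ k, lo k ≤ p.1.1 k ∧ p.1.1 k ≤ hi k)
    (hlen : ∀ k, hi k - lo k + 3 < Λ.b k - Λ.a k) :
    ∃ z ∈ (X ∪ B₁.plaqs ∪ B₂.plaqs) \ T, ∀ k, lo k - 1 ≤ z.1.1 k ∧ z.1.1 k ≤ hi k + 2 := by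
  have conn : ∀ B : Rect Λ, B.plaqs ⊆ X ∪ B₁.plaqs ∪ B₂.plaqs →
      (∃ z ∈ (X ∪ B₁.plaqs ∪ B₂.plaqs) \ T, ∀ k, lo k - 1 ≤ z.1.1 k ∧ z.1.1 k ≤ hi k + 2) ∨
        B.plaqs ⊆ T ∨ Disjoint B.plaqs T := by
    intro B hB
    by_contra! hcon
    obtain ⟨hcon, hc1, hc2⟩ := hcon
    obtain ⟨q, hq, hqT⟩ := Finset.not_subset.1 hc1
    obtain ⟨p, hp, hpT⟩ := Finset.not_disjoint_iff.1 hc2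
    rw [Rect.mem_plaqs] at hq hp
    obtain ⟨y, z, -, hz, hyT, hzT, hyz⟩ := exists_adjacent_plaqs _ hp hq le_rfl hpT hqT
    obtain ⟨k, hk⟩ := hcon z (Finset.mem_sdiff.2 ⟨hB (Rect.mem_plaqs.2 hz), hzT⟩)
    have a := plaqDist_le_iff.1 hyz k
    have b := hbox y hyT k
    by_cases hk' : lo k - 1 ≤ z.1.1 k
    · have := hk hk'; omega
    · omega
  rcases conn B₁ (Finset.subset_union_right.trans Finset.subset_union_left) with hz | hB₁
  · exact hz
  rcases conn B₂ Finset.subset_union_right with hz | hB₂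
  · exact hz
  clear conn
  by_contra! hcon
  obtain ⟨p₀, hp₀⟩ := hT
  have hp₀a : ∀ k, Λ.a k ≤ p₀.1.1 k ∧ p₀.1.1 k ≤ Λ.b k := p₀.2.2.1
  have hab : ∀ k, Λ.a k < Λ.b k := fun k => by
    have := hlen k; have := hbox p₀ hp₀ k; omega
  let R : Rect Λ :=
    { lo := fun k => max (lo k - 1) (Λ.a k)
      hi := fun k => min (hi k + 2) (Λ.b k)
      lo_le_hi := fun k => by
        have := hp₀a k; have := hbox p₀ hp₀ k; omega
      a_le_lo := fun k => le_max_right _ _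
      hi_le_b := fun k => min_le_right _ _ }
  have hgood : GoodFor H R := by
    refine goodFor_of_forall_side (fun k => ?_) fun k => ?_
    · have := hp₀a k; have := hbox p₀ hp₀ k; have := hab k
      simp only [R]; omega
    · by_cases hk : Λ.a k < lo k - 1
      · exact ⟨false, by simp [Rect.RelSide, R]; omega⟩
      · have := hlen k
        exact ⟨true, by simp [Rect.RelSide, R]; omega⟩
  have hTR : ∀ p ∈ T, R.plaqIn p ∧ ¬ R.bdP p := by
    intro p hp
    have hpa := p.2.2.1
    have hpc := p.2.2.2.2.1
    have hne : p.1.2.1 ≠ p.1.2.2 := p.2.1.ne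
    refine ⟨plaqIn_iff.2 ⟨fun k => ?_, fun k => ?_⟩, ?_⟩
    · have a := hpa k; have b := hbox p hp k
      simp only [R]; omega
    · have a := hpa k; have b := hbox p hp k; have c := hpc k
      have e := unit_apply_nonneg p.1.2.1 k
      have f := unit_apply_nonneg p.1.2.2 k
      have g : unit p.1.2.1 k + unit p.1.2.2 k ≤ 1 := by
        simp only [unit_apply_eq]
        split_ifs with h1 h2
        · exact absurd (h1.symm.trans h2) hne
        all_goals simp
      simp only [R, Pi.add_apply] at c ⊢; omega
    · rintro ⟨-, k, -, -, s, hs, hk⟩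
      have a := hpa k; have b := hbox p hp k
      cases s <;> simp [Rect.RelSide, Rect.sideVal, R] at hs hk <;> omega
  have hnot : ∀ z ∈ X ∪ B₁.plaqs ∪ B₂.plaqs, z ∉ T → ¬ R.plaqIn z := by
    intro z hz hzT hzR
    obtain ⟨k, hk⟩ := hcon z (Finset.mem_sdiff.2 ⟨hz, hzT⟩)
    have a := (plaqIn_iff.1 hzR).1 k
    simp only [R] at a
    by_cases hk' : lo k - 1 ≤ z.1.1 k
    · have := hk hk'; omega
    · omega
  have hin : ∀ B : Rect Λ, B.plaqs.Nonempty → B.plaqs ⊆ T → B.Inside R := by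
    intro B hB hBT e he
    obtain ⟨p, hp, hpe⟩ := exists_plaq_of_edgeIn hB he
    exact edgeIn_of_plaqIn (hTR p (hBT (Rect.mem_plaqs.2 hp))).1 hpe
  have hout : ∀ B : Rect Λ, B.plaqs.Nonempty → B.plaqs ⊆ X ∪ B₁.plaqs ∪ B₂.plaqs →
      Disjoint B.plaqs T → B.Outside R := by
    intro B hB hBS hBT e he heR
    obtain ⟨p, hp, hpe⟩ := exists_plaq_of_edgeIn hB he
    have hp' := Rect.mem_plaqs.2 hp
    exact bdE_of_hasEdge heR hpe (hnot p (hBS hp') (Finset.disjoint_left.1 hBT hp'))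
  obtain ⟨a1, a2, a3, a4⟩ := h R hgood fun p hp hb => by
    by_cases hpT : p ∈ T
    · exact (hTR p hpT).2 hb
    · exact hnot p (by simp [hp]) hpT hb.1
  have hs₁ : B₁.plaqs ⊆ X ∪ B₁.plaqs ∪ B₂.plaqs :=
    Finset.subset_union_right.trans Finset.subset_union_left
  have hs₂ : B₂.plaqs ⊆ X ∪ B₁.plaqs ∪ B₂.plaqs := Finset.subset_union_right
  rcases hB₁ with hB₁ | hB₁ <;> rcases hB₂ with hB₂ | hB₂
  · refine hne (hTS.antisymm fun z hz => ?_)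
    by_contra hzT
    simp only [Finset.mem_union] at hz
    rcases hz with (hz | hz) | hz
    · exact hnot z (by simp [hz]) hzT (a3 (hin B₁ h₁ hB₁) (hin B₂ h₂ hB₂) z hz)
    · exact hzT (hB₁ hz)
    · exact hzT (hB₂ hz)
  · exact a1 ⟨hin B₁ h₁ hB₁, hout B₂ h₂ hs₂ hB₂⟩
  · exact a2 ⟨hin B₂ h₂ hB₂, hout B₁ h₁ hs₁ hB₁⟩
  · have := hTS hp₀
    simp only [Finset.mem_union] at this
    rcases this with (hz | hz) | hz
    · exact a4 (hout B₁ h₁ hs₁ hB₁) (hout B₂ h₂ hs₂ hB₂) p₀ hz (hTR p₀ hp₀).1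
    · exact Finset.disjoint_left.1 hB₁ hz hp₀
    · exact Finset.disjoint_left.1 hB₂ hz hp₀

/-- A part of an inseparable set cannot be too far from the rest. -/
lemma Inseparable.le_two_mul_card (h : Inseparable H B₁ B₂ X) (h₁ : B₁.plaqs.Nonempty)
    (h₂ : B₂.plaqs.Nonempty) {Y : Finset (Plaq Λ)} (hYS : Y ⊆ X ∪ B₁.plaqs ∪ B₂.plaqs)
    (hY : Y.Nonempty) (hne : Y ≠ X ∪ B₁.plaqs ∪ B₂.plaqs) {j : ℕ}
    (hj : ∀ y ∈ Y, ∀ z ∈ (X ∪ B₁.plaqs ∪ B₂.plaqs) \ Y, j < plaqDist y z) :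
    j ≤ 2 * Y.card := by
  obtain ⟨y₀, hy₀⟩ := hY
  obtain ⟨z₀, hz₀⟩ : ((X ∪ B₁.plaqs ∪ B₂.plaqs) \ Y).Nonempty :=
    Finset.sdiff_nonempty.2 fun hs => hne (hYS.antisymm hs)
  have hside : ∀ k, j < Λ.b k - Λ.a k := by
    have h := hj y₀ hy₀ z₀ hz₀
    rw [← not_le, plaqDist_le_iff] at h
    push Not at h
    obtain ⟨k', hk'⟩ := h
    intro k
    have a := y₀.2.2.1 k'
    have b := z₀.2.2.1 k'
    have c := Λ.side_eq k k'
    omega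
  have key : ∀ t : ℕ, 2 * t + 1 ≤ j → ∃ T ⊆ Y, T.card = t + 1 ∧ ∃ lo hi : Site,
      (∀ p ∈ T, ∀ k, lo k ≤ p.1.1 k ∧ p.1.1 k ≤ hi k) ∧ ∀ k, hi k - lo k ≤ 2 * t := by
    intro t ht
    induction t with
    | zero => exact ⟨{y₀}, by simpa using hy₀, by simp, y₀.1.1, y₀.1.1, by simp, by simp⟩
    | succ t ih =>
      obtain ⟨T, hTY, hTc, lo, hi, hbox, hw⟩ := ih (by omega)
      have hTne : T.Nonempty := Finset.card_pos.1 (by omega)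
      obtain ⟨z, hz, hzbox⟩ := h.exists_near h₁ h₂ (hTY.trans hYS) hTne
        (fun hT => hne (hYS.antisymm (hT ▸ hTY))) hbox fun k => by
          have a := hw k; have b := hside k; omega
      rw [Finset.mem_sdiff] at hz
      have hzY : z ∈ Y := by
        by_contra hzY
        obtain ⟨p, hp⟩ := hTne
        refine absurd (hj p (hTY hp) z (Finset.mem_sdiff.2 ⟨hz.1, hzY⟩)) (not_lt.2 ?_)
        rw [plaqDist_le_iff]
        intro k
        have a := hw k; have b := hbox p hp k; have c := hzbox k
        omega
      refine ⟨insert z T, Finset.insert_subset hzY hTY, ?_, fun k => min (lo k) (z.1.1 k),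
        fun k => max (hi k) (z.1.1 k), ?_, ?_⟩
      · rw [Finset.card_insert_of_notMem hz.2, hTc]
      · intro p hp k
        rcases Finset.mem_insert.1 hp with rfl | hp
        · exact ⟨min_le_right _ _, le_max_right _ _⟩
        · exact ⟨(min_le_left _ _).trans (hbox p hp k).1, (hbox p hp k).2.trans (le_max_left _ _)⟩
      · intro k
        obtain ⟨p, hp⟩ := hTne
        have a := hw k; have b := hbox p hp k; have c := hzbox k
        push_cast
        omega
  rcases Nat.eq_zero_or_pos j with rfl | hjpos
  · simp
  · obtain ⟨T, hTY, hTc, -⟩ := key ((j - 1) / 2) (by omega)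
    have := Finset.card_le_card hTY
    omega

end Entropy

section Summation

variable {Λ : Box} {H : Type*} [Group H] {B₁ B₂ : Rect Λ}

lemma card_plaqDist_eq_le (p : Plaq Λ) (r : ℕ) :
    Finset.card {q : Plaq Λ | plaqDist p q = r} ≤ 16 * (2 * r + 1) ^ 4 := by
  have h1 : ((Fintype.piFinset fun k => Finset.Icc (p.1.1 k - r) (p.1.1 k + r)) ×ˢ
      (Finset.univ : Finset (Fin 4 × Fin 4))).card = 16 * (2 * r + 1) ^ 4 := by
    have : ∀ k, (p.1.1 k + r + 1 - (p.1.1 k - r)).toNat = 2 * r + 1 := fun k => by omega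
    simp [Fintype.card_piFinset, this, mul_comm]
  rw [← h1]
  refine Finset.card_le_card_of_injOn Subtype.val ?_ Subtype.val_injective.injOn
  intro q hq
  simp only [Finset.coe_filter, Finset.mem_univ, true_and, Set.mem_ofPred_eq] at hq
  simp only [Finset.coe_product, Set.mem_prod, Finset.mem_coe, Fintype.mem_piFinset,
    Finset.mem_Icc, Finset.mem_univ, and_true]
  intro k
  have := plaqDist_le_iff.1 hq.le k
  omega

lemma sum_plaqDist_le (p : Plaq Λ) :
    ∑ q : Plaq Λ, ((plaqDist p q + 1 : ℝ)⁻¹) ^ 6 ≤ 512 := by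
  obtain ⟨M, hM⟩ : ∃ M, ∀ q : Plaq Λ, plaqDist p q < M :=
    ⟨Finset.univ.sup (plaqDist p) + 1, fun q =>
      Nat.lt_succ_of_le (Finset.le_sup (f := plaqDist p) (Finset.mem_univ q))⟩
  rw [Finset.sum_comp (fun r : ℕ => ((r + 1 : ℝ)⁻¹) ^ 6) (plaqDist p)]
  calc _ ≤ ∑ r ∈ Finset.univ.image (plaqDist p),
        512 * ((r + 1 : ℝ)⁻¹ * (r + 2 : ℝ)⁻¹) := by
        refine Finset.sum_le_sum fun r _ => ?_
        have h1 : (Finset.card {q : Plaq Λ | plaqDist p q = r} : ℝ) ≤ 256 * (r + 1) ^ 4 := by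
          calc (Finset.card {q : Plaq Λ | plaqDist p q = r} : ℝ) ≤ 16 * (2 * r + 1) ^ 4 := by
                exact_mod_cast card_plaqDist_eq_le p r
            _ ≤ 16 * (2 * (r + 1)) ^ 4 := by gcongr; linarith
            _ = _ := by ring
        rw [nsmul_eq_mul]
        calc _ ≤ 256 * (r + 1 : ℝ) ^ 4 * ((r + 1 : ℝ)⁻¹) ^ 6 := by gcongr
          _ = 256 * ((r + 1 : ℝ)⁻¹ * (r + 1 : ℝ)⁻¹) := by field_simp
          _ ≤ 512 * ((r + 1 : ℝ)⁻¹ * (r + 2 : ℝ)⁻¹) := by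
            have : (r + 1 : ℝ)⁻¹ ≤ 2 * (r + 2 : ℝ)⁻¹ := by
              rw [← div_eq_mul_inv, inv_eq_one_div, div_le_div_iff₀ (by positivity) (by positivity)]
              linarith [(Nat.cast_nonneg r : (0 : ℝ) ≤ r)]
            have h2 : (0 : ℝ) ≤ (r + 1 : ℝ)⁻¹ := by positivity
            nlinarith
    _ ≤ ∑ r ∈ Finset.range M, 512 * ((r + 1 : ℝ)⁻¹ * (r + 2 : ℝ)⁻¹) := by
        refine Finset.sum_le_sum_of_subset_of_nonneg (fun r hr => ?_) fun _ _ _ => by positivity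
        obtain ⟨q, -, rfl⟩ := Finset.mem_image.1 hr
        exact Finset.mem_range.2 (hM q)
    _ ≤ 512 := by
        rw [← Finset.mul_sum]
        linarith [sum_range_inv_le M]

/-- The number of inseparable sets grows at most exponentially with their size. -/
lemma card_inseparable_le (h₁ : B₁.plaqs.Nonempty) (h₂ : B₂.plaqs.Nonempty) (m : ℕ)
    (T : Finset (Finset (Plaq Λ)))
    (hT : ∀ S ∈ T, S.card = m ∧ ∃ X, Inseparable H B₁ B₂ X ∧ S = X ∪ B₁.plaqs ∪ B₂.plaqs) :
    T.card * Real.exp (-36) ^ m ≤ 512 ^ (2 * m) := by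
  obtain ⟨p, hp⟩ := h₁
  refine (card_le_of_cheap_walks (fun _ _ => by positivity) sum_plaqDist_le p (2 * (m - 1)) T
    fun S hS => ?_).trans (pow_le_pow_right₀ (by norm_num) (by omega))
  obtain ⟨rfl, X, hX, rfl⟩ := hT S hS
  exact exists_cheap_walk plaqDist_comm (by simp [hp]) fun Y hYS hY hne j hj =>
    hX.le_two_mul_card ⟨p, hp⟩ h₂ hYS hY hne (by convert hj)

lemma sum_inseparable_union_le (h₁ : B₁.plaqs.Nonempty) (h₂ : B₂.plaqs.Nonempty)
    (T : Finset (Finset (Plaq Λ)))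
    (hT : ∀ S ∈ T, ∃ X, Inseparable H B₁ B₂ X ∧ S = X ∪ B₁.plaqs ∪ B₂.plaqs) :
    ∑ S ∈ T, Real.exp (-57) ^ S.card ≤ 1 := by
  obtain ⟨M, hM⟩ : ∃ M, ∀ S ∈ T, S.card < M :=
    ⟨T.sup Finset.card + 1, fun S hS => Nat.lt_succ_of_le (Finset.le_sup hS)⟩
  rw [Finset.sum_comp (fun m : ℕ => Real.exp (-57) ^ m) Finset.card]
  have hK : (2 * 512 ^ 2 : ℝ) * Real.exp (-57) ≤ Real.exp (-36) := by
    have h : (2 : ℝ) ^ 21 ≤ Real.exp 21 := by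
      rw [show (21 : ℝ) = (21 : ℕ) * 1 by norm_num, Real.exp_nat_mul]
      gcongr
      linarith [Real.add_one_le_exp (1 : ℝ)]
    have h2 : Real.exp 21 * Real.exp (-57) = Real.exp (-36) := by
      rw [← Real.exp_add]; norm_num
    rw [← h2]
    gcongr
    norm_num at h ⊢
    linarith
  calc _ ≤ ∑ m ∈ T.image Finset.card, (1 / 2 : ℝ) ^ m := by
        refine Finset.sum_le_sum fun m _ => ?_
        rw [nsmul_eq_mul]
        have h := card_inseparable_le (H := H) h₁ h₂ m {S ∈ T | S.card = m} fun S hS => by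
          rw [Finset.mem_filter] at hS
          exact ⟨hS.2, hT S hS.1⟩
        have hpos := Real.exp_pos (-36)
        have h3 : Real.exp (-57) ≤ Real.exp (-36) * (2 * 512 ^ 2)⁻¹ := by
          rw [← div_eq_mul_inv, le_div_iff₀ (by positivity), mul_comm]
          exact hK
        calc _ ≤ (Finset.card {S ∈ T | S.card = m} : ℝ) *
              (Real.exp (-36) * (2 * 512 ^ 2)⁻¹) ^ m := by gcongr
          _ = (Finset.card {S ∈ T | S.card = m} * Real.exp (-36) ^ m) *
              ((2 * 512 ^ 2)⁻¹) ^ m := by rw [mul_pow]; ring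
          _ ≤ 512 ^ (2 * m) * ((2 * 512 ^ 2)⁻¹) ^ m := by gcongr
          _ = (1 / 2 : ℝ) ^ m := by
            rw [pow_mul, ← mul_pow]
            norm_num
    _ ≤ ∑ m ∈ Finset.range M \ {0}, (1 / 2 : ℝ) ^ m := by
        refine Finset.sum_le_sum_of_subset_of_nonneg (fun m hm => ?_) fun _ _ _ => by positivity
        obtain ⟨S, hS, rfl⟩ := Finset.mem_image.1 hm
        obtain ⟨p, hp⟩ := h₁
        obtain ⟨X, -, rfl⟩ := hT S hS
        simp only [Finset.mem_sdiff, Finset.mem_range, Finset.mem_singleton]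
        refine ⟨hM _ hS, ?_⟩
        rw [Finset.card_eq_zero]
        exact Finset.ne_empty_of_mem (a := p) (by simp [hp])
    _ ≤ 1 := by
        have h : ∀ M : ℕ, ∑ m ∈ Finset.range (M + 1), (1 / 2 : ℝ) ^ m ≤ 2 := fun M => by
          have := geom_sum_eq (x := (1 / 2 : ℝ)) (by norm_num) (M + 1)
          rw [this]
          have : (0 : ℝ) ≤ (1 / 2) ^ (M + 1) := by positivity
          rw [div_le_iff_of_neg (by norm_num)]
          linarith
        rcases M with _ | M
        · simp
        · rw [Finset.sum_sdiff_eq_sub (by simp)]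
          simp only [Finset.sum_singleton, pow_zero]
          linarith [h M]

theorem sum_inseparable_le (h₁ : B₁.plaqs.Nonempty) (h₂ : B₂.plaqs.Nonempty) :
    ∑ X : Finset (Plaq Λ), (if Inseparable H B₁ B₂ X then Real.exp (-57) ^ X.card else 0) ≤
      (2 * Real.exp 57) ^ (B₁.plaqCard + B₂.plaqCard) := by
  set b := B₁.plaqCard + B₂.plaqCard with hb
  set Q := B₁.plaqs ∪ B₂.plaqs with hQ
  have hQb : Q.card ≤ b := by
    rw [hb, ← Rect.card_plaqs, ← Rect.card_plaqs]
    exact Finset.card_union_le _ _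
  set I : Finset (Finset (Plaq Λ)) := {X | Inseparable H B₁ B₂ X} with hI
  have hθ1 : Real.exp (-57) ≤ 1 := Real.exp_le_one_iff.2 (by norm_num)
  rw [← Finset.sum_filter]
  have hinj : Set.InjOn (fun X => (X ∪ Q, X ∩ Q)) (I : Set (Finset (Plaq Λ))) := by
    intro X _ Y _ hXY
    simp only [Prod.mk.injEq] at hXY
    ext x
    have a := congrArg (x ∈ ·) hXY.1
    have c := congrArg (x ∈ ·) hXY.2
    simp only [Finset.mem_union, Finset.mem_inter, eq_iff_iff] at a c
    tauto
  have key : ∑ X ∈ I, Real.exp (-57) ^ (X ∪ Q).card ≤ 2 ^ b := by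
    calc ∑ X ∈ I, Real.exp (-57) ^ (X ∪ Q).card
        = ∑ z ∈ I.image fun X => (X ∪ Q, X ∩ Q), Real.exp (-57) ^ z.1.card := by
          rw [Finset.sum_image hinj]
      _ ≤ ∑ z ∈ (I.image (· ∪ Q)) ×ˢ Q.powerset, Real.exp (-57) ^ z.1.card := by
          refine Finset.sum_le_sum_of_subset_of_nonneg (fun z hz => ?_) fun _ _ _ => by positivity
          obtain ⟨X, hX, rfl⟩ := Finset.mem_image.1 hz
          exact Finset.mem_product.2 ⟨Finset.mem_image_of_mem _ hX,
            Finset.mem_powerset.2 Finset.inter_subset_right⟩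
      _ = 2 ^ Q.card * ∑ S ∈ I.image (· ∪ Q), Real.exp (-57) ^ S.card := by
          rw [Finset.sum_product, Finset.mul_sum]
          simp
      _ ≤ 2 ^ b * 1 := by
          gcongr
          · norm_num
          · refine sum_inseparable_union_le (H := H) h₁ h₂ _ fun S hS => ?_
            obtain ⟨X, hX, rfl⟩ := Finset.mem_image.1 hS
            exact ⟨X, (Finset.mem_filter.1 hX).2, by rw [hQ, Finset.union_assoc]⟩
      _ = 2 ^ b := mul_one _
  have he : Real.exp 57 * Real.exp (-57) = 1 := by rw [← Real.exp_add]; simp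
  calc ∑ X ∈ I, Real.exp (-57) ^ X.card
      ≤ ∑ X ∈ I, Real.exp 57 ^ b * Real.exp (-57) ^ (X ∪ Q).card := by
        refine Finset.sum_le_sum fun X _ => ?_
        have h : (X ∪ Q).card ≤ X.card + b := (Finset.card_union_le _ _).trans (by omega)
        calc Real.exp (-57) ^ X.card = Real.exp 57 ^ b * Real.exp (-57) ^ (X.card + b) := by
              rw [pow_add _ X.card b, mul_left_comm, ← mul_pow, he, one_pow, mul_one]
          _ ≤ _ := mul_le_mul_of_nonneg_left
              (pow_le_pow_of_le_one (Real.exp_pos _).le hθ1 h) (by positivity)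
    _ ≤ (2 * Real.exp 57) ^ b := by
        rw [← Finset.mul_sum, mul_pow, mul_comm]
        gcongr

end Summation

section Duplication

variable {Λ : Box}

lemma hol_map {H K : Type*} [Group H] [Group K] (f : H →* K) (σ : EdgeConf Λ H) {u v : VSite Λ}
    (w : (latticeGraph Λ).Walk u v) : hol (fun e => f (σ e)) w = f (hol σ w) := by
  have h : ∀ x y, oval (fun e => f (σ e)) x y = f (oval σ x y) := fun x y => by
    simp only [oval]
    split_ifs <;> simp
  simp only [hol, map_list_prod, List.map_map, h]
  rfl

lemma holP_map {H K : Type*} [Group H] [Group K] (f : H →* K) (σ : EdgeConf Λ H) (p : Plaq Λ) :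
    holP (fun e => f (σ e)) p = f (holP σ p) := hol_map f σ _

variable {G : Type*} [Group G]

/-- The weight of a pair of independent group elements. -/
def dupWeight (φ : G → ℝ) (g : G × G) : ℝ := φ g.1 * φ g.2

/-- The first component of a configuration of pairs. -/
def confFst (σ : EdgeConf Λ (G × G)) : EdgeConf Λ G := fun e => MonoidHom.fst G G (σ e)

/-- The second component of a configuration of pairs. -/
def confSnd (σ : EdgeConf Λ (G × G)) : EdgeConf Λ G := fun e => MonoidHom.snd G G (σ e)

/-- The difference of an observable between two independent copies. -/
def dupDiff (F : EdgeConf Λ G → ℂ) (σ : EdgeConf Λ (G × G)) : ℂ := F (confFst σ) - F (confSnd σ)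

lemma holP_confFst (σ : EdgeConf Λ (G × G)) (p : Plaq Λ) : holP (confFst σ) p = (holP σ p).1 :=
  holP_map (MonoidHom.fst G G) σ p

lemma holP_confSnd (σ : EdgeConf Λ (G × G)) (p : Plaq Λ) : holP (confSnd σ) p = (holP σ p).2 :=
  holP_map (MonoidHom.snd G G) σ p

lemma wt_dupWeight (φ : G → ℝ) (σ : EdgeConf Λ (G × G)) :
    wt (dupWeight φ) σ = wt φ (confFst σ) * wt φ (confSnd σ) := by
  simp only [wt, dupWeight, holP_confFst, holP_confSnd, Finset.prod_mul_distrib]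

lemma GaugeInvariant.dupDiff {F : EdgeConf Λ G → ℂ} (hF : GaugeInvariant F) :
    GaugeInvariant (dupDiff F) := fun h σ => by
  have h1 := hF (fun x => (h x).1) (confFst σ)
  have h2 := hF (fun x => (h x).2) (confSnd σ)
  simp only [LGT.dupDiff, ← h1, ← h2]
  rfl

lemma LocalIn.dupDiff {B : Rect Λ} {F : EdgeConf Λ G → ℂ} (hF : LocalIn B F) :
    LocalIn B (dupDiff F) := fun σ τ h => by
  simp only [LGT.dupDiff]
  rw [hF (confFst σ) (confFst τ) fun e he => by simp only [confFst, h e he],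
    hF (confSnd σ) (confSnd τ) fun e he => by simp only [confSnd, h e he]]

variable [Fintype G]

lemma sum_confFst_confSnd (f : EdgeConf Λ G → EdgeConf Λ G → ℂ) :
    ∑ σ : EdgeConf Λ (G × G), f (confFst σ) (confSnd σ) = ∑ σ, ∑ τ, f σ τ := by
  rw [← Fintype.sum_prod_type' f]
  exact (Equiv.arrowProdEquivProdArrow (PEdge Λ) (fun _ => G) (fun _ => G)).sum_comp
    fun q => f q.1 q.2

lemma chargeSum_dupDiff (φ : G → ℝ) (Q : Finset (Plaq Λ)) (F : EdgeConf Λ G → ℂ) :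
    chargeSum (dupWeight φ) Q (dupDiff F) = 0 := by
  let s : EdgeConf Λ (G × G) ≃ EdgeConf Λ (G × G) :=
    Equiv.arrowCongr (Equiv.refl _) (Equiv.prodComm G G)
  have hs : ∀ σ p, holP (s σ) p = (holP σ p).swap := fun σ p =>
    holP_map (MulEquiv.prodComm : G × G ≃* G × G).toMonoidHom σ p
  have hc : ∀ σ, charges (s σ) = charges σ := fun σ => by
    ext p
    rw [mem_charges, mem_charges, hs, not_iff_not]
    exact Prod.swap_inj (q := (1, 1))
  have h : chargeSum (dupWeight φ) Q (dupDiff F) = -chargeSum (dupWeight φ) Q (dupDiff F) := by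
    conv_lhs => rw [chargeSum, ← s.sum_comp]
    rw [chargeSum, ← Finset.sum_neg_distrib]
    refine Finset.sum_congr rfl fun σ _ => ?_
    rw [chargeTerm, chargeTerm, hc]
    split_ifs with hQ
    · have h1 : wt (dupWeight φ) (s σ) = wt (dupWeight φ) σ := by
        simp only [wt, hs, dupWeight, Prod.fst_swap, Prod.snd_swap, mul_comm]
      have h2 : dupDiff F (s σ) = -dupDiff F σ := by
        rw [dupDiff, dupDiff, neg_sub]
        rfl
      rw [h1, h2, mul_neg]
    · simp
  exact self_eq_neg.1 h

lemma sum_chargeSum {H : Type*} [Group H] [Fintype H] (w : H → ℝ) (F : EdgeConf Λ H → ℂ) :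
    ∑ P : Finset (Plaq Λ), chargeSum w P F = ∑ σ, (wt w σ : ℂ) * F σ := by
  simp only [chargeSum, chargeTerm]
  rw [Finset.sum_comm]
  simp

lemma sum_chargeWeight {H : Type*} [Group H] [Fintype H] (w : H → ℝ) :
    ∑ P : Finset (Plaq Λ), chargeWeight w P = ∑ σ : EdgeConf Λ H, wt w σ := by
  simp only [chargeWeight]
  rw [Finset.sum_comm]
  simp

lemma norm_chargeSum_le {H : Type*} [Group H] [Fintype H] {w : H → ℝ} (hw0 : ∀ g, 0 ≤ w g)
    {F : EdgeConf Λ H → ℂ} {M : ℝ} (hF : ∀ σ, ‖F σ‖ ≤ M) (P : Finset (Plaq Λ)) :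
    ‖chargeSum w P F‖ ≤ M * chargeWeight w P := by
  rw [chargeSum, chargeWeight, Finset.mul_sum]
  refine (norm_sum_le _ _).trans (Finset.sum_le_sum fun σ _ => ?_)
  rw [chargeTerm]
  split_ifs
  · rw [norm_mul, Complex.norm_real, Real.norm_of_nonneg (wt_nonneg hw0 σ), mul_comm]
    exact mul_le_mul_of_nonneg_right (hF σ) (wt_nonneg hw0 σ)
  · simp

/-- The sum of a mean zero product of observables is controlled by the inseparable sets of
charges. -/
theorem norm_sum_mul_le {H : Type*} [Group H] [Fintype H] {w : H → ℝ}
    (hw : ∀ x g, w (g * x * g⁻¹) = w x) (hw0 : ∀ g, 0 ≤ w g) (hw1 : w 1 = 1) {q : ℝ}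
    (hq0 : 0 ≤ q) (hq : ∀ g, g ≠ 1 → w g ≤ q) {B₁ B₂ : Rect Λ} {F₁ F₂ : EdgeConf Λ H → ℂ}
    (hg₁ : GaugeInvariant F₁) (hg₂ : GaugeInvariant F₂) (hl₁ : LocalIn B₁ F₁)
    (hl₂ : LocalIn B₂ F₂) (hz₁ : ∀ Q, chargeSum w Q F₁ = 0) (hz₂ : ∀ Q, chargeSum w Q F₂ = 0)
    {M : ℝ} (hM0 : 0 ≤ M) (hM : ∀ σ, ‖F₁ σ * F₂ σ‖ ≤ M) :
    ‖∑ σ, (wt w σ : ℂ) * (F₁ σ * F₂ σ)‖ ≤ M * (∑ σ : EdgeConf Λ H, wt w σ) *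
      ∑ X : Finset (Plaq Λ),
        if Inseparable H B₁ B₂ X then (Fintype.card H * q) ^ X.card else 0 := by
  have hpos : 0 < chargeWeight (Λ := Λ) w ∅ := chargeWeight_empty_pos hw1
  have hnn := fun P => chargeWeight_nonneg (Λ := Λ) hw0 P
  have key : ∀ P : Finset (Plaq Λ), ‖chargeSum w P fun σ => F₁ σ * F₂ σ‖ ≤
      ∑ X : Finset (Plaq Λ), if Inseparable H B₁ B₂ X ∧ X ⊆ P then
        M * ((Fintype.card H * q) ^ X.card * chargeWeight w (P \ X)) else 0 := by
    intro P
    have hterm : ∀ X : Finset (Plaq Λ), 0 ≤ if Inseparable H B₁ B₂ X ∧ X ⊆ P then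
        M * ((Fintype.card H * q) ^ X.card * chargeWeight w (P \ X)) else 0 := fun X => by
      split_ifs
      · have := hnn (P \ X)
        positivity
      · exact le_rfl
    rcases chargeSum_mul_eq_zero_or hw (by rw [chargeSum_one]; exact_mod_cast hpos.ne') hg₁ hg₂
      hl₁ hl₂ hz₁ hz₂ P with h | ⟨X, hXP, hX, h⟩
    · rw [h, norm_zero]
      exact Finset.sum_nonneg fun X _ => hterm X
    · simp only [chargeSum_one] at h
      have h' : chargeWeight w P * chargeWeight (Λ := Λ) w ∅ =
          chargeWeight w X * chargeWeight w (P \ X) := by exact_mod_cast h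
      refine le_trans ?_ (Finset.single_le_sum (fun X _ => hterm X) (Finset.mem_univ X))
      rw [if_pos ⟨hX, hXP⟩]
      refine (norm_chargeSum_le hw0 hM P).trans (mul_le_mul_of_nonneg_left ?_ hM0)
      refine le_of_mul_le_mul_right ?_ hpos
      rw [h', mul_right_comm]
      exact mul_le_mul_of_nonneg_right (chargeWeight_le hw0 hw1 hq0 hq X) (hnn _)
  rw [← sum_chargeSum, ← sum_chargeWeight]
  calc _ ≤ ∑ P : Finset (Plaq Λ), ‖chargeSum w P fun σ => F₁ σ * F₂ σ‖ := norm_sum_le _ _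
    _ ≤ _ := Finset.sum_le_sum fun P _ => key P
    _ = ∑ X : Finset (Plaq Λ), ∑ P : Finset (Plaq Λ), if Inseparable H B₁ B₂ X ∧ X ⊆ P then
        M * ((Fintype.card H * q) ^ X.card * chargeWeight w (P \ X)) else 0 := Finset.sum_comm
    _ ≤ ∑ X : Finset (Plaq Λ), if Inseparable H B₁ B₂ X then
        M * (Fintype.card H * q) ^ X.card * ∑ Q : Finset (Plaq Λ), chargeWeight w Q else 0 := by
        refine Finset.sum_le_sum fun X _ => ?_
        by_cases hX : Inseparable H B₁ B₂ X
        · simp only [hX, true_and, if_true]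
          rw [← Finset.sum_filter]
          simp only [← mul_assoc]
          rw [← Finset.mul_sum]
          refine mul_le_mul_of_nonneg_left ?_ (by positivity)
          rw [← Finset.sum_image (f := fun Q => chargeWeight w Q) (g := fun P => P \ X)]
          · exact Finset.sum_le_sum_of_subset_of_nonneg (Finset.subset_univ _) fun Q _ _ => hnn Q
          · intro P hP P' hP' h
            simp only [Finset.coe_filter, Finset.mem_univ, true_and, Set.mem_ofPred_eq] at hP hP'
            rw [← Finset.sdiff_union_of_subset hP, ← Finset.sdiff_union_of_subset hP']
            exact congrArg (· ∪ X) h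
        · simp [hX]
    _ = _ := by
        rw [Finset.mul_sum]
        refine Finset.sum_congr rfl fun X _ => ?_
        split_ifs
        · ring
        · simp

/-- The bound on unnormalized covariances. -/
theorem norm_sum_mul_sub_le {φ : G → ℝ} (hφ : ∀ x g, φ (g * x * g⁻¹) = φ x)
    (hφ0 : ∀ g, 0 ≤ φ g) (hφ1 : φ 1 = 1) {q : ℝ} (hq0 : 0 ≤ q) (hq1 : q ≤ 1)
    (hq : ∀ g, g ≠ 1 → φ g ≤ q) {B₁ B₂ : Rect Λ} {F₁ F₂ : EdgeConf Λ G → ℂ}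
    (hg₁ : GaugeInvariant F₁) (hg₂ : GaugeInvariant F₂) (hl₁ : LocalIn B₁ F₁)
    (hl₂ : LocalIn B₂ F₂) {M₁ M₂ : ℝ} (hM₁ : ∀ σ, ‖F₁ σ‖ ≤ M₁) (hM₂ : ∀ σ, ‖F₂ σ‖ ≤ M₂) :
    ‖(∑ σ : EdgeConf Λ G, (wt φ σ : ℂ)) * (∑ σ, (wt φ σ : ℂ) * (F₁ σ * F₂ σ)) -
        (∑ σ, (wt φ σ : ℂ) * F₁ σ) * ∑ σ, (wt φ σ : ℂ) * F₂ σ‖ ≤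
      2 * M₁ * M₂ * (∑ σ : EdgeConf Λ G, wt φ σ) ^ 2 * ∑ X : Finset (Plaq Λ),
        if Inseparable (G × G) B₁ B₂ X then ((Fintype.card G : ℝ) ^ 2 * q) ^ X.card else 0 := by
  have hM₁0 : 0 ≤ M₁ := (norm_nonneg _).trans (hM₁ 1)
  have hM₂0 : 0 ≤ M₂ := (norm_nonneg _).trans (hM₂ 1)
  have hφle : ∀ g, φ g ≤ 1 := fun g => by
    by_cases h : g = 1
    · rw [h, hφ1]
    · exact (hq g h).trans hq1
  have hdup : ∀ F : EdgeConf Λ G → ℂ, ∀ M : ℝ, (∀ σ, ‖F σ‖ ≤ M) →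
      ∀ σ, ‖dupDiff F σ‖ ≤ 2 * M := fun F M hM σ => by
    have := norm_sub_le (F (confFst σ)) (F (confSnd σ))
    rw [dupDiff]
    linarith [hM (confFst σ), hM (confSnd σ)]
  have main := norm_sum_mul_le (w := dupWeight φ) (q := q) (M := 2 * M₁ * (2 * M₂))
    (fun x g => by
      simp only [dupWeight, Prod.fst_mul, Prod.snd_mul, Prod.fst_inv, Prod.snd_inv, hφ])
    (fun g => mul_nonneg (hφ0 _) (hφ0 _)) (by simp [dupWeight, hφ1]) hq0
    (fun g hg => by
      rw [dupWeight]
      by_cases h : g.1 = 1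
      · have h' : g.2 ≠ 1 := fun h' => hg (Prod.ext h h')
        nlinarith [hφ0 g.1, hφ0 g.2, hφle g.1, hq g.2 h']
      · nlinarith [hφ0 g.1, hφ0 g.2, hφle g.2, hq g.1 h])
    hg₁.dupDiff hg₂.dupDiff hl₁.dupDiff hl₂.dupDiff (fun Q => chargeSum_dupDiff φ Q F₁)
    (fun Q => chargeSum_dupDiff φ Q F₂) (by positivity) fun σ => by
      rw [norm_mul]
      exact mul_le_mul (hdup _ _ hM₁ σ) (hdup _ _ hM₂ σ) (norm_nonneg _) (by positivity)
  have hZ : ∑ σ : EdgeConf Λ (G × G), wt (dupWeight φ) σ =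
      (∑ σ : EdgeConf Λ G, wt φ σ) ^ 2 := by
    have := sum_confFst_confSnd (Λ := Λ) (fun σ τ : EdgeConf Λ G => (wt φ σ : ℂ) * wt φ τ)
    simp only [wt_dupWeight, sq, Finset.sum_mul_sum]
    exact_mod_cast this
  have hcov : ∑ σ : EdgeConf Λ (G × G), (wt (dupWeight φ) σ : ℂ) * (dupDiff F₁ σ * dupDiff F₂ σ) =
      2 * ((∑ σ : EdgeConf Λ G, (wt φ σ : ℂ)) * (∑ σ, (wt φ σ : ℂ) * (F₁ σ * F₂ σ)) -
        (∑ σ, (wt φ σ : ℂ) * F₁ σ) * ∑ σ, (wt φ σ : ℂ) * F₂ σ) := by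
    have := sum_confFst_confSnd (Λ := Λ) (fun σ τ : EdgeConf Λ G => (wt φ σ : ℂ) * wt φ τ *
      ((F₁ σ - F₁ τ) * (F₂ σ - F₂ τ)))
    simp only [wt_dupWeight, dupDiff, Complex.ofReal_mul]
    rw [this]
    have e : ∀ σ τ : EdgeConf Λ G, (wt φ σ : ℂ) * wt φ τ * ((F₁ σ - F₁ τ) * (F₂ σ - F₂ τ)) =
        (wt φ σ * (F₁ σ * F₂ σ)) * wt φ τ + wt φ σ * (wt φ τ * (F₁ τ * F₂ τ)) -
          (wt φ σ * F₁ σ) * (wt φ τ * F₂ τ) - (wt φ σ * F₂ σ) * (wt φ τ * F₁ τ) := by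
      intros; ring
    simp only [e, Finset.sum_sub_distrib, Finset.sum_add_distrib, ← Finset.sum_mul_sum]
    ring
  rw [hcov, hZ, norm_mul, Complex.norm_ofNat, Fintype.card_prod] at main
  push_cast at main
  rw [← sq] at main
  linarith

end Duplication

section Character

variable {G : Type*} [Group G] {d : ℕ} (ρ : G →* Matrix.unitaryGroup (Fin d) ℂ)

lemma chi_conj (x g : G) : chi ρ (g * x * g⁻¹) = chi ρ x := by
  simp only [chi, map_mul, Submonoid.coe_mul]
  rw [Matrix.trace_mul_comm, ← mul_assoc, ← Submonoid.coe_mul, ← map_mul, inv_mul_cancel, map_one,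
    OneMemClass.coe_one, one_mul]

lemma re_chi_one_sub_nonneg (g : G) : 0 ≤ (chi ρ 1 - chi ρ g).re := by
  simp only [chi, map_one, OneMemClass.coe_one, Matrix.trace, Matrix.diag, Matrix.one_apply_eq]
  rw [← Finset.sum_sub_distrib, Complex.re_sum]
  refine Finset.sum_nonneg fun i _ => ?_
  have := (Complex.re_le_norm _).trans (entry_norm_bound_of_unitary (ρ g).2 i i)
  simpa using this

lemma DeltaG_nonneg : 0 ≤ DeltaG G (chi ρ) := by
  refine Real.sInf_nonneg ?_
  rintro _ ⟨g, -, rfl⟩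
  exact re_chi_one_sub_nonneg ρ g

lemma DeltaG_le {g : G} (hg : g ≠ 1) : DeltaG G (chi ρ) ≤ (chi ρ 1 - chi ρ g).re := by
  refine csInf_le ⟨0, ?_⟩ ⟨g, hg, rfl⟩
  rintro _ ⟨g, -, rfl⟩
  exact re_chi_one_sub_nonneg ρ g

lemma phiB_conj (β : ℝ) (x g : G) : phiB (chi ρ) β (g * x * g⁻¹) = phiB (chi ρ) β x := by
  simp only [phiB, chi_conj]

lemma phiB_one (χ : G → ℂ) (β : ℝ) : phiB χ β 1 = 1 := by simp [phiB]

lemma phiB_le {β : ℝ} (hβ : 0 ≤ β) {g : G} (hg : g ≠ 1) :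
    phiB (chi ρ) β g ≤ Real.exp (-(β * DeltaG G (chi ρ))) :=
  Real.exp_le_exp.2 (neg_le_neg (mul_le_mul_of_nonneg_left (DeltaG_le ρ hg) hβ))

end Character

section Covariance

variable {Λ : Box} {G : Type*} [Group G]

lemma exp_neg_action (χ : G → ℂ) (β : ℝ) (σ : EdgeConf Λ G) :
    Real.exp (-(β * action Λ χ σ)) = wt (phiB χ β) σ := by
  rw [action, finsum_eq_sum_of_fintype, Finset.mul_sum, ← Finset.sum_neg_distrib, Real.exp_sum]
  rfl

lemma muCov_comm (χ : G → ℂ) (β : ℝ) (F₁ F₂ : EdgeConf Λ G → ℂ) :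
    muCov Λ χ β F₁ F₂ = muCov Λ χ β F₂ F₁ := by
  simp only [muCov, mul_comm]

variable [Fintype G]

lemma muZ_eq_sum (χ : G → ℂ) (β : ℝ) :
    muZ Λ G χ β = ∑ σ : EdgeConf Λ G, wt (phiB χ β) σ := by
  simp only [muZ, finsum_eq_sum_of_fintype, exp_neg_action]

lemma muZ_pos (χ : G → ℂ) (β : ℝ) : 0 < muZ Λ G χ β := by
  rw [muZ, finsum_eq_sum_of_fintype]
  exact Finset.sum_pos (fun _ _ => Real.exp_pos _) Finset.univ_nonempty

lemma muE_eq_sum_div (χ : G → ℂ) (β : ℝ) (F : EdgeConf Λ G → ℂ) :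
    muE Λ χ β F = (∑ σ, (wt (phiB χ β) σ : ℂ) * F σ) / muZ Λ G χ β := by
  rw [muE, finsum_eq_sum_of_fintype, Finset.sum_div]
  refine Finset.sum_congr rfl fun σ _ => ?_
  rw [muP, exp_neg_action]
  push_cast
  ring

lemma muE_const (χ : G → ℂ) (β : ℝ) (c : ℂ) : muE Λ χ β (fun _ => c) = c := by
  have h : (muZ Λ G χ β : ℂ) ≠ 0 := by exact_mod_cast (muZ_pos χ β).ne'
  rw [muE_eq_sum_div, ← Finset.sum_mul, ← Complex.ofReal_sum, ← muZ_eq_sum,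
    mul_div_cancel_left₀ _ h]

lemma norm_muE_le (χ : G → ℂ) (β : ℝ) {F : EdgeConf Λ G → ℂ} {M : ℝ} (hF : ∀ σ, ‖F σ‖ ≤ M) :
    ‖muE Λ χ β F‖ ≤ M := by
  have h := muZ_pos (Λ := Λ) χ β
  rw [muE_eq_sum_div, norm_div, Complex.norm_real, Real.norm_of_nonneg h.le, div_le_iff₀ h,
    muZ_eq_sum, Finset.mul_sum]
  refine (norm_sum_le _ _).trans (Finset.sum_le_sum fun σ _ => ?_)
  have hw : 0 ≤ wt (phiB χ β) σ := wt_nonneg (fun _ => (Real.exp_pos _).le) σ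
  rw [norm_mul, Complex.norm_real, Real.norm_of_nonneg hw, mul_comm]
  exact mul_le_mul_of_nonneg_right (hF σ) hw

lemma norm_muCov_le_two_mul (χ : G → ℂ) (β : ℝ) {F₁ F₂ : EdgeConf Λ G → ℂ} {M₁ M₂ : ℝ}
    (hM₁ : ∀ σ, ‖F₁ σ‖ ≤ M₁) (hM₂ : ∀ σ, ‖F₂ σ‖ ≤ M₂) :
    ‖muCov Λ χ β F₁ F₂‖ ≤ 2 * (M₁ * M₂) := by
  have h0 : 0 ≤ M₁ := (norm_nonneg _).trans (hM₁ 1)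
  have h₁₂ := norm_muE_le χ β (F := fun σ => F₁ σ * F₂ σ) fun σ => by
    rw [norm_mul]
    exact mul_le_mul (hM₁ σ) (hM₂ σ) (norm_nonneg _) h0
  have h := mul_le_mul (norm_muE_le χ β hM₁) (norm_muE_le χ β hM₂) (norm_nonneg _) h0
  rw [← norm_mul] at h
  rw [muCov]
  linarith [norm_sub_le (muE Λ χ β fun σ => F₁ σ * F₂ σ) (muE Λ χ β F₁ * muE Λ χ β F₂)]

lemma muCov_const_left (χ : G → ℂ) (β : ℝ) (c : ℂ) (F : EdgeConf Λ G → ℂ) :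
    muCov Λ χ β (fun _ => c) F = 0 := by
  rw [muCov, muE_const, muE_eq_sum_div, muE_eq_sum_div, mul_div_assoc', Finset.mul_sum]
  simp only [mul_left_comm, sub_self]

lemma norm_muCov_le {d : ℕ} (ρ : G →* Matrix.unitaryGroup (Fin d) ℂ) {β : ℝ} (hβ : 0 ≤ β)
    {B₁ B₂ : Rect Λ} {F₁ F₂ : EdgeConf Λ G → ℂ} (hg₁ : GaugeInvariant F₁)
    (hg₂ : GaugeInvariant F₂) (hl₁ : LocalIn B₁ F₁) (hl₂ : LocalIn B₂ F₂) {M₁ M₂ : ℝ}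
    (hM₁ : ∀ σ, ‖F₁ σ‖ ≤ M₁) (hM₂ : ∀ σ, ‖F₂ σ‖ ≤ M₂) :
    ‖muCov Λ (chi ρ) β F₁ F₂‖ ≤ 2 * M₁ * M₂ * ∑ X : Finset (Plaq Λ),
      if Inseparable (G × G) B₁ B₂ X then
        ((Fintype.card G : ℝ) ^ 2 * Real.exp (-(β * DeltaG G (chi ρ)))) ^ X.card else 0 := by
  have hq1 : Real.exp (-(β * DeltaG G (chi ρ))) ≤ 1 :=
    Real.exp_le_one_iff.2 (neg_nonpos.2 (mul_nonneg hβ (DeltaG_nonneg ρ)))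
  have main := norm_sum_mul_sub_le (phiB_conj ρ β) (fun _ => (Real.exp_pos _).le)
    (phiB_one _ _) (Real.exp_pos _).le hq1 (fun g hg => phiB_le ρ hβ hg) hg₁ hg₂ hl₁ hl₂ hM₁ hM₂
  have hZ := muZ_pos (Λ := Λ) (chi ρ) β
  have hZ' : (muZ Λ G (chi ρ) β : ℂ) ≠ 0 := by exact_mod_cast hZ.ne'
  rw [← Complex.ofReal_sum, ← muZ_eq_sum] at main
  have hcov : muCov Λ (chi ρ) β F₁ F₂ =
      ((muZ Λ G (chi ρ) β : ℂ) * (∑ σ, (wt (phiB (chi ρ) β) σ : ℂ) * (F₁ σ * F₂ σ)) -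
        (∑ σ, (wt (phiB (chi ρ) β) σ : ℂ) * F₁ σ) * ∑ σ, (wt (phiB (chi ρ) β) σ : ℂ) * F₂ σ) /
        (muZ Λ G (chi ρ) β : ℂ) ^ 2 := by
    rw [muCov, muE_eq_sum_div, muE_eq_sum_div, muE_eq_sum_div]
    field_simp
  rw [hcov, norm_div, norm_pow, Complex.norm_real, Real.norm_of_nonneg hZ.le,
    div_le_iff₀ (pow_pos hZ 2)]
  linarith

end Covariance

section LoopObservables

variable {Λ : Box} {G : Type*} [Group G] {k : ℕ} {f : (Fin k → G) → ℂ}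
  {γ : Fin k → Σ u : VSite Λ, (latticeGraph Λ).Walk u u} {B : Rect Λ}

lemma ConjInvariant.gaugeInvariant (hf : ConjInvariant f) :
    GaugeInvariant fun σ : EdgeConf Λ G => f fun j => hol σ (γ j).2 := fun h σ => by
  have := hf (fun j => hol σ (γ j).2) fun j => (h (γ j).1)⁻¹
  simpa only [hol_gaugeAct, inv_inv] using this

lemma localIn_loops (hγ : ∀ j, WalkInRect B (γ j).2) :
    LocalIn B fun σ : EdgeConf Λ G => f fun j => hol σ (γ j).2 := fun _ _ h =>
  congrArg f (funext fun j => hol_congr_of_walkInRect h _ (hγ j))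

lemma loops_eq_of_plaqs_empty (hγ : ∀ j, WalkInRect B (γ j).2) (hB : B.plaqs = ∅) :
    (fun σ : EdgeConf Λ G => f fun j => hol σ (γ j).2) = fun _ => f 1 := by
  funext σ
  have hflat : FlatIn B σ := fun p hp => by simpa [hB] using B.mem_plaqs.2 hp
  obtain ⟨h, hh⟩ := hflat.exists_trivBy
  exact congrArg f (funext fun j => by rw [hh.hol_eq _ (hγ j), inv_mul_cancel, Pi.one_apply])

lemma norm_le_supNorm {α : Type*} [Finite α] (f : α → ℂ) (x : α) : ‖f x‖ ≤ supNorm f :=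
  le_ciSup (f := fun x => ‖f x‖) (Set.finite_range _).bddAbove x

end LoopObservables

lemma two_mul_exp_le {n : ℝ} (hn : 2 ≤ n) : 2 * Real.exp 57 ≤ 4 * 10 ^ 24 * n ^ 2 := by
  have h : Real.exp 57 ≤ 8 * 10 ^ 24 := by
    have h1 : Real.exp 57 = Real.exp 1 ^ 57 := by rw [← Real.exp_nat_mul]; norm_num
    rw [h1]
    refine (pow_le_pow_left₀ (Real.exp_pos 1).le Real.exp_one_lt_d9.le 57).trans ?_
    norm_num
  nlinarith

/-- The smallness of the activity at large inverse coupling. -/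
lemma sq_mul_exp_neg_le {n t : ℝ} (hn : 0 < n) (ht : 114 + 4 * Real.log n ≤ t) :
    n ^ 2 * Real.exp (-t) ≤ Real.exp (-57) * Real.exp (-(t / 2)) := by
  have h : n ^ 2 = Real.exp (2 * Real.log n) := by
    rw [two_mul, Real.exp_add, Real.exp_log hn, sq]
  rw [h, ← Real.exp_add, ← Real.exp_add]
  exact Real.exp_le_exp.2 (by linarith)

/-- Theorem 1.1: exponential decay of correlations for conjugacy invariant
functions of Wilson loop observables in rectangles `B₁, B₂` at `ℓ∞` distance at least `L`,
at inverse coupling `β ≥ (1/Δ_G)(114 + 4 log |G|)`. -/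
theorem decay_of_correlations
    (Λ : Box) (G : Type*) [Group G] [Fintype G] [Nontrivial G]
    {d : ℕ} (ρ : G →* Matrix.unitaryGroup (Fin d) ℂ)
    (β : ℝ) (hβ : (1 / DeltaG G (chi ρ)) * (114 + 4 * Real.log (Nat.card G)) ≤ β)
    (L : ℕ) (B₁ B₂ : Rect Λ)
    (hdist : ∀ x y : Site, B₁.memV x → B₂.memV y → ∃ i, (L : ℤ) ≤ |x i - y i|)
    (k₁ k₂ : ℕ) (hk₁ : 1 ≤ k₁) (hk₂ : 1 ≤ k₂)
    (f₁ : (Fin k₁ → G) → ℂ) (f₂ : (Fin k₂ → G) → ℂ)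
    (hf₁ : ConjInvariant f₁) (hf₂ : ConjInvariant f₂)
    (γ₁ : Fin k₁ → Σ u : VSite Λ, (latticeGraph Λ).Walk u u)
    (γ₂ : Fin k₂ → Σ u : VSite Λ, (latticeGraph Λ).Walk u u)
    (hγ₁ : ∀ j, WalkInRect B₁ (γ₁ j).2) (hγ₂ : ∀ j, WalkInRect B₂ (γ₂ j).2) :
    ‖muCov Λ (chi ρ) β
        (fun σ => f₁ fun j => hol σ (γ₁ j).2)
        (fun σ => f₂ fun j => hol σ (γ₂ j).2)‖
      ≤ 4 * (4 * 10 ^ 24 * (Nat.card G : ℝ) ^ 2) ^ (B₁.plaqCard + B₂.plaqCard)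
          * supNorm f₁ * supNorm f₂
          * Real.exp (-(β / 2) * DeltaG G (chi ρ) * ((L : ℝ) - 1)) := by
  have hn : (2 : ℝ) ≤ Fintype.card G := by exact_mod_cast Fintype.one_lt_card (α := G)
  rw [Nat.card_eq_fintype_card] at hβ ⊢
  have hlog : 0 ≤ Real.log (Fintype.card G) := Real.log_nonneg (by linarith)
  have hΔ := DeltaG_nonneg ρ
  have hβ0 : 0 ≤ β := le_trans (by positivity) hβ
  have hM₁ := fun σ : EdgeConf Λ G => norm_le_supNorm f₁ fun j => hol σ (γ₁ j).2
  have hM₂ := fun σ : EdgeConf Λ G => norm_le_supNorm f₂ fun j => hol σ (γ₂ j).2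
  have hs₁ : 0 ≤ supNorm f₁ := (norm_nonneg _).trans (hM₁ 1)
  have hs₂ : 0 ≤ supNorm f₂ := (norm_nonneg _).trans (hM₂ 1)
  rcases B₁.plaqs.eq_empty_or_nonempty with h₁ | h₁
  · rw [loops_eq_of_plaqs_empty hγ₁ h₁, muCov_const_left, norm_zero]
    positivity
  rcases B₂.plaqs.eq_empty_or_nonempty with h₂ | h₂
  · rw [loops_eq_of_plaqs_empty hγ₂ h₂, muCov_comm, muCov_const_left, norm_zero]
    positivity
  have hC := two_mul_exp_le hn
  set C : ℝ := 4 * 10 ^ 24 * (Fintype.card G : ℝ) ^ 2 with hCdef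
  set N := B₁.plaqCard + B₂.plaqCard
  set r : ℝ := Real.exp (-(β / 2) * DeltaG G (chi ρ) * ((L : ℝ) - 1)) with hr
  by_cases htriv : DeltaG G (chi ρ) = 0 ∨ L ≤ 1
  · have hC1 : 1 ≤ C ^ N := one_le_pow₀ (by nlinarith [Real.add_one_le_exp 57])
    have hr1 : 1 ≤ r := by
      rw [hr, Real.one_le_exp_iff]
      rcases htriv with h | h
      · simp [h]
      · have hL : (L : ℝ) ≤ 1 := by exact_mod_cast h
        exact mul_nonneg_of_nonpos_of_nonpos
          (mul_nonpos_of_nonpos_of_nonneg (by linarith) hΔ) (by linarith)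
    refine (norm_muCov_le_two_mul (chi ρ) β hM₁ hM₂).trans ?_
    have hm : 0 ≤ supNorm f₁ * supNorm f₂ := mul_nonneg hs₁ hs₂
    have hCr : 1 ≤ C ^ N * r := one_le_mul_of_one_le_of_one_le hC1 hr1
    nlinarith [mul_le_mul_of_nonneg_left hCr hm]
  push Not at htriv
  obtain ⟨hΔ0, hL⟩ := htriv
  have hΔpos : 0 < DeltaG G (chi ρ) := lt_of_le_of_ne hΔ (Ne.symm hΔ0)
  have hβΔ : 114 + 4 * Real.log (Fintype.card G) ≤ β * DeltaG G (chi ρ) := by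
    rwa [one_div, ← div_eq_inv_mul, div_le_iff₀ hΔpos] at hβ
  have hact := sq_mul_exp_neg_le (by linarith) hβΔ
  have hsum : (∑ X : Finset (Plaq Λ), if Inseparable (G × G) B₁ B₂ X then
      ((Fintype.card G : ℝ) ^ 2 * Real.exp (-(β * DeltaG G (chi ρ)))) ^ X.card else 0) ≤
      C ^ N * r := by
    calc _ ≤ ∑ X : Finset (Plaq Λ),
          (if Inseparable (G × G) B₁ B₂ X then Real.exp (-57) ^ X.card else 0) * r := by
          refine Finset.sum_le_sum fun X _ => ?_
          split_ifs with hX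
          · refine (pow_le_pow_left₀ (by positivity) hact _).trans ?_
            rw [mul_pow]
            refine mul_le_mul_of_nonneg_left ?_ (by positivity)
            rw [← Real.exp_nat_mul, hr, Real.exp_le_exp]
            have hcard : (L : ℝ) ≤ X.card + 1 := by exact_mod_cast hX.le_card hdist
            nlinarith [mul_nonneg hβ0 hΔ]
          · simp
      _ ≤ (2 * Real.exp 57) ^ N * r := by
          rw [← Finset.sum_mul]
          exact mul_le_mul_of_nonneg_right (sum_inseparable_le h₁ h₂) (Real.exp_pos _).le
      _ ≤ _ := mul_le_mul_of_nonneg_right (pow_le_pow_left₀ (by positivity) hC _)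
          (Real.exp_pos _).le
  refine (norm_muCov_le ρ hβ0 hf₁.gaugeInvariant hf₂.gaugeInvariant (localIn_loops hγ₁)
    (localIn_loops hγ₂) hM₁ hM₂).trans ?_
  have hm : 0 ≤ 2 * supNorm f₁ * supNorm f₂ := by positivity
  refine (mul_le_mul_of_nonneg_left hsum hm).trans ?_
  have : 0 ≤ C ^ N * r := by positivity
  nlinarith [mul_nonneg hm this]

end LGT
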